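/- arXiv:2512.22498 — 7 statements merged into one kernel-verified Lean document; each statement's English description precedes it below -/
import Mathlib

section
/- Limit lemma for the half-line problem (Lemma 5.1). Assume 1/k ∈ L¹(ℝ⁺). For each n ∈ ℕ let x_n ∈ W^{1,1}([0, n]) be a solution of the Dirichlet problem (Φ(k(t)x_n'(t)))' = f(t, x_n(t), x_n'(t)) a.e. on [0, n], x_n(0) = ν₁, x_n(n) = ν₂. Suppose there exist a constant C ∈ ℝ, a compact interval K ⊂ J on which Φ is strictly monotone, and a function ψ ∈ L¹(ℝ⁺), such that for every n ∈ ℕ: |x_n(t) − ν₁| ≤ C and k(t)x_n'(t) ∈ K for a.e. t ∈ [0, n], and |(Φ(k(t)x_n'(t)))'| ≤ ψ(t) for a.e. t ∈ [0, n]. Then the half-line problem (Φ(k(t)x'(t)))' = f(t, x(t), x'(t)) a.e. on [0, +∞), x(0) = ν₁, lim_{t→+∞} x(t) = ν₂, admits a solution x ∈ W^{1,1}_loc([0, +∞)) satisfying |x(t) − ν₁| ≤ C for all t ≥ 0 and k(t)x'(t) ∈ K for a.e. t ≥ 0. -/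
open MeasureTheory Set Filter

/-- A sequence in a compact set whose image under a continuous injective map converges is itself
convergent. -/
lemma IsCompact.exists_tendsto_of_injOn {K : Set ℝ} (hK : IsCompact K) {Φ : ℝ → ℝ}
    (hc : ContinuousOn Φ K) (hinj : InjOn Φ K) {z : ℕ → ℝ} (hz : ∀ᶠ n in atTop, z n ∈ K) {y : ℝ}
    (hy : Tendsto (fun n => Φ (z n)) atTop (nhds y)) :
    ∃ l ∈ K, Tendsto z atTop (nhds l) ∧ Φ l = y := by
  have key : ∀ {l : ℝ} {u : ℕ → ℕ}, l ∈ K → Tendsto u atTop atTop →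
      Tendsto (fun n => z (u n)) atTop (nhds l) → Φ l = y := by
    intro l u hl hu hlim
    have h1 : Tendsto (fun n => z (u n)) atTop (nhdsWithin l K) :=
      tendsto_nhdsWithin_iff.2 ⟨hlim, hu.eventually hz⟩
    exact tendsto_nhds_unique ((hc l hl).tendsto.comp h1) (hy.comp hu)
  obtain ⟨l, hl, u, hu, hlim⟩ := hK.tendsto_subseq' hz.frequently
  have hΦl := key hl hu.tendsto_atTop hlim
  refine ⟨l, hl, ?_, hΦl⟩
  refine tendsto_of_subseq_tendsto fun v hv => ?_
  obtain ⟨l', hl', u', hu', hlim'⟩ := hK.tendsto_subseq' (hv.eventually hz).frequently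
  have hΦl' := key (u := v ∘ u') hl' (hv.comp hu'.tendsto_atTop) hlim'
  obtain rfl : l' = l := hinj hl' hl (hΦl'.trans hΦl.symm)
  exact ⟨u', hlim'⟩

/-- A uniformly bounded sequence of real functions with a common modulus of continuity
has a pointwise convergent subsequence. -/
lemma exists_subseq_tendsto_of_equicontinuous {Y : ℕ → ℝ → ℝ} {G : ℝ → ℝ} {M : ℝ}
    (hG : Continuous G) (hM : ∀ n t, |Y n t| ≤ M)
    (hY : ∀ n s t, |Y n t - Y n s| ≤ |G t - G s|) :
    ∃ φ : ℕ → ℕ, StrictMono φ ∧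
      ∃ y : ℝ → ℝ, ∀ t, Tendsto (fun n => Y (φ n) t) atTop (nhds (y t)) := by
  have hcpt : IsCompact (Set.pi univ fun _ : ℚ => Icc (-M) M) :=
    isCompact_univ_pi fun _ => isCompact_Icc
  obtain ⟨l, -, φ, hφ, hlim⟩ := hcpt.tendsto_subseq (x := fun n (q : ℚ) => Y n q)
    (fun n q _ => abs_le.1 (hM n q))
  rw [tendsto_pi_nhds] at hlim
  refine ⟨φ, hφ, ?_⟩
  suffices h : ∀ t, ∃ y, Tendsto (fun n => Y (φ n) t) atTop (nhds y) by
    choose y hy using h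
    exact ⟨y, hy⟩
  intro t
  refine cauchySeq_tendsto_of_complete (Metric.cauchySeq_iff.2 fun ε hε => ?_)
  have hopen : IsOpen {s | |G t - G s| < ε / 3} :=
    isOpen_lt (by fun_prop) continuous_const
  obtain ⟨q, hq⟩ := Rat.denseRange_cast.exists_mem_open hopen ⟨t, by simp; positivity⟩
  obtain ⟨N, hN⟩ := Metric.cauchySeq_iff.1 (hlim q).cauchySeq (ε / 3) (by positivity)
  refine ⟨N, fun m hm n hn => ?_⟩
  have h1 := hN m hm n hn
  have h2 := (hY (φ m) q t).trans_lt hq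
  have h3 := (hY (φ n) q t).trans_lt hq
  simp only [Real.dist_eq, Function.comp_apply, abs_lt] at h1 h2 h3 ⊢
  constructor <;> linarith [h1.1, h1.2, h2.1, h2.2, h3.1, h3.2]

lemma integrable_of_tendsto_of_dominated {F : ℕ → ℝ → ℝ} {h g : ℝ → ℝ} (hg : Integrable g)
    (hF : ∀ n, Integrable (F n)) (hb : ∀ n, ∀ᵐ t, |F n t| ≤ g t)
    (hlim : ∀ᵐ t, Tendsto (fun n => F n t) atTop (nhds (h t))) : Integrable h := by
  refine hg.mono' (aestronglyMeasurable_of_tendsto_ae atTop (fun n => (hF n).1) hlim) ?_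
  filter_upwards [ae_all_iff.2 hb, hlim] with t hb hlim
  exact le_of_tendsto hlim.abs (Eventually.of_forall hb)

lemma tendsto_intervalIntegral_of_dominated {F : ℕ → ℝ → ℝ} {h g : ℝ → ℝ} (hg : Integrable g)
    (hF : ∀ n, Integrable (F n)) (hb : ∀ n, ∀ᵐ t, |F n t| ≤ g t)
    (hlim : ∀ᵐ t, Tendsto (fun n => F n t) atTop (nhds (h t))) (t : ℝ) :
    Tendsto (fun n => ∫ s in (0 : ℝ)..t, F n s) atTop (nhds (∫ s in (0 : ℝ)..t, h s)) := by
  refine intervalIntegral.tendsto_integral_filter_of_dominated_convergence g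
    (Eventually.of_forall fun n => (hF n).1.restrict) (Eventually.of_forall fun n => ?_)
    hg.intervalIntegrable ?_
  · filter_upwards [hb n] with s hs _ using hs
  · filter_upwards [hlim] with s hs _ using hs

lemma forall_Ici_le_of_ae {u : ℝ → ℝ} (hu : Continuous u) {C : ℝ}
    (h : ∀ᵐ t, 0 ≤ t → u t ≤ C) {t : ℝ} (ht : 0 ≤ t) : u t ≤ C := by
  have hopen : IsOpen ({t | C < u t} ∩ Ioi 0) := (isOpen_lt continuous_const hu).inter isOpen_Ioi
  have hnull : volume ({t | C < u t} ∩ Ioi (0 : ℝ)) = 0 := by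
    refine measure_mono_null ?_ (ae_iff.1 h)
    rintro s ⟨hs, hs0⟩ hcon
    exact absurd (hcon (le_of_lt hs0)) (not_le.2 hs)
  have hempty := hopen.measure_eq_zero_iff volume |>.1 hnull
  have hsub : closure (Ioi (0 : ℝ)) ⊆ {t | u t ≤ C} := by
    refine closure_minimal (fun s hs => ?_) (isClosed_le hu continuous_const)
    by_contra hcon
    have hmem : s ∈ {t | C < u t} ∩ Ioi 0 := ⟨show C < u s from lt_of_not_ge hcon, hs⟩
    rwa [hempty] at hmem
  rw [closure_Ioi] at hsub
  exact hsub ht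

lemma intervalIntegral_indicator_Icc {v : ℝ → ℝ} {N t : ℝ} (ht : t ∈ Icc 0 N) :
    ∫ s in (0 : ℝ)..t, (Icc 0 N).indicator v s = ∫ s in (0 : ℝ)..t, v s := by
  refine intervalIntegral.integral_congr fun s hs => indicator_of_mem ?_ _
  rw [uIcc_of_le ht.1] at hs
  exact ⟨hs.1, hs.2.trans ht.2⟩

/-- **Lemma 5.1** (limit lemma for the half-line problem). -/
theorem halfline_limit_lemma
    (ν₁ ν₂ : ℝ)
    (J : Set ℝ) (hJopen : IsOpen J) (hJconn : J.OrdConnected)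
    (Φ : ℝ → ℝ) (hΦcont : ContinuousOn Φ J)
    (k : ℝ → ℝ) (hkmeas : Measurable k)
    (hkpos : ∀ᵐ t ∂(volume.restrict (Ici (0:ℝ))), 0 < k t)
    (f : ℝ → ℝ → ℝ → ℝ)
    (hfmeas : ∀ u v : ℝ, Measurable fun t => f t u v)
    (hfcar : ∀ᵐ t ∂(volume.restrict (Ici (0:ℝ))), Continuous fun q : ℝ × ℝ => f t q.1 q.2)
    (hk : IntegrableOn (fun t => 1 / k t) (Ici 0))
    -- the compact interval K ⊂ J on which Φ is strictly monotone, and the bounds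
    (a b : ℝ) (hab : a ≤ b) (K : Set ℝ) (hK : K = Icc a b) (hKJ : K ⊆ J)
    (hmono : StrictMonoOn Φ K ∨ StrictAntiOn Φ K)
    (C : ℝ)
    (ψ : ℝ → ℝ) (hψint : IntegrableOn ψ (Ici 0))
    -- the solutions xₙ ∈ W^{1,1}([0,n]) of the Dirichlet problems on [0,n]
    (xn xn' : ℕ → ℝ → ℝ)
    (hsol : ∀ n : ℕ, 1 ≤ n →
      IntegrableOn (xn' n) (Icc 0 (n:ℝ)) ∧
      (∀ t ∈ Icc (0:ℝ) (n:ℝ), xn n t = ν₁ + ∫ s in (0:ℝ)..t, xn' n s) ∧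
      xn n 0 = ν₁ ∧ xn n (n:ℝ) = ν₂ ∧
      ∃ w : ℝ → ℝ, IntegrableOn w (Icc 0 (n:ℝ)) ∧
        (∀ᵐ t ∂(volume.restrict (Icc 0 (n:ℝ))), w t = f t (xn n t) (xn' n t)) ∧
        ∃ c : ℝ, ∀ᵐ t ∂(volume.restrict (Icc 0 (n:ℝ))),
          Φ (k t * xn' n t) = c + ∫ s in (0:ℝ)..t, w s)
    -- the uniform estimates
    (hest : ∀ n : ℕ, 1 ≤ n →
      ∀ᵐ t ∂(volume.restrict (Icc 0 (n:ℝ))),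
        |xn n t - ν₁| ≤ C ∧ k t * xn' n t ∈ K)
    (hder : ∀ n : ℕ, 1 ≤ n →
      ∀ᵐ t ∂(volume.restrict (Icc 0 (n:ℝ))),
        |f t (xn n t) (xn' n t)| ≤ ψ t) :
    -- conclusion: a solution of the problem on the half-line
    ∃ x x' : ℝ → ℝ,
      IntegrableOn x' (Ici 0) ∧
      (∀ t ∈ Ici (0:ℝ), x t = ν₁ + ∫ s in (0:ℝ)..t, x' s) ∧
      x 0 = ν₁ ∧ Tendsto x atTop (nhds ν₂) ∧
      (∃ w : ℝ → ℝ, IntegrableOn w (Ici 0) ∧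
        (∀ᵐ t ∂(volume.restrict (Ici (0:ℝ))), w t = f t (x t) (x' t)) ∧
        ∃ c : ℝ, ∀ᵐ t ∂(volume.restrict (Ici (0:ℝ))),
          Φ (k t * x' t) = c + ∫ s in (0:ℝ)..t, w s) ∧
      (∀ t ∈ Ici (0:ℝ), |x t - ν₁| ≤ C) ∧
      (∀ᵐ t ∂(volume.restrict (Ici (0:ℝ))), k t * x' t ∈ K) := by
  subst hK
  have hN1 : ∀ n : ℕ, 1 ≤ n + 1 := fun n => Nat.le_add_left 1 n
  choose hxint hxeq hx0 hxN w hwint hwf c hc using fun n : ℕ => hsol (n + 1) (hN1 n)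
  have hinj : InjOn Φ (Icc a b) := hmono.elim (fun h => h.injOn) (fun h => h.injOn)
  have hΦK : ContinuousOn Φ (Icc a b) := hΦcont.mono hKJ
  set I : ℕ → Set ℝ := fun n => Icc 0 ((n + 1 : ℕ) : ℝ) with hI
  set V : ℕ → ℝ → ℝ := fun n => (I n).indicator (xn' (n + 1)) with hV
  set W : ℕ → ℝ → ℝ := fun n => (I n).indicator (w n) with hW
  set B : ℝ := max |a| |b| with hB
  set g₁ : ℝ → ℝ := (Ici 0).indicator fun t => B * (1 / k t) with hg₁
  set g₂ : ℝ → ℝ := (Ici 0).indicator fun t => |ψ t| with hg₂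
  have hg₁int : Integrable g₁ := (integrable_indicator_iff measurableSet_Ici).2 (hk.const_mul B)
  have hg₂int : Integrable g₂ := (integrable_indicator_iff measurableSet_Ici).2 hψint.abs
  have hVint : ∀ n, Integrable (V n) := fun n =>
    (integrable_indicator_iff measurableSet_Icc).2 (hxint n)
  have hWint : ∀ n, Integrable (W n) := fun n =>
    (integrable_indicator_iff measurableSet_Icc).2 (hwint n)
  -- almost everywhere facts, unrestricted
  have hkpos' := (ae_restrict_iff' measurableSet_Ici).1 hkpos
  have hfcar' := (ae_restrict_iff' measurableSet_Ici).1 hfcar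
  have hest' : ∀ n, ∀ᵐ t, t ∈ I n →
      |xn (n + 1) t - ν₁| ≤ C ∧ k t * xn' (n + 1) t ∈ Icc a b := fun n =>
    (ae_restrict_iff' measurableSet_Icc).1 (hest (n + 1) (hN1 n))
  have hder' : ∀ n, ∀ᵐ t, t ∈ I n → |f t (xn (n + 1) t) (xn' (n + 1) t)| ≤ ψ t := fun n =>
    (ae_restrict_iff' measurableSet_Icc).1 (hder (n + 1) (hN1 n))
  have hwf' : ∀ n, ∀ᵐ t, t ∈ I n → w n t = f t (xn (n + 1) t) (xn' (n + 1) t) := fun n =>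
    (ae_restrict_iff' measurableSet_Icc).1 (hwf n)
  have hc' : ∀ n, ∀ᵐ t, t ∈ I n → Φ (k t * xn' (n + 1) t) = c n + ∫ s in (0:ℝ)..t, W n s := by
    intro n
    filter_upwards [(ae_restrict_iff' measurableSet_Icc).1 (hc n)] with t ht htI
    rw [ht htI, hW, intervalIntegral_indicator_Icc htI]
  have hVb : ∀ n, ∀ᵐ t, |V n t| ≤ g₁ t := by
    intro n
    filter_upwards [hest' n, hkpos'] with t h1 h2
    by_cases ht : t ∈ I n
    · have hk0 := h2 ht.1
      have h3 := (h1 ht).2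
      simp only [hV, hg₁, indicator_of_mem ht, indicator_of_mem (show t ∈ Ici (0:ℝ) from ht.1)]
      rw [mul_one_div, le_div_iff₀ hk0]
      calc |xn' (n + 1) t| * k t = |k t * xn' (n + 1) t| := by
            rw [abs_mul, abs_of_pos hk0, mul_comm]
        _ ≤ B := abs_le_max_abs_abs h3.1 h3.2
    · simp only [hV, hg₁, indicator_of_notMem ht, abs_zero]
      refine indicator_apply_nonneg fun ht0 => ?_
      exact mul_nonneg ((abs_nonneg a).trans (le_max_left _ _)) (one_div_pos.2 (h2 ht0)).le
  have hWb : ∀ n, ∀ᵐ t, |W n t| ≤ g₂ t := by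
    intro n
    filter_upwards [hder' n, hwf' n] with t h1 h2
    by_cases ht : t ∈ I n
    · simp only [hW, hg₂, indicator_of_mem ht, indicator_of_mem (show t ∈ Ici (0:ℝ) from ht.1)]
      rw [h2 ht]
      exact (h1 ht).trans (le_abs_self _)
    · simp only [hW, hg₂, indicator_of_notMem ht, abs_zero]
      exact indicator_apply_nonneg fun _ => abs_nonneg _
  set Y : ℕ → ℝ → ℝ := fun n t => c n + ∫ s in (0:ℝ)..t, W n s with hYdef
  set G : ℝ → ℝ := fun t => ∫ s in (0:ℝ)..t, g₂ s with hGdef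
  have hG : Continuous G := intervalIntegral.continuous_primitive
    (fun _ _ => hg₂int.intervalIntegrable) 0
  have hYsub : ∀ n s t, |Y n t - Y n s| ≤ |∫ r in s..t, g₂ r| := by
    intro n s t
    have h1 : Y n t - Y n s = ∫ r in s..t, W n r := by
      rw [← intervalIntegral.integral_interval_sub_left (hWint n).intervalIntegrable
        (hWint n).intervalIntegrable (a := 0)]
      simp only [hYdef]; ring
    rw [h1, ← Real.norm_eq_abs]
    exact intervalIntegral.norm_integral_le_abs_of_norm_le
      ((hWb n).filter_mono (ae_mono Measure.restrict_le_self)) hg₂int.intervalIntegrable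
  have hYG : ∀ n s t, |Y n t - Y n s| ≤ |G t - G s| := by
    intro n s t
    have h2 : G t - G s = ∫ r in s..t, g₂ r :=
      intervalIntegral.integral_interval_sub_left hg₂int.intervalIntegrable
        hg₂int.intervalIntegrable
    exact h2 ▸ hYsub n s t
  have hg₂nn : ∀ t, 0 ≤ g₂ t := fun t => indicator_apply_nonneg fun _ => abs_nonneg _
  obtain ⟨M, hM⟩ : ∃ M, ∀ z ∈ Icc a b, |Φ z| ≤ M := isCompact_Icc.exists_bound_of_continuousOn hΦK
  have hYM : ∀ n t, |Y n t| ≤ M + ∫ s, g₂ s := by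
    intro n t
    have hpos : (volume (I n)) ≠ 0 := by
      simp only [hI, Real.volume_Icc, ne_eq, ENNReal.ofReal_eq_zero, not_le, sub_zero]
      exact Nat.cast_pos.2 n.succ_pos
    obtain ⟨t₀, ht₀, h1, h2⟩ : ∃ t₀ ∈ I n, k t₀ * xn' (n + 1) t₀ ∈ Icc a b ∧
        Φ (k t₀ * xn' (n + 1) t₀) = Y n t₀ := by
      by_contra! hcon
      refine hpos (measure_mono_null (fun t ht => ?_) (ae_iff.1 ((hest' n).and (hc' n))))
      intro h
      exact hcon t ht (h.1 ht).2 (h.2 ht)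
    have h3 : |Y n t₀| ≤ M := h2 ▸ hM _ h1
    have h4 : |∫ r in t₀..t, g₂ r| ≤ ∫ r, g₂ r := by
      rw [intervalIntegral.abs_integral_eq_abs_integral_uIoc,
        abs_of_nonneg (integral_nonneg hg₂nn)]
      exact setIntegral_le_integral hg₂int (Eventually.of_forall hg₂nn)
    have h5 := (hYsub n t₀ t).trans h4
    have h6 := abs_sub_abs_le_abs_sub (Y n t) (Y n t₀)
    linarith
  obtain ⟨φ, hφ, y, hy⟩ := exists_subseq_tendsto_of_equicontinuous hG hYM hYG
  have hmem : ∀ t : ℝ, 0 ≤ t → ∀ᶠ n in atTop, t ∈ I (φ n) := by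
    intro t ht
    obtain ⟨N, hN⟩ := exists_nat_ge t
    filter_upwards [eventually_ge_atTop N] with n hn
    refine ⟨ht, hN.trans ?_⟩
    exact_mod_cast (hn.trans (hφ.id_le n)).trans (Nat.le_succ _)
  have hnotmem : ∀ t : ℝ, ¬ 0 ≤ t → ∀ n, t ∉ I n := fun t ht n h => ht h.1
  -- the limit of the derivatives
  set x' : ℝ → ℝ := fun t => limUnder atTop fun n => V (φ n) t with hx'
  have hlim0 : ∀ᵐ t, 0 ≤ t →
      Tendsto (fun n => V (φ n) t) atTop (nhds (x' t)) ∧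
        k t * x' t ∈ Icc a b ∧ Φ (k t * x' t) = y t := by
    filter_upwards [hkpos', ae_all_iff.2 hest', ae_all_iff.2 hc'] with t h1 h2 h3 ht
    have hk0 := h1 ht
    have hz : ∀ᶠ n in atTop, k t * V (φ n) t ∈ Icc a b := by
      filter_upwards [hmem t ht] with n hn
      simpa only [hV, indicator_of_mem hn] using (h2 _ hn).2
    have hΦz : Tendsto (fun n => Φ (k t * V (φ n) t)) atTop (nhds (y t)) := by
      refine (hy t).congr' ?_
      filter_upwards [hmem t ht] with n hn
      simpa only [hV, indicator_of_mem hn] using (h3 _ hn).symm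
    obtain ⟨l, hl, hlim, hΦl⟩ := isCompact_Icc.exists_tendsto_of_injOn hΦK hinj hz hΦz
    have hVlim : Tendsto (fun n => V (φ n) t) atTop (nhds ((k t)⁻¹ * l)) := by
      refine (hlim.const_mul (k t)⁻¹).congr fun n => ?_
      rw [inv_mul_cancel_left₀ hk0.ne']
    have hx't : x' t = (k t)⁻¹ * l := hVlim.limUnder_eq
    rw [hx't, mul_inv_cancel_left₀ hk0.ne']
    exact ⟨hVlim, hl, hΦl⟩
  have hVlim : ∀ᵐ t, Tendsto (fun n => V (φ n) t) atTop (nhds (x' t)) := by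
    filter_upwards [hlim0] with t h
    by_cases ht : 0 ≤ t
    · exact (h ht).1
    · have h0 : Tendsto (fun n => V (φ n) t) atTop (nhds 0) := by
        simp [hV, indicator_of_notMem (hnotmem t ht _)]
      have hx't : x' t = 0 := h0.limUnder_eq
      rwa [hx't]
  have hx'int : Integrable x' := integrable_of_tendsto_of_dominated hg₁int
    (fun n => hVint (φ n)) (fun n => hVb (φ n)) hVlim
  set x : ℝ → ℝ := fun t => ν₁ + ∫ s in (0:ℝ)..t, x' s with hx
  have hxcont : Continuous x := continuous_const.add <|
    intervalIntegral.continuous_primitive (fun _ _ => hx'int.intervalIntegrable) 0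
  have hxV : ∀ n, ∀ t ∈ I n, xn (n + 1) t = ν₁ + ∫ s in (0:ℝ)..t, V n s := by
    intro n t ht
    rw [hxeq n t ht, hV, intervalIntegral_indicator_Icc ht]
  have hxlim : ∀ t, 0 ≤ t → Tendsto (fun n => xn (φ n + 1) t) atTop (nhds (x t)) := by
    intro t ht
    refine ((tendsto_intervalIntegral_of_dominated hg₁int (fun n => hVint (φ n))
      (fun n => hVb (φ n)) hVlim t).const_add ν₁).congr' ?_
    filter_upwards [hmem t ht] with n hn using (hxV _ t hn).symm
  -- the limit of the right-hand sides
  set w₀ : ℝ → ℝ := (Ici 0).indicator fun t => f t (x t) (x' t) with hw₀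
  have hWlim : ∀ᵐ t, Tendsto (fun n => W (φ n) t) atTop (nhds (w₀ t)) := by
    filter_upwards [hVlim, hfcar', ae_all_iff.2 hwf'] with t h1 h2 h3
    by_cases ht : 0 ≤ t
    · have hq : Tendsto (fun n => (xn (φ n + 1) t, V (φ n) t)) atTop (nhds (x t, x' t)) :=
        (hxlim t ht).prodMk_nhds h1
      simp only [hw₀, indicator_of_mem (show t ∈ Ici (0:ℝ) from ht)]
      refine (((h2 ht).tendsto (x t, x' t)).comp hq).congr' ?_
      filter_upwards [hmem t ht] with n hn
      simp only [hV, hW, Function.comp_apply, indicator_of_mem hn]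
      exact (h3 _ hn).symm
    · simp [hW, hw₀, indicator_of_notMem (hnotmem t ht _), ht]
  have hw₀int : Integrable w₀ := integrable_of_tendsto_of_dominated hg₂int
    (fun n => hWint (φ n)) (fun n => hWb (φ n)) hWlim
  have hyeq : ∀ t, y t = y 0 + ∫ s in (0:ℝ)..t, w₀ s := by
    intro t
    have h0 : Tendsto (fun n => c (φ n)) atTop (nhds (y 0)) := by
      simpa [hYdef] using hy 0
    exact tendsto_nhds_unique (hy t) (h0.add (tendsto_intervalIntegral_of_dominated hg₂int
      (fun n => hWint (φ n)) (fun n => hWb (φ n)) hWlim t))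
  have hν₂ : ν₁ + ∫ s in Ioi (0:ℝ), x' s = ν₂ := by
    have h1 : Tendsto (fun n => ∫ s in Ioi (0:ℝ), V (φ n) s) atTop
        (nhds (∫ s in Ioi (0:ℝ), x' s)) :=
      tendsto_integral_of_dominated_convergence g₁ (fun n => (hVint (φ n)).1.restrict)
        hg₁int.integrableOn (fun n => ae_restrict_of_ae (hVb (φ n))) (ae_restrict_of_ae hVlim)
    have h2 : ∀ n, ∫ s in Ioi (0:ℝ), V n s = ν₂ - ν₁ := by
      intro n
      have hn : (0:ℝ) ≤ ((n + 1 : ℕ) : ℝ) := Nat.cast_nonneg _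
      have h3 := hxeq n _ (right_mem_Icc.2 hn)
      rw [hxN n, intervalIntegral.integral_of_le hn] at h3
      rw [h3, hV, ← integral_Ici_eq_integral_Ioi, setIntegral_indicator measurableSet_Icc,
        inter_eq_self_of_subset_right Icc_subset_Ici_self, integral_Icc_eq_integral_Ioc]
      ring
    simp only [h2] at h1
    rw [tendsto_nhds_unique h1 tendsto_const_nhds]
    ring
  refine ⟨x, x', hx'int.integrableOn, fun t _ => rfl, by simp [hx], ?_,
    ⟨w₀, hw₀int.integrableOn, ?_, y 0, ?_⟩, fun t ht => ?_, ?_⟩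
  · rw [← hν₂]
    exact (intervalIntegral_tendsto_integral_Ioi 0 hx'int.integrableOn tendsto_id).const_add ν₁
  · filter_upwards [ae_restrict_mem measurableSet_Ici] with t ht
    exact indicator_of_mem ht _
  · rw [ae_restrict_iff' measurableSet_Ici]
    filter_upwards [hlim0] with t h ht
    rw [(h ht).2.2, hyeq t]
  · refine forall_Ici_le_of_ae (u := fun t => |x t - ν₁|) (by fun_prop) ?_ ht
    filter_upwards [ae_all_iff.2 hest'] with t h1 ht
    refine le_of_tendsto ((hxlim t ht).sub_const ν₁).abs ?_
    filter_upwards [hmem t ht] with n hn using (h1 _ hn).1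
  · rw [ae_restrict_iff' measurableSet_Ici]
    filter_upwards [hlim0] with t h ht using (h ht).2.1
end

section
/- Perona–Malik example (Example 4.1). Let α > 0, let g, h : ℝ → ℝ be continuous with g bounded, set M = max_{|y| ≤ 1} |h(y)| and N = ‖g‖_{L^∞(ℝ)}, and let λ ∈ ℝ with |λ| < 1. If |λ|/(1 + λ²) < 1/2 − 2MN/(α + 1), then the problem ( x'(t)/(1 + x'(t)²) )' = t^α g(x(t)) h(x'(t)) for a.e. t ∈ [0, 1], x(0) = 0, x(1) = λ, admits a solution x ∈ W^{1,1}([0,1]) with |x'(t)| < 1 for a.e. t. -/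
open MeasureTheory Set Filter Topology

/-- The inverse of `s ↦ s / (1 + s ^ 2)` on `[-1, 1]`, extended to the line by constants. -/
noncomputable def peronaMalikInv (u : ℝ) : ℝ :=
  2 * max (-(1 / 2)) (min u (1 / 2)) / (1 + √(1 - 4 * max (-(1 / 2)) (min u (1 / 2)) ^ 2))

theorem continuous_peronaMalikInv : Continuous peronaMalikInv := by
  unfold peronaMalikInv
  refine Continuous.div (by fun_prop) (by fun_prop) fun u => ?_
  positivity

theorem abs_peronaMalikInv_le (u : ℝ) : |peronaMalikInv u| ≤ 1 := by
  unfold peronaMalikInv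
  set v := max (-(1 / 2)) (min u (1 / 2)) with hv
  have h1 : -(1 / 2) ≤ v := le_max_left _ _
  have h2 : v ≤ 1 / 2 := max_le (by norm_num) (min_le_right _ _)
  have h3 := Real.sqrt_nonneg (1 - 4 * v ^ 2)
  rw [abs_le, le_div_iff₀ (by positivity), div_le_iff₀ (by positivity)]
  constructor <;> linarith

theorem peronaMalik_peronaMalikInv (u : ℝ) :
    peronaMalikInv u / (1 + peronaMalikInv u ^ 2) = max (-(1 / 2)) (min u (1 / 2)) := by
  unfold peronaMalikInv
  set v := max (-(1 / 2)) (min u (1 / 2)) with hv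
  have h1 : -(1 / 2) ≤ v := le_max_left _ _
  have h2 : v ≤ 1 / 2 := max_le (by norm_num) (min_le_right _ _)
  have h3 := Real.sqrt_nonneg (1 - 4 * v ^ 2)
  have h4 := Real.sq_sqrt (show 0 ≤ 1 - 4 * v ^ 2 by nlinarith)
  set r := √(1 - 4 * v ^ 2)
  have h5 : 1 + r ≠ 0 := by positivity
  have h6 : 1 + (2 * v / (1 + r)) ^ 2 ≠ 0 := by positivity
  rw [div_eq_iff h6]
  field_simp
  linear_combination (-v) * h4

theorem peronaMalik_peronaMalikInv_of_abs_le {u : ℝ} (hu : |u| ≤ 1 / 2) :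
    peronaMalikInv u / (1 + peronaMalikInv u ^ 2) = u := by
  rw [peronaMalik_peronaMalikInv, min_eq_left (abs_le.1 hu).2, max_eq_right (abs_le.1 hu).1]

theorem peronaMalik_lt {a b : ℝ} (ha : |a| ≤ 1) (hb : |b| ≤ 1) (hab : a < b) :
    a / (1 + a ^ 2) < b / (1 + b ^ 2) := by
  rw [abs_le] at ha hb
  rw [div_lt_div_iff₀ (by positivity) (by positivity)]
  have : 0 < 1 - a * b := by nlinarith
  nlinarith [mul_pos (sub_pos.2 hab) this]

theorem monotone_peronaMalikInv : Monotone peronaMalikInv := by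
  intro u v huv
  by_contra! hlt
  have := peronaMalik_lt (abs_peronaMalikInv_le v) (abs_peronaMalikInv_le u) hlt
  rw [peronaMalik_peronaMalikInv, peronaMalik_peronaMalikInv] at this
  exact this.not_ge (max_le_max le_rfl (min_le_min huv le_rfl))

theorem abs_peronaMalikInv_lt {u : ℝ} (hu : |u| < 1 / 2) : |peronaMalikInv u| < 1 := by
  refine (abs_peronaMalikInv_le u).lt_of_ne fun h => ?_
  have key := peronaMalik_peronaMalikInv_of_abs_le hu.le
  have hsq : peronaMalikInv u ^ 2 = 1 := by rw [← sq_abs, h, one_pow]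
  rw [← key, hsq, abs_div, h] at hu
  norm_num at hu

theorem abs_peronaMalik_le (s : ℝ) : |s / (1 + s ^ 2)| ≤ 1 / 2 := by
  rw [abs_le, le_div_iff₀ (by positivity), div_le_iff₀ (by positivity)]
  constructor <;> nlinarith [sq_nonneg (s - 1), sq_nonneg (s + 1)]

theorem peronaMalikInv_peronaMalik {s : ℝ} (hs : |s| ≤ 1) :
    peronaMalikInv (s / (1 + s ^ 2)) = s := by
  have key := peronaMalik_peronaMalikInv_of_abs_le (abs_peronaMalik_le s)
  rcases lt_trichotomy (peronaMalikInv (s / (1 + s ^ 2))) s with h | h | h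
  · exact absurd key (peronaMalik_lt (abs_peronaMalikInv_le _) hs h).ne
  · exact h
  · exact absurd key (peronaMalik_lt hs (abs_peronaMalikInv_le _) h).ne'

section DelayedEquation

variable {E : Type*} [NormedAddCommGroup E] [NormedSpace ℝ E]

/-- Picard iterates, with parameter `c`, for the delayed equation `dy/dt = F t (y (t - δ))` with
`y 0 = γ c` and constant history before time `0`. -/
noncomputable def delayedPicard (F : ℝ → E → E) (γ : ℝ → E) (δ : ℝ) : ℕ → ℝ → ℝ → E
  | 0 => fun c _ => γ c
  | k + 1 => fun c t => γ c + ∫ s in (0 : ℝ)..t, F s (delayedPicard F γ δ k c (max (s - δ) 0))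

theorem continuous_delayedPicard {F : ℝ → E → E} (hF : Continuous (Function.uncurry F))
    {γ : ℝ → E} (hγ : Continuous γ) (δ : ℝ) (k : ℕ) :
    Continuous (Function.uncurry (delayedPicard F γ δ k)) := by
  induction k with
  | zero => exact hγ.comp continuous_fst
  | succ k ih =>
    have hint : Continuous (Function.uncurry fun (p : ℝ × ℝ) (s : ℝ) =>
        F s (delayedPicard F γ δ k p.1 (max (s - δ) 0))) := by
      have h1 : Continuous fun q : (ℝ × ℝ) × ℝ => (q.1.1, max (q.2 - δ) 0) := by fun_prop
      exact hF.comp (continuous_snd.prodMk (ih.comp h1))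
    exact (hγ.comp continuous_fst).add
      (intervalIntegral.continuous_parametric_intervalIntegral_of_continuous hint continuous_snd)

theorem delayedPicard_succ_eq (F : ℝ → E → E) (γ : ℝ → E) {δ : ℝ} (hδ : 0 ≤ δ) (c : ℝ) (k : ℕ) :
    ∀ t ∈ Icc 0 (k * δ), delayedPicard F γ δ (k + 1) c t = delayedPicard F γ δ k c t := by
  induction k with
  | zero =>
    intro t ht
    have : t = 0 := by simpa using ht
    simp [this, delayedPicard]
  | succ k ih =>
    intro t ht
    refine congrArg (γ c + ·) (intervalIntegral.integral_congr fun s hs => ?_)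
    rw [uIcc_of_le ht.1] at hs
    have h2 := ht.2
    push_cast at h2
    rw [ih _ ⟨le_max_right _ _, max_le (by linarith [hs.2]) (by positivity)⟩]

theorem exists_delayed_solution {F : ℝ → E → E} (hF : Continuous (Function.uncurry F))
    {γ : ℝ → E} (hγ : Continuous γ) {δ : ℝ} (hδ : 0 < δ) :
    ∃ Y : ℝ → ℝ → E, Continuous (Function.uncurry Y) ∧
      ∀ c, ∀ t ∈ Icc (0 : ℝ) 1,
        Y c t = γ c + ∫ s in (0 : ℝ)..t, F s (Y c (max (s - δ) 0)) := by
  obtain ⟨n, hn⟩ := exists_nat_ge (1 / δ)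
  rw [div_le_iff₀ hδ] at hn
  refine ⟨delayedPicard F γ δ n, continuous_delayedPicard hF hγ δ n, fun c t ht => ?_⟩
  rw [← delayedPicard_succ_eq F γ hδ.le c n t ⟨ht.1, ht.2.trans hn⟩, delayedPicard]

/-- Solutions of the delayed equations subconverge to a solution of the equation without delay. -/
theorem exists_subseq_tendsto_of_delayed [ProperSpace E] {F : ℝ → E → E}
    (hF : Continuous (Function.uncurry F)) {C R : ℝ}
    (hC : ∀ s ∈ Icc (0 : ℝ) 1, ∀ y, ‖F s y‖ ≤ C)
    {δ : ℕ → ℝ} (hδ : ∀ n, 0 ≤ δ n) (hδ0 : Tendsto δ atTop (𝓝 0))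
    {y : ℕ → ℝ → E} (hy : ∀ n, Continuous (y n)) (hR : ∀ n, ‖y n 0‖ ≤ R)
    (heq : ∀ n, ∀ t ∈ Icc (0 : ℝ) 1,
      y n t = y n 0 + ∫ s in (0 : ℝ)..t, F s (y n (max (s - δ n) 0))) :
    ∃ (z : ℝ → E) (φ : ℕ → ℕ), Continuous z ∧
      (∀ t ∈ Icc (0 : ℝ) 1, Tendsto (fun n => y (φ n) t) atTop (𝓝 (z t))) ∧
      ∀ t ∈ Icc (0 : ℝ) 1, z t = z 0 + ∫ s in (0 : ℝ)..t, F s (z s) := by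
  have hcont : ∀ n, Continuous fun s => F s (y n (max (s - δ n) 0)) := fun n =>
    hF.comp (continuous_id.prodMk ((hy n).comp (by fun_prop)))
  have h0 : (0 : ℝ) ∈ Icc (0 : ℝ) 1 := ⟨le_rfl, zero_le_one⟩
  have hC0 : 0 ≤ C := (norm_nonneg _).trans (hC 0 h0 0)
  have hlip : ∀ n, ∀ s ∈ Icc (0 : ℝ) 1, ∀ t ∈ Icc (0 : ℝ) 1,
      ‖y n t - y n s‖ ≤ C * |t - s| := by
    intro n s hs t ht
    rw [heq n t ht, heq n s hs, add_sub_add_left_eq_sub,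
      intervalIntegral.integral_interval_sub_left ((hcont n).intervalIntegrable _ _)
        ((hcont n).intervalIntegrable _ _)]
    refine intervalIntegral.norm_integral_le_of_norm_le_const fun r hr => hC r ?_ _
    exact (convex_Icc (0 : ℝ) 1).ordConnected.uIcc_subset hs ht (uIoc_subset_uIcc hr)
  let f : ℕ → BoundedContinuousFunction (Icc (0 : ℝ) 1) E := fun n =>
    BoundedContinuousFunction.mkOfCompact ⟨fun t => y n t, (hy n).comp continuous_subtype_val⟩
  have hcomp : IsCompact (closure (range f)) := by
    refine BoundedContinuousFunction.arzela_ascoli (Metric.closedBall (0 : E) (R + C))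
      (isCompact_closedBall _ _) _ ?_ ?_
    · rintro _ t ⟨n, rfl⟩
      rw [mem_closedBall_zero_iff]
      have h1 := hlip n 0 h0 t t.2
      have h2 : C * |(t : ℝ) - 0| ≤ C * 1 := by
        gcongr
        rw [sub_zero, abs_of_nonneg t.2.1]
        exact t.2.2
      calc ‖y n t‖ = ‖y n 0 + (y n t - y n 0)‖ := by rw [add_sub_cancel]
        _ ≤ ‖y n 0‖ + ‖y n t - y n 0‖ := norm_add_le _ _
        _ ≤ R + C := by linarith [hR n]
    · refine Metric.equicontinuous_of_continuity_modulus (fun d => C * d) ?_ _ ?_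
      · exact Continuous.tendsto' (by fun_prop) _ _ (by simp)
      · rintro s t ⟨_, n, rfl⟩
        rw [dist_comm, dist_comm s t, dist_eq_norm]
        exact hlip n s s.2 t t.2
  obtain ⟨g, -, φ, hφ, hg⟩ := hcomp.tendsto_subseq fun n =>
    subset_closure (mem_range_self (f := f) n)
  have hunif : Tendsto (fun n => dist (f (φ n)) g) atTop (𝓝 0) :=
    tendsto_iff_dist_tendsto_zero.1 hg
  set z : ℝ → E := IccExtend zero_le_one g with hz
  have hzc : Continuous z := g.continuous.Icc_extend'
  have hz_apply : ∀ t (ht : t ∈ Icc (0 : ℝ) 1), z t = g ⟨t, ht⟩ := fun t ht =>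
    IccExtend_of_mem _ _ ht
  have hdist : ∀ n, ∀ t ∈ Icc (0 : ℝ) 1, dist (y (φ n) t) (z t) ≤ dist (f (φ n)) g := by
    intro n t ht
    rw [hz_apply t ht]
    exact BoundedContinuousFunction.dist_coe_le_dist (f := f (φ n)) (⟨t, ht⟩ : Icc (0 : ℝ) 1)
  have hlim : ∀ t ∈ Icc (0 : ℝ) 1, Tendsto (fun n => y (φ n) t) atTop (𝓝 (z t)) := fun t ht =>
    tendsto_iff_dist_tendsto_zero.2
      (squeeze_zero (fun _ => dist_nonneg) (fun n => hdist n t ht) hunif)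
  have hshift : ∀ t ∈ Icc (0 : ℝ) 1,
      Tendsto (fun n => y (φ n) (max (t - δ (φ n)) 0)) atTop (𝓝 (z t)) := by
    intro t ht
    have h1 : Tendsto (fun n => C * δ (φ n) + dist (f (φ n)) g) atTop (𝓝 0) := by
      simpa using ((hδ0.comp hφ.tendsto_atTop).const_mul C).add hunif
    refine tendsto_iff_dist_tendsto_zero.2 (squeeze_zero (fun _ => dist_nonneg) (fun n => ?_) h1)
    have hd := hδ (φ n)
    have hmem : max (t - δ (φ n)) 0 ∈ Icc (0 : ℝ) 1 :=
      ⟨le_max_right _ _, max_le (by linarith [ht.2]) zero_le_one⟩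
    refine (dist_triangle _ (y (φ n) t) _).trans (add_le_add ?_ (hdist n t ht))
    rw [dist_eq_norm]
    refine (hlip _ t ht _ hmem).trans (mul_le_mul_of_nonneg_left ?_ hC0)
    rw [abs_le]
    exact ⟨by linarith [le_max_left (t - δ (φ n)) 0], by
      linarith [max_le (show t - δ (φ n) ≤ t + δ (φ n) by linarith)
        (show 0 ≤ t + δ (φ n) by linarith [ht.1])]⟩
  refine ⟨z, φ, hzc, hlim, fun t ht => ?_⟩
  have hsub : ∀ s ∈ uIoc 0 t, s ∈ Icc (0 : ℝ) 1 := fun s hs => by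
    rw [uIoc_of_le ht.1] at hs
    exact ⟨hs.1.le, hs.2.trans ht.2⟩
  have hint : Tendsto (fun n => ∫ s in (0 : ℝ)..t, F s (y (φ n) (max (s - δ (φ n)) 0))) atTop
      (𝓝 (∫ s in (0 : ℝ)..t, F s (z s))) := by
    refine intervalIntegral.tendsto_integral_filter_of_dominated_convergence (fun _ => C) ?_ ?_
      intervalIntegrable_const ?_
    · exact Eventually.of_forall fun n => (hcont _).aestronglyMeasurable
    · exact Eventually.of_forall fun n => ae_of_all _ fun s hs => hC s (hsub s hs) _
    · refine ae_of_all _ fun s hs => ?_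
      exact (hF.tendsto (s, z s)).comp (tendsto_const_nhds.prodMk_nhds (hshift s (hsub s hs)))
  exact tendsto_nhds_unique (hlim t ht)
    (((hlim 0 h0).add hint).congr fun n => (heq (φ n) t ht).symm)

end DelayedEquation

theorem abs_integral_rpow_mul_le {α : ℝ} (hα : 0 < α) {v : ℝ → ℝ} {C : ℝ} (hv : ∀ s, |v s| ≤ C)
    {t : ℝ} (ht : t ∈ Icc (0 : ℝ) 1) : |∫ s in (0 : ℝ)..t, s ^ α * v s| ≤ C / (α + 1) := by
  have hC : 0 ≤ C := (abs_nonneg _).trans (hv 0)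
  have hint : IntervalIntegrable (fun s : ℝ => s ^ α * C) volume 0 t :=
    ((Real.continuous_rpow_const hα.le).mul continuous_const).intervalIntegrable _ _
  have h1 : |∫ s in (0 : ℝ)..t, s ^ α * v s| ≤ ∫ s in (0 : ℝ)..t, s ^ α * C := by
    rw [← Real.norm_eq_abs]
    refine intervalIntegral.norm_integral_le_of_norm_le ht.1 (ae_of_all _ fun s hs => ?_) hint
    have hs0 : 0 ≤ s ^ α := Real.rpow_nonneg hs.1.le _
    rw [Real.norm_eq_abs, abs_mul, abs_of_nonneg hs0]
    exact mul_le_mul_of_nonneg_left (hv s) hs0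
  refine h1.trans ?_
  rw [intervalIntegral.integral_mul_const, integral_rpow (Or.inl (by linarith)),
    Real.zero_rpow (by linarith), sub_zero, div_mul_eq_mul_div]
  gcongr
  exact mul_le_of_le_one_left hC (Real.rpow_le_one ht.1 ht.2 (by linarith))

/-- The vector field of the first-order system for `x` and the flux `Φ` of its derivative. -/
noncomputable def peronaMalikField (α : ℝ) (g h : ℝ → ℝ) (s : ℝ) (y : ℝ × ℝ) : ℝ × ℝ :=
  (peronaMalikInv y.2, s ^ α * (g y.1 * h (peronaMalikInv y.2)))

theorem continuous_peronaMalikField {α : ℝ} (hα : 0 < α) {g h : ℝ → ℝ} (hg : Continuous g)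
    (hh : Continuous h) : Continuous (Function.uncurry (peronaMalikField α g h)) := by
  have h1 := Real.continuous_rpow_const hα.le
  have h2 := continuous_peronaMalikInv
  unfold peronaMalikField Function.uncurry
  fun_prop

theorem norm_peronaMalikField_le {α : ℝ} (hα : 0 < α) {g h : ℝ → ℝ} {C : ℝ}
    (hgh : ∀ a b, |g a * h (peronaMalikInv b)| ≤ C) {s : ℝ} (hs : s ∈ Icc (0 : ℝ) 1)
    (y : ℝ × ℝ) : ‖peronaMalikField α g h s y‖ ≤ max 1 C := by
  have hs0 : 0 ≤ s ^ α := Real.rpow_nonneg hs.1 _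
  refine max_le_max (abs_peronaMalikInv_le _) ?_
  rw [peronaMalikField, Real.norm_eq_abs, abs_mul, abs_of_nonneg hs0]
  exact (mul_le_of_le_one_left (abs_nonneg _) (Real.rpow_le_one hs.1 hs.2 hα.le)).trans (hgh _ _)

/-- Componentwise form of an integral equation for `peronaMalikField`. -/
theorem eq_add_integral_peronaMalikField {α : ℝ} (hα : 0 < α) {g h : ℝ → ℝ} (hg : Continuous g)
    (hh : Continuous h) {v : ℝ → ℝ × ℝ} (hv : Continuous v) {a b : ℝ × ℝ} {t : ℝ}
    (heq : a = b + ∫ s in (0 : ℝ)..t, peronaMalikField α g h s (v s)) :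
    a.1 = b.1 + ∫ s in (0 : ℝ)..t, peronaMalikInv (v s).2 ∧
      a.2 = b.2 + ∫ s in (0 : ℝ)..t, s ^ α * (g (v s).1 * h (peronaMalikInv (v s).2)) := by
  have hint : IntervalIntegrable (fun s => peronaMalikField α g h s (v s)) volume 0 t :=
    ((continuous_peronaMalikField hα hg hh).comp
      (continuous_id.prodMk hv)).intervalIntegrable _ _
  have h1 := (ContinuousLinearMap.fst ℝ ℝ ℝ).intervalIntegral_comp_comm hint
  have h2 := (ContinuousLinearMap.snd ℝ ℝ ℝ).intervalIntegral_comp_comm hint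
  simp only [ContinuousLinearMap.coe_fst', ContinuousLinearMap.coe_snd'] at h1 h2
  constructor
  · rw [heq, Prod.fst_add, ← h1]; rfl
  · rw [heq, Prod.snd_add, ← h2]; rfl

/-- Shooting: the delayed system has a solution whose first component goes from `0` to `lam`. -/
theorem exists_delayed_peronaMalik_solution {α : ℝ} (hα : 0 < α) {g h : ℝ → ℝ}
    (hg : Continuous g) (hh : Continuous h) {C : ℝ}
    (hgh : ∀ a b, |g a * h (peronaMalikInv b)| ≤ C) {lam : ℝ} (hlam : |lam| ≤ 1) {δ : ℝ}
    (hδ : 0 < δ) :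
    ∃ y : ℝ → ℝ × ℝ, Continuous y ∧ (y 0).1 = 0 ∧
      |(y 0).2 - lam / (1 + lam ^ 2)| ≤ C / (α + 1) ∧ (y 1).1 = lam ∧
      ∀ t ∈ Icc (0 : ℝ) 1,
        y t = y 0 + ∫ s in (0 : ℝ)..t, peronaMalikField α g h s (y (max (s - δ) 0)) := by
  have hγ : Continuous fun c : ℝ => ((0 : ℝ), c) := by fun_prop
  obtain ⟨Y, hY, heq⟩ :=
    exists_delayed_solution (continuous_peronaMalikField hα hg hh) hγ hδ
  have hYc : ∀ c, Continuous (Y c) := fun c => hY.comp (Continuous.prodMk_right c)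
  have hvc : ∀ c, Continuous fun s => Y c (max (s - δ) 0) := fun c => (hYc c).comp (by fun_prop)
  have h0 : (0 : ℝ) ∈ Icc (0 : ℝ) 1 := ⟨le_rfl, zero_le_one⟩
  have h1 : (1 : ℝ) ∈ Icc (0 : ℝ) 1 := ⟨zero_le_one, le_rfl⟩
  have hY0 : ∀ c, Y c 0 = (0, c) := fun c => by
    rw [heq c 0 h0, intervalIntegral.integral_same, add_zero]
  have hdev : ∀ c, ∀ t ∈ Icc (0 : ℝ) 1, |(Y c t).2 - c| ≤ C / (α + 1) := fun c t ht => by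
    rw [(eq_add_integral_peronaMalikField hα hg hh (hvc c) (heq c t ht)).2, add_sub_cancel_left]
    exact abs_integral_rpow_mul_le hα (fun s => hgh _ _) ht
  have hend : ∀ c, (Y c 1).1 = ∫ s in (0 : ℝ)..1, peronaMalikInv (Y c (max (s - δ) 0)).2 :=
    fun c => by
      rw [(eq_add_integral_peronaMalikField hα hg hh (hvc c) (heq c 1 h1)).1, zero_add]
  have hintg : ∀ c, IntervalIntegrable (fun s => peronaMalikInv (Y c (max (s - δ) 0)).2)
      volume 0 1 := fun c =>
    (continuous_peronaMalikInv.comp (continuous_snd.comp (hvc c))).intervalIntegrable _ _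
  have hmem : ∀ s ∈ Icc (0 : ℝ) 1, max (s - δ) 0 ∈ Icc (0 : ℝ) 1 := fun s hs =>
    ⟨le_max_right _ _, max_le (by linarith [hs.2]) zero_le_one⟩
  set p := lam / (1 + lam ^ 2) with hp
  set K := C / (α + 1) with hK
  have hpinv : peronaMalikInv p = lam := peronaMalikInv_peronaMalik hlam
  have hK0 : 0 ≤ K := (abs_nonneg _).trans (hdev 0 0 h0)
  have hlow : (Y (p - K) 1).1 ≤ lam := by
    rw [hend]
    calc _ ≤ ∫ _ in (0 : ℝ)..1, lam := by
          refine intervalIntegral.integral_mono_on zero_le_one (hintg _)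
            intervalIntegrable_const fun s hs => ?_
          rw [← hpinv]
          exact monotone_peronaMalikInv (by linarith [(abs_le.1 (hdev (p - K) _ (hmem s hs))).2])
      _ = lam := by simp
  have hhigh : lam ≤ (Y (p + K) 1).1 := by
    rw [hend]
    calc lam = ∫ _ in (0 : ℝ)..1, lam := by simp
      _ ≤ _ := by
          refine intervalIntegral.integral_mono_on zero_le_one
            intervalIntegrable_const (hintg _) fun s hs => ?_
          rw [← hpinv]
          exact monotone_peronaMalikInv (by linarith [(abs_le.1 (hdev (p + K) _ (hmem s hs))).1])
  have hcont : Continuous fun c => (Y c 1).1 :=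
    continuous_fst.comp (hY.comp (Continuous.prodMk_left 1))
  obtain ⟨c, hc, hc1⟩ := intermediate_value_Icc (show p - K ≤ p + K by linarith)
    hcont.continuousOn ⟨hlow, hhigh⟩
  refine ⟨Y c, hYc c, by rw [hY0], ?_, hc1, fun t ht => ?_⟩
  · rw [hY0, abs_le]
    exact ⟨by linarith [hc.1], by linarith [hc.2]⟩
  · rw [hY0]
    exact heq c t ht

/-- **Example 4.1** (Perona–Malik operator `Φ(s) = s/(1+s²)`). -/
theorem perona_malik_example
    (α : ℝ) (hα : 0 < α)
    (g h : ℝ → ℝ) (hg : Continuous g) (hh : Continuous h)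
    (M : ℝ) (hM : IsGreatest ((fun y => |h y|) '' Icc (-1 : ℝ) 1) M)
    (N : ℝ) (hN : IsLUB (Set.range fun x => |g x|) N)
    (lam : ℝ) (hlam : |lam| < 1)
    (hcond : |lam| / (1 + lam ^ 2) < 1 / 2 - 2 * M * N / (α + 1)) :
    ∃ x x' : ℝ → ℝ,
      IntegrableOn x' (Icc 0 1) ∧
      (∀ t ∈ Icc (0:ℝ) 1, x t = ∫ s in (0:ℝ)..t, x' s) ∧
      x 0 = 0 ∧ x 1 = lam ∧
      (∀ᵐ t ∂(volume.restrict (Icc (0:ℝ) 1)), |x' t| < 1) ∧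
      ∃ w : ℝ → ℝ, IntegrableOn w (Icc 0 1) ∧
        (∀ᵐ t ∂(volume.restrict (Icc (0:ℝ) 1)),
          w t = t ^ α * g (x t) * h (x' t)) ∧
        ∃ c : ℝ, ∀ᵐ t ∂(volume.restrict (Icc (0:ℝ) 1)),
          x' t / (1 + x' t ^ 2) = c + ∫ s in (0:ℝ)..t, w s := by
  have hgh : ∀ a b, |g a * h (peronaMalikInv b)| ≤ M * N := fun a b => by
    have hgN : |g a| ≤ N := hN.1 (mem_range_self a)
    have hhM : |h (peronaMalikInv b)| ≤ M :=
      hM.2 (mem_image_of_mem (fun y => |h y|) (abs_le.1 (abs_peronaMalikInv_le b)))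
    rw [abs_mul, mul_comm M N]
    exact mul_le_mul hgN hhM (abs_nonneg _) ((abs_nonneg _).trans hgN)
  have hδ : ∀ n : ℕ, 0 < 1 / ((n : ℝ) + 1) := fun n => by positivity
  choose y hyc hy0 hyp hy1 hyeq using fun n : ℕ =>
    exists_delayed_peronaMalik_solution hα hg hh hgh hlam.le (hδ n)
  set p := lam / (1 + lam ^ 2) with hp
  set K := M * N / (α + 1) with hK
  have hpK : |p| + 2 * K < 1 / 2 := by
    have e1 : |p| = |lam| / (1 + lam ^ 2) := by
      rw [hp, abs_div, abs_of_nonneg (show 0 ≤ 1 + lam ^ 2 by positivity)]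
    have e2 : 2 * M * N / (α + 1) = 2 * K := by rw [hK]; ring
    linarith
  have hR : ∀ n, ‖y n 0‖ ≤ |p| + K := fun n => by
    have hK0 : 0 ≤ K := (abs_nonneg _).trans (hyp n)
    rw [Prod.norm_def, hy0, norm_zero]
    refine max_le (by positivity) ?_
    rw [Real.norm_eq_abs]
    linarith [abs_sub_abs_le_abs_sub (y n 0).2 p, hyp n]
  obtain ⟨z, φ, hz, hlim, hzeq⟩ := exists_subseq_tendsto_of_delayed
    (continuous_peronaMalikField hα hg hh)
    (fun s hs v => norm_peronaMalikField_le hα hgh hs v) (fun n => (hδ n).le)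
    tendsto_one_div_add_atTop_nhds_zero_nat hyc hR hyeq
  have h0 : (0 : ℝ) ∈ Icc (0 : ℝ) 1 := ⟨le_rfl, zero_le_one⟩
  have h1 : (1 : ℝ) ∈ Icc (0 : ℝ) 1 := ⟨zero_le_one, le_rfl⟩
  have hfst : ∀ t ∈ Icc (0 : ℝ) 1, Tendsto (fun n => (y (φ n) t).1) atTop (𝓝 (z t).1) :=
    fun t ht => (continuous_fst.tendsto _).comp (hlim t ht)
  have hz0 : (z 0).1 = 0 :=
    tendsto_nhds_unique (hfst 0 h0) (tendsto_const_nhds.congr fun n => (hy0 _).symm)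
  have hz1 : (z 1).1 = lam :=
    tendsto_nhds_unique (hfst 1 h1) (tendsto_const_nhds.congr fun n => (hy1 _).symm)
  have hzp : |(z 0).2 - p| ≤ K :=
    le_of_tendsto ((((continuous_snd.tendsto _).comp (hlim 0 h0)).sub_const p).abs)
      (Eventually.of_forall fun n => hyp _)
  have hsys := fun t ht => eq_add_integral_peronaMalikField hα hg hh hz (hzeq t ht)
  have hzlt : ∀ t ∈ Icc (0 : ℝ) 1, |(z t).2| < 1 / 2 := fun t ht => by
    have hdev : |(z t).2 - (z 0).2| ≤ K := by
      rw [(hsys t ht).2, add_sub_cancel_left]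
      exact abs_integral_rpow_mul_le hα (fun s => hgh _ _) ht
    linarith [abs_sub_abs_le_abs_sub (z t).2 (z 0).2, abs_sub_abs_le_abs_sub (z 0).2 p]
  have hx'c : Continuous fun t => peronaMalikInv (z t).2 :=
    continuous_peronaMalikInv.comp (continuous_snd.comp hz)
  have hwc : Continuous fun t => t ^ α * (g (z t).1 * h (peronaMalikInv (z t).2)) :=
    (Real.continuous_rpow_const hα.le).mul
      ((hg.comp (continuous_fst.comp hz)).mul (hh.comp hx'c))
  refine ⟨fun t => (z t).1, fun t => peronaMalikInv (z t).2,
    hx'c.continuousOn.integrableOn_Icc, fun t ht => ?_, hz0, hz1, ?_,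
    fun t => t ^ α * (g (z t).1 * h (peronaMalikInv (z t).2)),
    hwc.continuousOn.integrableOn_Icc, ?_, (z 0).2, ?_⟩
  · simpa [hz0] using (hsys t ht).1
  · exact ae_restrict_of_forall_mem measurableSet_Icc fun t ht => abs_peronaMalikInv_lt (hzlt t ht)
  · exact ae_of_all _ fun t => by ring
  · refine ae_restrict_of_forall_mem measurableSet_Icc fun t ht => ?_
    rw [peronaMalik_peronaMalikInv_of_abs_le (hzlt t ht).le]
    exact (hsys t ht).2
end

section
/- Oscillating operator example (Example 4.2). Let α > −1, let g, h : ℝ → ℝ be continuous with g bounded, set M = max_{|y| ≤ π/2} |h(y)| and N = ‖g‖_{L^∞(ℝ)}, and let λ ∈ ℝ with |λ| < π/2. If sin(|λ|) < 1 − 2MN/(α + 1), then the problem ( sin(x'(t)) )' = t^α g(x(t)) h(x'(t)) for a.e. t ∈ [0, 1], x(0) = 0, x(1) = λ, admits a solution x ∈ W^{1,1}([0,1]) with |x'(t)| < π/2 for a.e. t. -/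
open MeasureTheory Set Filter Real

open scoped Topology

namespace EulerShooting

/-- The explicit Euler scheme with step `1 / n` for the planar system
`x' = φ u`, `u' = ρ(t) f(x, u)` with initial value `(0, c)`. -/
noncomputable def euler (ρ : ℝ → ℝ) (f : ℝ × ℝ → ℝ) (φ : ℝ → ℝ) (n : ℕ) (c : ℝ) : ℕ → ℝ × ℝ
  | 0 => (0, c)
  | k + 1 => ((euler ρ f φ n c k).1 + 1 / n * φ (euler ρ f φ n c k).2,
      (euler ρ f φ n c k).2 +
        (∫ s in (k / n : ℝ)..((k + 1 : ℕ) / n : ℝ), ρ s) * f (euler ρ f φ n c k))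

theorem continuous_euler {ρ : ℝ → ℝ} {f : ℝ × ℝ → ℝ} {φ : ℝ → ℝ} (hf : Continuous f)
    (hφ : Continuous φ) (n k : ℕ) : Continuous fun c => euler ρ f φ n c k := by
  induction k with
  | zero => simp only [euler]; fun_prop
  | succ k ih => simp only [euler]; fun_prop

theorem measurable_step {E : Type*} [MeasurableSpace E] (G : ℕ → E) (n : ℕ) :
    Measurable fun s : ℝ => G ⌊(n : ℝ) * s⌋₊ :=
  (measurable_from_nat (f := G)).comp (Nat.measurable_floor.comp (measurable_const_mul _))

theorem intervalIntegrable_mul_of_bounded {ρ w : ℝ → ℝ} {B a b : ℝ}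
    (hρ : IntervalIntegrable ρ volume a b) (hw : Measurable w) (hB : ∀ s, |w s| ≤ B) :
    IntervalIntegrable (fun s => ρ s * w s) volume a b := by
  refine (hρ.norm.mul_const B).mono_fun' (hρ.def'.aestronglyMeasurable.mul
    hw.aestronglyMeasurable) (ae_of_all _ fun s => ?_)
  simp only [norm_mul]
  exact mul_le_mul_of_nonneg_left (hB s) (norm_nonneg _)

theorem abs_integral_mul_le {ρ w : ℝ → ℝ} {B a b : ℝ} (hρ : IntervalIntegrable ρ volume a b)
    (hρ0 : ∀ s, 0 ≤ ρ s) (hB : ∀ s, |w s| ≤ B) :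
    |∫ s in a..b, ρ s * w s| ≤ |∫ s in a..b, ρ s * B| := by
  rw [← Real.norm_eq_abs]
  refine intervalIntegral.norm_integral_le_abs_of_norm_le (ae_of_all _ fun s => ?_)
    (hρ.mul_const B)
  rw [norm_mul, Real.norm_of_nonneg (hρ0 s)]
  exact mul_le_mul_of_nonneg_left (hB s) (hρ0 s)

theorem integral_mul_step {ρ : ℝ → ℝ} {n : ℕ} (hn : 0 < n) (G : ℕ → ℝ) (k : ℕ) :
    ∫ s in (k / n : ℝ)..((k + 1 : ℕ) / n : ℝ), ρ s * G ⌊(n : ℝ) * s⌋₊ =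
      (∫ s in (k / n : ℝ)..((k + 1 : ℕ) / n : ℝ), ρ s) * G k := by
  have hn' : (0 : ℝ) < n := by exact_mod_cast hn
  rw [← intervalIntegral.integral_mul_const]
  refine intervalIntegral.integral_congr_Ioo_of_le (by gcongr; simp) fun s hs => ?_
  have h1 := (div_lt_iff₀' hn').1 hs.1
  have h2 := (lt_div_iff₀' hn').1 hs.2
  have : ⌊(n : ℝ) * s⌋₊ = k := by
    rw [Nat.floor_eq_iff (by linarith [k.cast_nonneg (α := ℝ)])]
    push_cast at h2
    exact ⟨h1.le, h2⟩
  simp only [this]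

section Integral

variable {ρ : ℝ → ℝ} {f : ℝ × ℝ → ℝ} {φ : ℝ → ℝ} {B C : ℝ}

theorem euler_snd (hρ : ∀ a b, IntervalIntegrable ρ volume a b) (hf : Continuous f)
    (hB : ∀ p, |f p| ≤ B) {n : ℕ} (hn : 0 < n) (c : ℝ) (k : ℕ) :
    (euler ρ f φ n c k).2 =
      c + ∫ s in (0 : ℝ)..(k / n : ℝ), ρ s * f (euler ρ f φ n c ⌊(n : ℝ) * s⌋₊) := by
  induction k with
  | zero => simp [euler]
  | succ k ih =>
    have hi : ∀ a b, IntervalIntegrable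
        (fun s => ρ s * f (euler ρ f φ n c ⌊(n : ℝ) * s⌋₊)) volume a b := fun a b =>
      intervalIntegrable_mul_of_bounded (hρ a b)
        (hf.measurable.comp (measurable_step _ n)) fun s => hB _
    rw [← intervalIntegral.integral_add_adjacent_intervals (hi 0 (k / n : ℝ)) (hi _ _),
      integral_mul_step hn (fun j => f (euler ρ f φ n c j)), ← add_assoc, ← ih]
    rfl

theorem euler_fst (hφ : Continuous φ) (hC : ∀ v, |φ v| ≤ C) {n : ℕ} (hn : 0 < n) (c : ℝ)
    (k : ℕ) :
    (euler ρ f φ n c k).1 =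
      ∫ s in (0 : ℝ)..(k / n : ℝ), φ (euler ρ f φ n c ⌊(n : ℝ) * s⌋₊).2 := by
  induction k with
  | zero => simp [euler]
  | succ k ih =>
    have hi : ∀ a b, IntervalIntegrable
        (fun s => φ (euler ρ f φ n c ⌊(n : ℝ) * s⌋₊).2) volume a b := fun a b => by
      simpa using intervalIntegrable_mul_of_bounded (ρ := fun _ => (1 : ℝ)) (a := a) (b := b)
        intervalIntegrable_const
        (hφ.measurable.comp (measurable_snd.comp (measurable_step _ n))) fun s => hC _
    have hs := integral_mul_step (ρ := fun _ => (1 : ℝ)) hn (fun j => φ (euler ρ f φ n c j).2) k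
    simp only [one_mul, intervalIntegral.integral_const, smul_eq_mul, mul_one] at hs
    rw [← intervalIntegral.integral_add_adjacent_intervals (hi 0 (k / n : ℝ)) (hi _ _), hs,
      ← ih]
    simp only [euler]
    push_cast
    ring

theorem abs_integral_mul_sub_le (hρ : ∀ a b, IntervalIntegrable ρ volume a b)
    (hρ0 : ∀ s, 0 ≤ ρ s) {w : ℝ → ℝ} (hw : Measurable w) (hB : ∀ s, |w s| ≤ B) (a b : ℝ) :
    |(∫ s in (0 : ℝ)..a, ρ s * w s) - ∫ s in (0 : ℝ)..b, ρ s * w s| ≤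
      |(∫ s in (0 : ℝ)..a, ρ s * B) - ∫ s in (0 : ℝ)..b, ρ s * B| := by
  have hi : ∀ a b, IntervalIntegrable (fun s => ρ s * w s) volume a b := fun a b =>
    intervalIntegrable_mul_of_bounded (hρ a b) hw hB
  rw [intervalIntegral.integral_interval_sub_left (hi _ _) (hi _ _),
    intervalIntegral.integral_interval_sub_left ((hρ _ _).mul_const B) ((hρ _ _).mul_const B)]
  exact abs_integral_mul_le (hρ b a) hρ0 hB

theorem abs_integral_mul_le_of_mem (hρ : ∀ a b, IntervalIntegrable ρ volume a b)
    (hρ0 : ∀ s, 0 ≤ ρ s) {w : ℝ → ℝ} (hB : ∀ s, |w s| ≤ B) {t : ℝ} (ht : t ∈ Icc (0 : ℝ) 1) :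
    |∫ s in (0 : ℝ)..t, ρ s * w s| ≤ B * ∫ s in (0 : ℝ)..1, ρ s := by
  have hB0 : 0 ≤ B := (abs_nonneg _).trans (hB 0)
  refine (abs_integral_mul_le (hρ 0 t) hρ0 hB).trans ?_
  rw [intervalIntegral.integral_mul_const, abs_of_nonneg
    (mul_nonneg (intervalIntegral.integral_nonneg ht.1 fun s _ => hρ0 s) hB0), mul_comm]
  refine mul_le_mul_of_nonneg_left ?_ hB0
  exact intervalIntegral.integral_mono_interval le_rfl ht.1 ht.2
    (ae_of_all _ hρ0) (hρ 0 1)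

theorem div_mem_unitInterval {n k : ℕ} (hk : k ≤ n) : (k / n : ℝ) ∈ Icc (0 : ℝ) 1 :=
  ⟨by positivity, div_le_one_of_le₀ (by exact_mod_cast hk) (by positivity)⟩

theorem abs_euler_snd_sub_le (hρ : ∀ a b, IntervalIntegrable ρ volume a b) (hρ0 : ∀ s, 0 ≤ ρ s)
    (hf : Continuous f) (hB : ∀ p, |f p| ≤ B) {n : ℕ} (hn : 0 < n) (c : ℝ) {k : ℕ}
    (hk : k ≤ n) : |(euler ρ f φ n c k).2 - c| ≤ B * ∫ s in (0 : ℝ)..1, ρ s := by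
  rw [euler_snd hρ hf hB hn, add_sub_cancel_left]
  exact abs_integral_mul_le_of_mem hρ hρ0 (fun s => hB _) (div_mem_unitInterval hk)

theorem euler_fst_le {n : ℕ} {c L : ℝ} {k : ℕ}
    (h : ∀ j < k, φ (euler ρ f φ n c j).2 ≤ L) : (euler ρ f φ n c k).1 ≤ k / n * L := by
  induction k with
  | zero => simp [euler]
  | succ k ih =>
    have h1 := ih fun j hj => h j (hj.trans k.lt_succ_self)
    have h2 := mul_le_mul_of_nonneg_left (h k k.lt_succ_self)
      (show (0 : ℝ) ≤ 1 / n by positivity)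
    simp only [euler]
    push_cast
    linarith [show ((k : ℝ) + 1) / n * L = k / n * L + 1 / n * L by ring]

theorem le_euler_fst {n : ℕ} {c L : ℝ} {k : ℕ}
    (h : ∀ j < k, L ≤ φ (euler ρ f φ n c j).2) : k / n * L ≤ (euler ρ f φ n c k).1 := by
  induction k with
  | zero => simp [euler]
  | succ k ih =>
    have h1 := ih fun j hj => h j (hj.trans k.lt_succ_self)
    have h2 := mul_le_mul_of_nonneg_left (h k k.lt_succ_self)
      (show (0 : ℝ) ≤ 1 / n by positivity)
    simp only [euler]
    push_cast
    linarith [show ((k : ℝ) + 1) / n * L = k / n * L + 1 / n * L by ring]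

/-- Shooting for the Euler scheme: some initial value of the second component steers the first
component to `L` at time `1`. -/
theorem exists_euler_fst_eq (hρ : ∀ a b, IntervalIntegrable ρ volume a b)
    (hρ0 : ∀ s, 0 ≤ ρ s) (hf : Continuous f) (hB : ∀ p, |f p| ≤ B) (hφ : Continuous φ)
    (hmono : Monotone φ) {a b L : ℝ} (hab : a ≤ b)
    (ha : φ (a + B * ∫ s in (0 : ℝ)..1, ρ s) ≤ L)
    (hb : L ≤ φ (b - B * ∫ s in (0 : ℝ)..1, ρ s)) {n : ℕ} (hn : 0 < n) :
    ∃ c ∈ Icc a b, (euler ρ f φ n c n).1 = L := by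
  have hn' : (n / n : ℝ) = 1 := div_self (by exact_mod_cast hn.ne')
  have hbd := fun (c : ℝ) (j : ℕ) (hj : j < n) =>
    abs_le.1 (abs_euler_snd_sub_le (φ := φ) hρ hρ0 hf hB hn c hj.le)
  refine intermediate_value_Icc hab
    (continuous_fst.comp (continuous_euler hf hφ n n)).continuousOn ⟨?_, ?_⟩
  · refine (euler_fst_le fun j hj => hmono ?_).trans (by rw [hn', one_mul]; exact ha)
    linarith [(hbd a j hj).2]
  · refine le_trans (by rw [hn', one_mul]; exact hb) (le_euler_fst fun j hj => hmono ?_)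
    linarith [(hbd b j hj).1]

theorem exists_subseq_tendsto_of_dist_le {U : ℕ → C(Icc (0 : ℝ) 1, ℝ)} {D : ℝ} {R : ℝ → ℝ}
    (hR : Continuous R) (hD : ∀ n t, |U n t| ≤ D)
    (hU : ∀ n s t, |U n s - U n t| ≤ |R s - R t|) :
    ∃ F : C(Icc (0 : ℝ) 1, ℝ), ∃ ψ : ℕ → ℕ, StrictMono ψ ∧ Tendsto (U ∘ ψ) atTop (𝓝 F) := by
  let V : ℕ → BoundedContinuousFunction (Icc (0 : ℝ) 1) ℝ := fun n =>
    BoundedContinuousFunction.mkOfCompact (U n)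
  have hcomp : IsCompact (closure (range V)) := by
    refine BoundedContinuousFunction.arzela_ascoli (Icc (-D) D) isCompact_Icc _ ?_ ?_
    · rintro _ t ⟨n, rfl⟩
      exact abs_le.1 (hD n t)
    · intro t
      rw [Metric.equicontinuousAt_iff]
      intro ε hε
      obtain ⟨δ, hδ, h⟩ := Metric.continuous_iff.1 (hR.comp continuous_subtype_val) t ε hε
      refine ⟨δ, hδ, fun s hs => ?_⟩
      rintro ⟨_, n, rfl⟩
      have := h s hs
      rw [dist_comm]
      exact (hU n s t).trans_lt this
  obtain ⟨F, -, ψ, hψ, hlim⟩ := hcomp.tendsto_subseq fun n => subset_closure (mem_range_self n)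
  refine ⟨F.toContinuousMap, ψ, hψ, ?_⟩
  exact ((ContinuousMap.isometryEquivBoundedOfCompact _ _).symm.continuous.tendsto F).comp hlim

theorem floor_mul_div_mem {n : ℕ} {t : ℝ} (ht : t ∈ Icc (0 : ℝ) 1) :
    (⌊(n : ℝ) * t⌋₊ / n : ℝ) ∈ Icc (0 : ℝ) 1 := by
  refine div_mem_unitInterval (Nat.floor_le_of_le ?_)
  exact mul_le_of_le_one_right (by positivity) ht.2

theorem tendsto_floor_mul_div {t : ℝ} (ht : 0 ≤ t) :
    Tendsto (fun n : ℕ => (⌊(n : ℝ) * t⌋₊ / n : ℝ)) atTop (𝓝 t) := by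
  simpa only [mul_comm, Function.comp_def] using
    (tendsto_nat_floor_mul_div_atTop ht).comp (tendsto_natCast_atTop_atTop (R := ℝ))

theorem tendsto_integral_mul_of_bounded (hρ : ∀ a b, IntervalIntegrable ρ volume a b)
    {w : ℕ → ℝ → ℝ} {w₀ : ℝ → ℝ} (hw : ∀ n, Measurable (w n)) (hB : ∀ n s, |w n s| ≤ B)
    (hlim : ∀ s ∈ Icc (0 : ℝ) 1, Tendsto (fun n => w n s) atTop (𝓝 (w₀ s))) {t : ℝ}
    (ht : t ∈ Icc (0 : ℝ) 1) :
    Tendsto (fun n => ∫ s in (0 : ℝ)..t, ρ s * w n s) atTop (𝓝 (∫ s in (0 : ℝ)..t, ρ s * w₀ s)) := by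
  refine intervalIntegral.tendsto_integral_filter_of_dominated_convergence
    (fun s => ‖ρ s‖ * B) (Eventually.of_forall fun n => ?_)
    (Eventually.of_forall fun n => ae_of_all _ fun s _ => ?_) ((hρ 0 t).norm.mul_const B)
    (ae_of_all _ fun s hs => ?_)
  · exact (hρ 0 t).def'.aestronglyMeasurable.mul (hw n).aestronglyMeasurable
  · rw [norm_mul]
    exact mul_le_mul_of_nonneg_left (hB n s) (norm_nonneg _)
  · rw [uIoc_of_le ht.1] at hs
    exact (hlim s ⟨hs.1.le, hs.2.trans ht.2⟩).const_mul _

/-- A two-point problem `x' = φ u`, `u' = ρ(t) f(x, u)`, `x 0 = 0`, `x 1 = L` with bounded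
continuous `f` and bounded continuous monotone `φ` is solvable, with `u 0` in a prescribed interval
`[a, b]` that is wide enough. -/
theorem exists_boundary_value_solution (hρ : ∀ a b, IntervalIntegrable ρ volume a b)
    (hρ0 : ∀ s, 0 ≤ ρ s) (hf : Continuous f) (hB : ∀ p, |f p| ≤ B) (hφ : Continuous φ)
    (hC : ∀ v, |φ v| ≤ C) (hmono : Monotone φ) {a b L : ℝ} (hab : a ≤ b)
    (ha : φ (a + B * ∫ s in (0 : ℝ)..1, ρ s) ≤ L)
    (hb : L ≤ φ (b - B * ∫ s in (0 : ℝ)..1, ρ s)) :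
    ∃ c ∈ Icc a b, ∃ u : ℝ → ℝ, Continuous u ∧
      (∀ t ∈ Icc (0 : ℝ) 1,
        u t = c + ∫ s in (0 : ℝ)..t, ρ s * f (∫ r in (0 : ℝ)..s, φ (u r), u s)) ∧
      ∫ s in (0 : ℝ)..1, φ (u s) = L := by
  choose c hc hcL using fun n : ℕ =>
    exists_euler_fst_eq hρ hρ0 hf hB hφ hmono hab ha hb n.succ_pos
  let y : ℕ → ℝ → ℝ × ℝ := fun n s => euler ρ f φ (n + 1) (c n) ⌊((n + 1 : ℕ) : ℝ) * s⌋₊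
  have hy : ∀ n, Measurable (y n) := fun n => measurable_step _ _
  have hfy : ∀ n, Measurable fun s => f (y n s) := fun n => hf.measurable.comp (hy n)
  have hφy : ∀ n, Measurable fun s => φ (y n s).2 := fun n =>
    hφ.measurable.comp (measurable_snd.comp (hy n))
  have hρR : Continuous fun t => ∫ s in (0 : ℝ)..t, ρ s * B :=
    intervalIntegral.continuous_primitive (fun a b => (hρ a b).mul_const B) 0
  let τ : ℕ → ℝ → ℝ := fun n t => ⌊((n + 1 : ℕ) : ℝ) * t⌋₊ / ((n + 1 : ℕ) : ℝ)
  have hτ : ∀ t ∈ Icc (0 : ℝ) 1, Tendsto (fun n => τ n t) atTop (𝓝 t) := fun t ht =>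
    (tendsto_floor_mul_div ht.1).comp (tendsto_add_atTop_nat 1)
  let U : ℕ → C(Icc (0 : ℝ) 1, ℝ) := fun n =>
    ⟨fun t => c n + ∫ s in (0 : ℝ)..t, ρ s * f (y n s),
      (continuous_const.add (intervalIntegral.continuous_primitive (fun a b =>
        intervalIntegrable_mul_of_bounded (hρ a b) (hfy n) fun s => hB _) 0)).comp
          continuous_subtype_val⟩
  obtain ⟨F, ψ, hψ, hlim⟩ := exists_subseq_tendsto_of_dist_le (U := U)
    (D := max |a| |b| + B * ∫ s in (0 : ℝ)..1, ρ s) hρR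
    (fun n t => (abs_add_le _ _).trans (add_le_add (abs_le_max_abs_abs (hc n).1 (hc n).2)
      (abs_integral_mul_le_of_mem hρ hρ0 (fun s => hB _) t.2)))
    (fun n s t => by
      simpa only [U, ContinuousMap.coe_mk, add_sub_add_left_eq_sub] using
        abs_integral_mul_sub_le hρ hρ0 (hfy n) (fun s => hB _) s t)
  have hψ' := hψ.tendsto_atTop
  have heval : ∀ {p : ℕ → Icc (0 : ℝ) 1} {q}, Tendsto p atTop (𝓝 q) →
      Tendsto (fun k => U (ψ k) (p k)) atTop (𝓝 (F q)) := fun hp =>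
    (continuous_eval.tendsto (F, _)).comp (hlim.prodMk_nhds hp)
  let u : ℝ → ℝ := IccExtend zero_le_one F
  have hu : Continuous u := F.continuous.Icc_extend'
  have huF : ∀ t (ht : t ∈ Icc (0 : ℝ) 1), u t = F ⟨t, ht⟩ := fun t ht => IccExtend_of_mem _ _ ht
  have hy2 : ∀ t ∈ Icc (0 : ℝ) 1, Tendsto (fun k => (y (ψ k) t).2) atTop (𝓝 (u t)) := by
    intro t ht
    have h1 : ∀ k, (y (ψ k) t).2 = U (ψ k) ⟨τ (ψ k) t, floor_mul_div_mem ht⟩ := fun k =>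
      euler_snd hρ hf hB (ψ k).succ_pos _ _
    simp only [h1, huF t ht]
    exact heval (tendsto_subtype_rng.2 ((hτ t ht).comp hψ'))
  have hint : ∀ t ∈ Icc (0 : ℝ) 1, Tendsto (fun k => ∫ s in (0 : ℝ)..t, φ (y (ψ k) s).2) atTop
      (𝓝 (∫ s in (0 : ℝ)..t, φ (u s))) := by
    intro t ht
    simpa only [one_mul] using tendsto_integral_mul_of_bounded (ρ := fun _ => (1 : ℝ))
      (fun a b => intervalIntegrable_const) (fun k => hφy (ψ k)) (fun k s => hC _)
      (fun s hs => (hφ.tendsto _).comp (hy2 s hs)) ht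
  have hy1 : ∀ t ∈ Icc (0 : ℝ) 1,
      Tendsto (fun k => (y (ψ k) t).1) atTop (𝓝 (∫ s in (0 : ℝ)..t, φ (u s))) := by
    intro t ht
    have h1 : ∀ k, (y (ψ k) t).1 = ∫ s in (0 : ℝ)..τ (ψ k) t, φ (y (ψ k) s).2 := fun k =>
      euler_fst hφ hC (ψ k).succ_pos _ _
    have h2 : Tendsto (fun k => C * |τ (ψ k) t - t|) atTop (𝓝 0) := by
      simpa using ((((hτ t ht).comp hψ').sub_const t).abs).const_mul C
    refine (hint t ht).congr_dist (squeeze_zero (fun _ => dist_nonneg) (fun k => ?_) h2)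
    rw [h1, dist_comm, Real.dist_eq]
    have hi : ∀ a b, IntervalIntegrable (fun s => φ (y (ψ k) s).2) volume a b := fun a b => by
      simpa only [one_mul] using intervalIntegrable_mul_of_bounded (ρ := fun _ => (1 : ℝ))
        intervalIntegrable_const (hφy (ψ k)) fun s => hC _
    rw [intervalIntegral.integral_interval_sub_left (hi _ _) (hi _ _)]
    exact intervalIntegral.norm_integral_le_of_norm_le_const
      (f := fun s => φ (y (ψ k) s).2) fun s _ => hC _
  have hw : ∀ t ∈ Icc (0 : ℝ) 1, Tendsto (fun k => ∫ s in (0 : ℝ)..t, ρ s * f (y (ψ k) s)) atTop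
      (𝓝 (∫ s in (0 : ℝ)..t, ρ s * f (∫ r in (0 : ℝ)..s, φ (u r), u s))) := fun t ht =>
    tendsto_integral_mul_of_bounded hρ (fun k => hfy (ψ k)) (fun k s => hB _)
      (fun s hs => (hf.tendsto _).comp ((hy1 s hs).prodMk_nhds (hy2 s hs))) ht
  have hU : ∀ t ∈ Icc (0 : ℝ) 1, Tendsto
      (fun k => c (ψ k) + ∫ s in (0 : ℝ)..t, ρ s * f (y (ψ k) s)) atTop (𝓝 (u t)) := by
    intro t ht
    rw [huF t ht]
    exact heval (tendsto_const_nhds (x := (⟨t, ht⟩ : Icc (0 : ℝ) 1)))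
  have hc0 : Tendsto (fun k => c (ψ k)) atTop (𝓝 (u 0)) := by
    simpa using hU 0 (left_mem_Icc.2 zero_le_one)
  refine ⟨u 0, isClosed_Icc.mem_of_tendsto hc0 (Eventually.of_forall fun k => hc _), u, hu,
    fun t ht => tendsto_nhds_unique (hU t ht) (hc0.add (hw t ht)), ?_⟩
  refine tendsto_nhds_unique (hint 1 (right_mem_Icc.2 zero_le_one)) ?_
  have h1 : ∀ k, ∫ s in (0 : ℝ)..1, φ (y (ψ k) s).2 = L := fun k => by
    rw [← hcL (ψ k), euler_fst hφ hC (ψ k).succ_pos, div_self (by positivity)]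
  simp only [h1, tendsto_const_nhds]

end Integral

end EulerShooting

/-- **Example 4.2** (oscillating operator `Φ(s) = sin s`). -/
theorem oscillating_operator_example
    (α : ℝ) (hα : -1 < α)
    (g h : ℝ → ℝ) (hg : Continuous g) (hh : Continuous h)
    (M : ℝ) (hM : IsGreatest ((fun y => |h y|) '' Icc (-(π / 2)) (π / 2)) M)
    (N : ℝ) (hN : IsLUB (Set.range fun x => |g x|) N)
    (lam : ℝ) (hlam : |lam| < π / 2)
    (hcond : Real.sin |lam| < 1 - 2 * M * N / (α + 1)) :
    ∃ x x' : ℝ → ℝ,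
      IntegrableOn x' (Icc 0 1) ∧
      (∀ t ∈ Icc (0:ℝ) 1, x t = ∫ s in (0:ℝ)..t, x' s) ∧
      x 0 = 0 ∧ x 1 = lam ∧
      (∀ᵐ t ∂(volume.restrict (Icc (0:ℝ) 1)), |x' t| < π / 2) ∧
      ∃ w : ℝ → ℝ, IntegrableOn w (Icc 0 1) ∧
        (∀ᵐ t ∂(volume.restrict (Icc (0:ℝ) 1)),
          w t = t ^ α * g (x t) * h (x' t)) ∧
        ∃ c : ℝ, ∀ᵐ t ∂(volume.restrict (Icc (0:ℝ) 1)),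
          Real.sin (x' t) = c + ∫ s in (0:ℝ)..t, w s := by
  have hhM : ∀ v, |h (arcsin v)| ≤ M := fun v => hM.2 ⟨_, arcsin_mem_Icc v, rfl⟩
  have hgN : ∀ z, |g z| ≤ N := fun z => hN.1 ⟨z, rfl⟩
  have hM0 : 0 ≤ M := (abs_nonneg _).trans (hhM 0)
  have hN0 : 0 ≤ N := (abs_nonneg _).trans (hgN 0)
  have hα1 : 0 < α + 1 := by linarith
  let f : ℝ × ℝ → ℝ := fun p => g p.1 * h (arcsin p.2)
  have hf : Continuous f :=
    (hg.comp continuous_fst).mul (hh.comp (continuous_arcsin.comp continuous_snd))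
  have hB : ∀ p, |f p| ≤ M * N := fun p => by
    rw [abs_mul, mul_comm]
    exact mul_le_mul (hhM _) (hgN _) (abs_nonneg _) hM0
  have hρ : ∀ a b, IntervalIntegrable (fun t : ℝ => |t ^ α|) volume a b := fun a b =>
    (intervalIntegral.intervalIntegrable_rpow' hα).abs
  have hρ0 : ∀ t : ℝ, 0 ≤ |t ^ α| := fun t => abs_nonneg _
  have hρpow : ∀ t : ℝ, 0 ≤ t → |t ^ α| = t ^ α := fun t ht => abs_of_nonneg (rpow_nonneg ht α)
  have hρ1 : ∫ s in (0 : ℝ)..1, |s ^ α| = 1 / (α + 1) := by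
    rw [intervalIntegral.integral_congr_Ioo_of_le zero_le_one
      (fun s hs => hρpow s hs.1.le : EqOn _ (fun s : ℝ => s ^ α) _),
      integral_rpow (Or.inl hα), one_rpow, zero_rpow hα1.ne', sub_zero]
  set K := M * N * ∫ s in (0 : ℝ)..1, |s ^ α| with hK
  have hK0 : 0 ≤ K := mul_nonneg (mul_nonneg hM0 hN0) (by rw [hρ1]; positivity)
  have hcond' : sin |lam| < 1 - 2 * K := by
    rw [hK, hρ1]
    exact hcond.trans_eq (by ring)
  have hs0 : 0 ≤ sin |lam| := sin_nonneg_of_nonneg_of_le_pi (abs_nonneg _) (by linarith [pi_pos])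
  have harc : arcsin (sin |lam|) = |lam| :=
    arcsin_sin (by linarith [abs_nonneg lam, pi_pos]) hlam.le
  obtain ⟨c, hc, u, hu, hueq, huL⟩ := EulerShooting.exists_boundary_value_solution hρ hρ0 hf hB
    continuous_arcsin (fun v => abs_le.2 (arcsin_mem_Icc v)) monotone_arcsin
    (a := -(K + sin |lam|)) (b := K + sin |lam|) (L := lam) (by linarith)
    (by rw [← hK, neg_add, add_right_comm, neg_add_cancel, zero_add, arcsin_neg, harc]
        exact neg_abs_le lam)
    (by rw [← hK, add_sub_cancel_left, harc]
        exact le_abs_self lam)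
  have hu1 : ∀ t ∈ Icc (0 : ℝ) 1, |u t| < 1 := fun t ht => by
    have h1 := EulerShooting.abs_integral_mul_le_of_mem hρ hρ0
      (w := fun s => f (∫ r in (0 : ℝ)..s, arcsin (u r), u s)) (fun s => hB _) ht
    rw [hueq t ht]
    linarith [abs_add_le c (∫ s in (0 : ℝ)..t,
      |s ^ α| * f (∫ r in (0 : ℝ)..s, arcsin (u r), u s)), abs_le.2 hc]
  have hv : Continuous fun t => arcsin (u t) := continuous_arcsin.comp hu
  have hx : Continuous fun t => ∫ s in (0 : ℝ)..t, arcsin (u s) :=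
    intervalIntegral.continuous_primitive (fun a b => hv.intervalIntegrable a b) 0
  have hae : ∀ {p : ℝ → Prop}, (∀ t ∈ Icc (0 : ℝ) 1, p t) →
      ∀ᵐ t ∂(volume.restrict (Icc (0 : ℝ) 1)), p t := fun hp =>
    (ae_restrict_iff' measurableSet_Icc).2 (ae_of_all _ hp)
  refine ⟨fun t => ∫ s in (0 : ℝ)..t, arcsin (u s), fun t => arcsin (u t),
    hv.integrableOn_Icc, fun t _ => rfl, intervalIntegral.integral_same, huL, hae fun t ht => ?_,
    fun t => |t ^ α| * f (∫ s in (0 : ℝ)..t, arcsin (u s), u t), ?_, hae fun t ht => ?_, c,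
    hae fun t ht => ?_⟩
  · have := abs_lt.1 (hu1 t ht)
    exact abs_lt.2 ⟨neg_pi_div_two_lt_arcsin.2 this.1, arcsin_lt_pi_div_two.2 this.2⟩
  · rw [← intervalIntegrable_iff_integrableOn_Icc_of_le zero_le_one]
    exact EulerShooting.intervalIntegrable_mul_of_bounded (hρ 0 1)
      (hf.comp (hx.prodMk hu)).measurable fun s => hB _
  · simp only [hρpow t ht.1, f, mul_assoc]
  · have := abs_lt.1 (hu1 t ht)
    rw [sin_arcsin this.1.le this.2.le]
    exact hueq t ht
end

section
/- p-Laplacian example, subcritical gradient growth (Example 4.3, case β < p − 1). Let p > 1, 0 ≤ β < p − 1, and let g : ℝ → ℝ be continuous and bounded. Then for every λ ∈ ℝ the problem ( |x'(t)|^{p−2} x'(t) )' = g(x(t)) |x'(t)|^β for a.e. t ∈ [0, 1], x(0) = 0, x(1) = λ, admits a solution x ∈ W^{1,1}([0,1]). -/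
open MeasureTheory Set Filter

/-- The inverse of `s ↦ |s| ^ (1 / r - 1) * s`, for `r > 0`: the odd extension of `y ↦ y ^ r`. -/
noncomputable def oddRpow (r y : ℝ) : ℝ := (max y 0) ^ r - (max (-y) 0) ^ r

lemma oddRpow_of_nonneg {r y : ℝ} (hr : 0 < r) (hy : 0 ≤ y) : oddRpow r y = y ^ r := by
  simp [oddRpow, hy, Real.zero_rpow hr.ne']

lemma oddRpow_neg (r y : ℝ) : oddRpow r (-y) = -oddRpow r y := by
  simp [oddRpow]

lemma continuous_oddRpow {r : ℝ} (hr : 0 ≤ r) : Continuous (oddRpow r) := by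
  unfold oddRpow
  exact ((continuous_id.max continuous_const).rpow_const fun _ => Or.inr hr).sub
    ((continuous_neg.max continuous_const).rpow_const fun _ => Or.inr hr)

lemma monotone_oddRpow {r : ℝ} (hr : 0 ≤ r) : Monotone (oddRpow r) := by
  intro a b hab
  unfold oddRpow
  gcongr

lemma abs_oddRpow {r : ℝ} (hr : 0 < r) (y : ℝ) : |oddRpow r y| = |y| ^ r := by
  rcases le_total 0 y with hy | hy
  · rw [oddRpow_of_nonneg hr hy, abs_of_nonneg hy, abs_of_nonneg (by positivity)]
  · have hy' : 0 ≤ -y := by linarith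
    rw [← neg_neg y, oddRpow_neg, oddRpow_of_nonneg hr hy', abs_neg, abs_neg, abs_of_nonneg hy',
      abs_of_nonneg (by positivity)]

lemma abs_rpow_mul_oddRpow {p : ℝ} (hp : 1 < p) (y : ℝ) :
    |oddRpow (1 / (p - 1)) y| ^ (p - 2) * oddRpow (1 / (p - 1)) y = y := by
  have hp' : 0 < p - 1 := by linarith
  have hr : 0 < 1 / (p - 1) := by positivity
  have key : ∀ y : ℝ, 0 ≤ y →
      |oddRpow (1 / (p - 1)) y| ^ (p - 2) * oddRpow (1 / (p - 1)) y = y := by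
    intro y hy
    rcases hy.eq_or_lt with rfl | hy
    · simp [oddRpow]
    · rw [oddRpow_of_nonneg hr hy.le, abs_of_nonneg (by positivity), ← Real.rpow_mul hy.le,
        ← Real.rpow_add hy]
      have : 1 / (p - 1) * (p - 2) + 1 / (p - 1) = 1 := by field_simp; ring
      rw [this, Real.rpow_one]
  rcases le_total 0 y with hy | hy
  · exact key y hy
  · have h := key (-y) (by linarith)
    rw [oddRpow_neg, abs_neg] at h
    linarith

lemma exists_mul_rpow_le {γ : ℝ} (hγ : γ < 1) (C : ℝ) {A : ℝ} (hA : 0 ≤ A) :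
    ∃ m, 0 ≤ m ∧ C * (2 * m + A) ^ γ ≤ m := by
  have h0 : Tendsto (fun s : ℝ => C * s ^ (-(1 - γ))) atTop (nhds 0) := by
    simpa using (tendsto_rpow_neg_atTop (by linarith : 0 < 1 - γ)).const_mul C
  have h1 : ∀ᶠ s : ℝ in atTop, C * s ^ (-(1 - γ)) < 1 / 4 :=
    h0.eventually (gt_mem_nhds (by norm_num))
  obtain ⟨s, hs, hsA, hs0⟩ :=
    (h1.and ((eventually_ge_atTop (2 * A)).and (eventually_gt_atTop 0))).exists
  refine ⟨(s - A) / 2, by linarith, ?_⟩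
  have e : s ^ γ = s ^ (-(1 - γ)) * s := by
    rw [← Real.rpow_add_one hs0.ne']; congr 1; ring
  rw [show 2 * ((s - A) / 2) + A = s by ring, e]
  nlinarith

/-- Euler's scheme with step `h` for the autonomous equation `z' = F z`. -/
def eulerScheme {E : Type*} [AddCommGroup E] [Module ℝ E] (F : E → E) (h : ℝ) (c : E) : ℕ → E
  | 0 => c
  | k + 1 => eulerScheme F h c k + h • F (eulerScheme F h c k)

section EulerScheme

variable {E : Type*} [NormedAddCommGroup E] [NormedSpace ℝ E]

lemma continuous_eulerScheme {F : E → E} (hF : Continuous F) (h : ℝ) (k : ℕ) :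
    Continuous fun c => eulerScheme F h c k := by
  induction k with
  | zero => exact continuous_id
  | succ k ih => exact ih.add ((hF.comp ih).const_smul h)

/-- The velocity of the Euler polygon with `n + 1` steps per unit of time. -/
noncomputable def eulerVelocity (F : E → E) (n : ℕ) (c : E) (s : ℝ) : E :=
  F (eulerScheme F (1 / ((n : ℝ) + 1)) c ⌊((n : ℝ) + 1) * s⌋₊)

/-- The Euler polygon with `n + 1` steps per unit of time. -/
noncomputable def eulerPolygon (F : E → E) (n : ℕ) (c : E) (t : ℝ) : E :=
  c + ∫ s in (0 : ℝ)..t, eulerVelocity F n c s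

variable {F : E → E} {L : ℝ}

lemma stronglyMeasurable_eulerVelocity (F : E → E) (n : ℕ) (c : E) :
    StronglyMeasurable (eulerVelocity F n c) :=
  (StronglyMeasurable.of_discrete
    (f := fun k : ℕ => F (eulerScheme F (1 / ((n : ℝ) + 1)) c k))).comp_measurable
    (Nat.measurable_floor.comp (measurable_const.mul measurable_id))

lemma intervalIntegrable_eulerVelocity (hL : ∀ z, ‖F z‖ ≤ L) (n : ℕ) (c : E) (a b : ℝ) :
    IntervalIntegrable (eulerVelocity F n c) volume a b :=
  (intervalIntegrable_const (c := L)).mono_fun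
    (stronglyMeasurable_eulerVelocity F n c).aestronglyMeasurable
    (Eventually.of_forall fun _ => (hL _).trans (le_abs_self L))

lemma norm_eulerPolygon_sub_le (hL : ∀ z, ‖F z‖ ≤ L) (n : ℕ) (c : E) (s t : ℝ) :
    ‖eulerPolygon F n c t - eulerPolygon F n c s‖ ≤ L * |t - s| := by
  have hi := intervalIntegrable_eulerVelocity hL n c
  rw [eulerPolygon, eulerPolygon, add_sub_add_left_eq_sub,
    intervalIntegral.integral_interval_sub_left (hi _ _) (hi _ _)]
  exact intervalIntegral.norm_integral_le_of_norm_le_const fun _ _ => hL _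

lemma eulerPolygon_node [CompleteSpace E] (hL : ∀ z, ‖F z‖ ≤ L) (n : ℕ) (c : E) (k : ℕ) :
    eulerPolygon F n c (k / ((n : ℝ) + 1)) = eulerScheme F (1 / ((n : ℝ) + 1)) c k := by
  have hn : (0 : ℝ) < (n : ℝ) + 1 := by positivity
  induction k with
  | zero => simp [eulerPolygon, eulerScheme]
  | succ k ih =>
    have hi := intervalIntegrable_eulerVelocity hL n c
    have hle : (k : ℝ) / ((n : ℝ) + 1) ≤ ((k + 1 : ℕ) : ℝ) / ((n : ℝ) + 1) := by
      gcongr; simp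
    have hcell : ∫ s in (k : ℝ) / ((n : ℝ) + 1)..((k + 1 : ℕ) : ℝ) / ((n : ℝ) + 1),
        eulerVelocity F n c s =
        (1 / ((n : ℝ) + 1)) • F (eulerScheme F (1 / ((n : ℝ) + 1)) c k) := by
      have hcongr : ∫ s in (k : ℝ) / ((n : ℝ) + 1)..((k + 1 : ℕ) : ℝ) / ((n : ℝ) + 1),
          eulerVelocity F n c s =
          ∫ s in (k : ℝ) / ((n : ℝ) + 1)..((k + 1 : ℕ) : ℝ) / ((n : ℝ) + 1),
            F (eulerScheme F (1 / ((n : ℝ) + 1)) c k) := by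
        refine intervalIntegral.integral_congr_Ioo_of_le hle fun s hs => ?_
        have h1 := (div_lt_iff₀ hn).1 hs.1
        have h2 := (lt_div_iff₀ hn).1 hs.2
        have hfl : ⌊((n : ℝ) + 1) * s⌋₊ = k := by
          rw [Nat.floor_eq_iff (by nlinarith [(k.cast_nonneg : (0 : ℝ) ≤ k)])]
          push_cast at h2
          constructor <;> linarith
        simp only [eulerVelocity, hfl]
      rw [hcongr, intervalIntegral.integral_const]
      congr 1
      push_cast
      ring
    have hsplit := intervalIntegral.integral_add_adjacent_intervals (hi 0 (k / ((n : ℝ) + 1)))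
      (hi (k / ((n : ℝ) + 1)) (((k + 1 : ℕ) : ℝ) / ((n : ℝ) + 1)))
    rw [eulerPolygon, ← hsplit, hcell, ← add_assoc, ← eulerPolygon, ih, eulerScheme]

lemma norm_eulerPolygon_sub_eulerScheme_le [CompleteSpace E] (hL : ∀ z, ‖F z‖ ≤ L) (n : ℕ)
    (c : E) {t : ℝ} (ht : 0 ≤ t) :
    ‖eulerPolygon F n c t - eulerScheme F (1 / ((n : ℝ) + 1)) c ⌊((n : ℝ) + 1) * t⌋₊‖ ≤
      L * (1 / ((n : ℝ) + 1)) := by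
  have hn : (0 : ℝ) < (n : ℝ) + 1 := by positivity
  rw [← eulerPolygon_node hL]
  refine (norm_eulerPolygon_sub_le hL _ _ _ _).trans ?_
  have hL0 : 0 ≤ L := (norm_nonneg _).trans (hL c)
  gcongr
  have h1 : (⌊((n : ℝ) + 1) * t⌋₊ : ℝ) / ((n : ℝ) + 1) ≤ t := by
    rw [div_le_iff₀ hn, mul_comm t]
    exact Nat.floor_le (by positivity)
  have h2 : t ≤ (⌊((n : ℝ) + 1) * t⌋₊ : ℝ) / ((n : ℝ) + 1) + 1 / ((n : ℝ) + 1) := by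
    rw [← add_div, le_div_iff₀ hn, mul_comm t]
    exact (Nat.lt_floor_add_one _).le
  rw [abs_le]
  constructor <;> linarith

/-- If Euler schemes for `z' = F z` with step tending to zero start in a compact set `K` and reach
a closed set `S` at time one, then so does some solution. -/
theorem exists_solution_of_eulerScheme [FiniteDimensional ℝ E] (hF : Continuous F)
    (hL : ∀ z, ‖F z‖ ≤ L) {K S : Set E} (hK : IsCompact K) (hS : IsClosed S)
    (h : ∀ n : ℕ, ∃ c ∈ K, eulerScheme F (1 / ((n : ℝ) + 1)) c (n + 1) ∈ S) :
    ∃ z : ℝ → E, Continuous z ∧ z 0 ∈ K ∧ z 1 ∈ S ∧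
      ∀ t ∈ Icc (0 : ℝ) 1, z t = z 0 + ∫ s in (0 : ℝ)..t, F (z s) := by
  have : CompleteSpace E := FiniteDimensional.complete ℝ E
  choose c hcK hcS using h
  have hL0 : 0 ≤ L := (norm_nonneg _).trans (hL (c 0))
  have hlip : ∀ n, LipschitzWith L.toNNReal (eulerPolygon F n (c n)) := fun n =>
    LipschitzWith.of_dist_le_mul fun s t => by
      rw [dist_eq_norm, Real.dist_eq, Real.coe_toNNReal _ hL0]
      exact norm_eulerPolygon_sub_le hL n (c n) t s
  let Z : ℕ → BoundedContinuousFunction (Icc (0 : ℝ) 1) E := fun n =>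
    BoundedContinuousFunction.mkOfCompact
      ⟨fun t => eulerPolygon F n (c n) t, (hlip n).continuous.comp continuous_subtype_val⟩
  obtain ⟨M, hM⟩ := hK.isBounded.exists_norm_le
  have hcpt : IsCompact (closure (range Z)) := by
    refine BoundedContinuousFunction.arzela_ascoli (Metric.closedBall (0 : E) (M + L))
      (isCompact_closedBall _ _) (range Z) ?_ ?_
    · rintro _ t ⟨n, rfl⟩
      have h1 := norm_eulerPolygon_sub_le hL n (c n) 0 t
      have h2 : eulerPolygon F n (c n) 0 = c n := by simp [eulerPolygon]
      rw [h2, sub_zero, abs_of_nonneg t.2.1] at h1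
      have h3 := norm_le_norm_add_norm_sub' (eulerPolygon F n (c n) t) (c n)
      have h4 : L * (t : ℝ) ≤ L := mul_le_of_le_one_right hL0 t.2.2
      rw [mem_closedBall_zero_iff]
      show ‖eulerPolygon F n (c n) t‖ ≤ _
      linarith [hM _ (hcK n)]
    · refine (LipschitzWith.uniformEquicontinuous _ L.toNNReal ?_).equicontinuous
      rintro ⟨_, n, rfl⟩
      exact fun s t => hlip n s t
  obtain ⟨z, -, φ, hφ, hz⟩ := hcpt.tendsto_subseq fun n =>
    subset_closure (mem_range_self (f := Z) n)
  have hpt : ∀ t (ht : t ∈ Icc (0 : ℝ) 1),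
      Tendsto (fun n => eulerPolygon F (φ n) (c (φ n)) t) atTop (nhds (z ⟨t, ht⟩)) := fun t ht =>
    ((continuous_eval_const (F := BoundedContinuousFunction (Icc (0 : ℝ) 1) E)
      (⟨t, ht⟩ : Icc (0 : ℝ) 1)).tendsto z).comp hz
  let y : ℝ → E := IccExtend zero_le_one z
  have hy : Continuous y := z.continuous.Icc_extend'
  have hyz : ∀ t ∈ Icc (0 : ℝ) 1,
      Tendsto (fun n => eulerPolygon F (φ n) (c (φ n)) t) atTop (nhds (y t)) := fun t ht => by
    simpa only [y, IccExtend_of_mem zero_le_one z ht] using hpt t ht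
  have hstep : Tendsto (fun n : ℕ => L * (1 / ((φ n : ℝ) + 1))) atTop (nhds 0) := by
    simpa using ((tendsto_one_div_add_atTop_nhds_zero_nat (𝕜 := ℝ)).comp
      hφ.tendsto_atTop).const_mul L
  have hvel : ∀ t ∈ Icc (0 : ℝ) 1,
      Tendsto (fun n => eulerVelocity F (φ n) (c (φ n)) t) atTop (nhds (F (y t))) := fun t ht => by
    refine (hF.tendsto (y t)).comp ?_
    have hd := squeeze_zero_norm
      (fun n => norm_eulerPolygon_sub_eulerScheme_le hL (φ n) (c (φ n)) ht.1) hstep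
    simpa using (hyz t ht).sub hd
  have h0 := hyz 0 (by simp)
  have h1 := hyz 1 (by simp)
  have hzero : ∀ n, eulerPolygon F n (c n) 0 = c n := fun n => by simp [eulerPolygon]
  simp only [hzero] at h0
  refine ⟨y, hy, hK.isClosed.mem_of_tendsto h0 (Eventually.of_forall fun n => hcK _),
    hS.mem_of_tendsto h1 (Eventually.of_forall fun n => ?_), fun t ht => ?_⟩
  · have hnode := eulerPolygon_node hL (φ n) (c (φ n)) (φ n + 1)
    rw [Nat.cast_add_one, div_self (by positivity)] at hnode
    rw [hnode]
    exact hcS _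
  · refine tendsto_nhds_unique (hyz t ht) (h0.add ?_)
    refine intervalIntegral.tendsto_integral_filter_of_dominated_convergence (fun _ => L)
      (Eventually.of_forall fun n =>
        (stronglyMeasurable_eulerVelocity F _ _).aestronglyMeasurable)
      (Eventually.of_forall fun n => Eventually.of_forall fun s _ => hL _)
      intervalIntegrable_const (Eventually.of_forall fun s hs => ?_)
    rw [uIoc_of_le ht.1] at hs
    exact hvel s ⟨hs.1.le, hs.2.trans ht.2⟩

end EulerScheme

/-- Shooting for the planar system `x' = φ y`, `y' = f (x, y)` with `φ` monotone and `f` bounded. -/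
theorem exists_planar_solution {φ : ℝ → ℝ} {f : ℝ × ℝ → ℝ} {M m a b lam : ℝ}
    (hφ : Continuous φ) (hmono : Monotone φ) (hM : ∀ y, |φ y| ≤ M)
    (hf : Continuous f) (hm : ∀ z, |f z| ≤ m)
    (hab : a ≤ b) (ha : φ (a + m) ≤ lam) (hb : lam ≤ φ (b - m)) :
    ∃ x y : ℝ → ℝ, Continuous x ∧ Continuous y ∧ x 0 = 0 ∧ x 1 = lam ∧ y 0 ∈ Icc a b ∧
      ∀ t ∈ Icc (0 : ℝ) 1, x t = ∫ s in (0 : ℝ)..t, φ (y s) ∧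
        y t = y 0 + ∫ s in (0 : ℝ)..t, f (x s, y s) := by
  let F : ℝ × ℝ → ℝ × ℝ := fun z => (φ z.2, f z)
  have hF : Continuous F := (hφ.comp continuous_snd).prodMk hf
  have hL : ∀ z, ‖F z‖ ≤ max M m := fun z => max_le_max (hM _) (hm _)
  have hm0 : 0 ≤ m := (abs_nonneg _).trans (hm 0)
  have hEuler : ∀ n : ℕ, ∃ c ∈ ({0} : Set ℝ) ×ˢ Icc a b,
      eulerScheme F (1 / ((n : ℝ) + 1)) c (n + 1) ∈ ({lam} : Set ℝ) ×ˢ univ := by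
    intro n
    set h : ℝ := 1 / ((n : ℝ) + 1) with hh
    have hn : ((n : ℝ) + 1) * h = 1 := by rw [hh]; field_simp
    have hpos : 0 < h := by positivity
    have hy : ∀ c k, |(eulerScheme F h (0, c) k).2 - c| ≤ k * h * m := by
      intro c k
      induction k with
      | zero => simp [eulerScheme]
      | succ k ih =>
        have e : (eulerScheme F h (0, c) (k + 1)).2 - c =
            ((eulerScheme F h (0, c) k).2 - c) + h * f (eulerScheme F h (0, c) k) := by
          simp [eulerScheme, F]; ring
        rw [e]
        refine (abs_add_le _ _).trans ?_
        rw [abs_mul, abs_of_pos hpos]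
        have := mul_le_mul_of_nonneg_left (hm (eulerScheme F h (0, c) k)) hpos.le
        push_cast
        linarith
    have hy' : ∀ c k, k ≤ n + 1 → |(eulerScheme F h (0, c) k).2 - c| ≤ m := by
      intro c k hk
      refine (hy c k).trans (mul_le_of_le_one_left hm0 ?_)
      rw [← hn]
      gcongr
      exact_mod_cast hk
    have hxa : ∀ k ≤ n + 1, (eulerScheme F h (0, a) k).1 ≤ k * h * lam := by
      intro k hk
      induction k with
      | zero => simp [eulerScheme]
      | succ k ih =>
        have h1 := (abs_le.1 (hy' a k (by omega))).2
        have h2 := mul_le_mul_of_nonneg_left ((hmono (by linarith :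
          (eulerScheme F h (0, a) k).2 ≤ a + m)).trans ha) hpos.le
        have e : (eulerScheme F h (0, a) (k + 1)).1 =
          (eulerScheme F h (0, a) k).1 + h * φ (eulerScheme F h (0, a) k).2 := by
          simp [eulerScheme, F]
        rw [e]
        push_cast
        linarith [ih (by omega)]
    have hxb : ∀ k ≤ n + 1, k * h * lam ≤ (eulerScheme F h (0, b) k).1 := by
      intro k hk
      induction k with
      | zero => simp [eulerScheme]
      | succ k ih =>
        have h1 := (abs_le.1 (hy' b k (by omega))).1
        have h2 := mul_le_mul_of_nonneg_left (hb.trans (hmono (by linarith :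
          b - m ≤ (eulerScheme F h (0, b) k).2))) hpos.le
        have e : (eulerScheme F h (0, b) (k + 1)).1 =
          (eulerScheme F h (0, b) k).1 + h * φ (eulerScheme F h (0, b) k).2 := by
          simp [eulerScheme, F]
        rw [e]
        push_cast
        linarith [ih (by omega)]
    have hcont : Continuous fun c : ℝ => (eulerScheme F h (0, c) (n + 1)).1 :=
      continuous_fst.comp ((continuous_eulerScheme hF h (n + 1)).comp (by fun_prop))
    have ea := hxa (n + 1) le_rfl
    have eb := hxb (n + 1) le_rfl
    rw [Nat.cast_add_one, hn, one_mul] at ea eb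
    obtain ⟨c, hc, hcl⟩ := intermediate_value_Icc hab hcont.continuousOn ⟨ea, eb⟩
    exact ⟨(0, c), ⟨rfl, hc⟩, hcl, mem_univ _⟩
  obtain ⟨z, hz, hz0, hz1, hzeq⟩ := exists_solution_of_eulerScheme hF hL
    (isCompact_singleton.prod isCompact_Icc) (isClosed_singleton.prod isClosed_univ) hEuler
  refine ⟨fun t => (z t).1, fun t => (z t).2, continuous_fst.comp hz, continuous_snd.comp hz,
    hz0.1, hz1.1, hz0.2, fun t ht => ?_⟩
  have hint : IntervalIntegrable (fun s => F (z s)) volume 0 t :=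
    (hF.comp hz).intervalIntegrable _ _
  have e1 := (ContinuousLinearMap.fst ℝ ℝ ℝ).intervalIntegral_comp_comm hint
  have e2 := (ContinuousLinearMap.snd ℝ ℝ ℝ).intervalIntegral_comp_comm hint
  have hx0 : (z 0).1 = 0 := hz0.1
  constructor
  · have := congrArg Prod.fst (hzeq t ht)
    rw [Prod.fst_add, hx0, zero_add] at this
    exact this.trans e1.symm
  · have := congrArg Prod.snd (hzeq t ht)
    rw [Prod.snd_add] at this
    exact this.trans (congrArg _ e2.symm)

/-- **Example 4.3, case β < p − 1** (p-Laplacian with subcritical gradient growth):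
for every `λ` the problem `(|x'|^{p−2}x')' = g(x)|x'|^β`, `x(0)=0`, `x(1)=λ`, has a
solution. -/
theorem pLaplacian_subcritical_example
    (p β : ℝ) (hp : 1 < p) (hβ0 : 0 ≤ β) (hβ : β < p - 1)
    (g : ℝ → ℝ) (hg : Continuous g) (hgbdd : ∃ C : ℝ, ∀ x, |g x| ≤ C)
    (lam : ℝ) :
    ∃ x x' : ℝ → ℝ,
      IntegrableOn x' (Icc 0 1) ∧
      (∀ t ∈ Icc (0:ℝ) 1, x t = ∫ s in (0:ℝ)..t, x' s) ∧
      x 0 = 0 ∧ x 1 = lam ∧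
      ∃ w : ℝ → ℝ, IntegrableOn w (Icc 0 1) ∧
        (∀ᵐ t ∂(volume.restrict (Icc (0:ℝ) 1)),
          w t = g (x t) * |x' t| ^ β) ∧
        ∃ c : ℝ, ∀ᵐ t ∂(volume.restrict (Icc (0:ℝ) 1)),
          |x' t| ^ (p - 2) * x' t = c + ∫ s in (0:ℝ)..t, w s := by
  obtain ⟨C, hC⟩ := hgbdd
  have hC0 : 0 ≤ C := (abs_nonneg _).trans (hC 0)
  have hp' : 0 < p - 1 := by linarith
  set r : ℝ := 1 / (p - 1) with hr_def
  have hr : 0 < r := by positivity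
  have hγ : r * β < 1 := by
    rw [hr_def, one_div, inv_mul_lt_iff₀ hp']; linarith
  set A : ℝ := |lam| ^ (p - 1) with hA_def
  have hA : 0 ≤ A := by positivity
  have hψA : oddRpow r A = |lam| := by
    rw [oddRpow_of_nonneg hr hA, hA_def, ← Real.rpow_mul (abs_nonneg _), hr_def,
      mul_one_div_cancel hp'.ne', Real.rpow_one]
  obtain ⟨m, hm0, hm⟩ := exists_mul_rpow_le hγ C hA
  set R : ℝ := 2 * m + A with hR
  have hR0 : 0 ≤ R := by positivity
  let clamp : ℝ → ℝ := fun y => max (-R) (min R y)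
  have hclamp : Continuous clamp := by fun_prop
  have hclamp_abs : ∀ y, |clamp y| ≤ R := fun y =>
    abs_le.2 ⟨le_max_left _ _, max_le (by linarith) (min_le_left _ _)⟩
  have hclamp_eq : ∀ y, |y| ≤ R → clamp y = y := fun y hy => by
    simp only [clamp]
    rw [min_eq_right (abs_le.1 hy).2, max_eq_right (abs_le.1 hy).1]
  have hclamp_mono : Monotone clamp := fun u v huv => max_le_max le_rfl (min_le_min le_rfl huv)
  let φ : ℝ → ℝ := fun y => oddRpow r (clamp y)
  have hφ : Continuous φ := (continuous_oddRpow hr.le).comp hclamp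
  have hφ_abs : ∀ y, |φ y| ≤ R ^ r := fun y => by
    simp only [φ, abs_oddRpow hr]
    exact Real.rpow_le_rpow (abs_nonneg _) (hclamp_abs y) hr.le
  let f : ℝ × ℝ → ℝ := fun z => g z.1 * |φ z.2| ^ β
  have hf : Continuous f :=
    (hg.comp continuous_fst).mul
      ((hφ.comp continuous_snd).abs.rpow_const fun _ => Or.inr hβ0)
  have hf_abs : ∀ z, |f z| ≤ m := fun z => by
    refine le_trans ?_ hm
    rw [abs_mul, abs_of_nonneg (by positivity : 0 ≤ |φ z.2| ^ β), Real.rpow_mul hR0]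
    exact mul_le_mul (hC _) (Real.rpow_le_rpow (abs_nonneg _) (hφ_abs _) hβ0)
      (by positivity) hC0
  have hφA : φ A = |lam| := by
    simp only [φ]
    rw [hclamp_eq A (by rw [abs_of_nonneg hA]; linarith), hψA]
  have hφnegA : φ (-A) = -|lam| := by
    simp only [φ]
    rw [hclamp_eq (-A) (by rw [abs_neg, abs_of_nonneg hA]; linarith), oddRpow_neg, hψA]
  obtain ⟨x, y, hx, hy, hx0, hx1, hy0, hxy⟩ :=
    exists_planar_solution (a := -(A + m)) (b := A + m) (lam := lam) hφ
      ((monotone_oddRpow hr.le).comp hclamp_mono) hφ_abs hf hf_abs (by linarith)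
      (by rw [show -(A + m) + m = -A by ring, hφnegA]; exact neg_abs_le lam)
      (by rw [add_sub_cancel_right, hφA]; exact le_abs_self lam)
  have hw : Continuous fun t => f (x t, y t) := hf.comp (hx.prodMk hy)
  have hy_abs : ∀ t ∈ Icc (0 : ℝ) 1, |y t| ≤ R := fun t ht => by
    have h1 : ‖∫ s in (0 : ℝ)..t, f (x s, y s)‖ ≤ m * |t - 0| :=
      intervalIntegral.norm_integral_le_of_norm_le_const fun _ _ => hf_abs _
    rw [sub_zero, abs_of_nonneg ht.1, Real.norm_eq_abs] at h1
    have h2 : m * t ≤ m := mul_le_of_le_one_right hm0 ht.2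
    have h3 := abs_le.1 h1
    rw [(hxy t ht).2, abs_le]
    constructor <;> linarith [hy0.1, hy0.2]
  refine ⟨x, fun t => φ (y t), (hφ.comp hy).integrableOn_Icc, fun t ht => (hxy t ht).1, hx0, hx1,
    fun t => f (x t, y t), hw.integrableOn_Icc, Eventually.of_forall fun t => rfl, y 0, ?_⟩
  filter_upwards [ae_restrict_mem measurableSet_Icc] with t ht
  rw [← (hxy t ht).2]
  simp only [φ]
  rw [hclamp_eq _ (hy_abs t ht)]
  exact abs_rpow_mul_oddRpow hp _
end

section
/- p-Laplacian example, supercritical gradient growth (Example 4.3, case β > p − 1). Let p > 1, β > p − 1, let g : ℝ → ℝ be continuous and bounded with N = ‖g‖_{L^∞(ℝ)} > 0, and define ℓ(z) = (z/N)^{(p−1)/β} − 2z for z ≥ 0. If λ ∈ ℝ satisfies |λ|^{p−1} ≤ sup_{z ≥ 0} ℓ(z), then the problem ( |x'(t)|^{p−2} x'(t) )' = g(x(t)) |x'(t)|^β for a.e. t ∈ [0, 1], x(0) = 0, x(1) = λ, admits a solution x ∈ W^{1,1}([0,1]). In particular, for the equation x''(t) = cos(x(t)) (x'(t))⁴ (p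 = 2, β = 4, N = 1), a solution with x(0) = 0, x(1) = λ exists whenever |λ| ≤ 3/8. -/
open MeasureTheory Set Filter

/-- A `C¹` function whose derivative is bounded below by a positive constant is invertible. -/
theorem exists_inverse_of_hasDerivAt_ge {f φ : ℝ → ℝ} {m : ℝ} (hm : 0 < m)
    (hf : ∀ x, HasDerivAt f (φ x) x) (hφ : ∀ x, m ≤ φ x) :
    ∃ h : ℝ → ℝ, (∀ t, f (h t) = t) ∧ (∀ x, h (f x) = x) ∧ Monotone h ∧
      ∀ t, HasDerivAt h (φ (h t))⁻¹ t := by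
  have hcont : Continuous f := continuous_iff_continuousAt.2 fun x => (hf x).continuousAt
  have hmono : StrictMono f :=
    strictMono_of_deriv_pos fun x => by rw [(hf x).deriv]; exact hm.trans_le (hφ x)
  have hlin : Monotone fun x => f x - m * x := by
    have hd : ∀ x, HasDerivAt (fun x => f x - m * x) (φ x - m) x := fun x => by
      simpa using (hf x).fun_sub ((hasDerivAt_id' x).const_mul m)
    refine monotone_of_deriv_nonneg (fun x => (hd x).differentiableAt) fun x => ?_
    rw [(hd x).deriv]
    exact sub_nonneg.2 (hφ x)
  have htop : Tendsto f atTop atTop := by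
    refine tendsto_atTop_mono' atTop ?_
      (tendsto_atTop_add_const_right atTop (f 0) (tendsto_id.const_mul_atTop hm))
    filter_upwards [eventually_ge_atTop 0] with x hx
    have := hlin hx
    simp at this ⊢
    linarith
  have hbot : Tendsto f atBot atBot := by
    refine tendsto_atBot_mono' atBot ?_
      (tendsto_atBot_add_const_right atBot (f 0) (tendsto_id.const_mul_atBot hm))
    filter_upwards [eventually_le_atBot 0] with x hx
    have := hlin hx
    simp at this ⊢
    linarith
  let e := (hmono.orderIsoOfSurjective f (hcont.surjective htop hbot))
  have hfe : ∀ t, f (e.symm t) = t := fun t => e.apply_symm_apply t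
  refine ⟨e.symm, hfe, fun x => e.symm_apply_apply x, e.symm.monotone, fun t => ?_⟩
  exact HasDerivAt.of_local_left_inverse e.symm.continuous.continuousAt (hf _)
    (hm.trans_le (hφ _)).ne' (Eventually.of_forall hfe)

/-- Antiderivative of a continuous function. -/
theorem hasDerivAt_integral_zero {f : ℝ → ℝ} (hf : Continuous f) (x : ℝ) :
    HasDerivAt (fun y => ∫ s in (0:ℝ)..y, f s) (f x) x :=
  intervalIntegral.integral_hasDerivAt_right (hf.intervalIntegrable _ _)
    (hf.stronglyMeasurableAtFilter _ _) hf.continuousAt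

/-- An increasing solution of `v' = k g(X) exp (α v)`, `X' = exp v` with `X 0 = 0`,
`X 1 = exp L`, under a smallness condition on `g`. -/
theorem exists_increasing_solution {k N α L δ : ℝ} (hk : 0 ≤ k) (hα : 0 ≤ α) (hδ : 0 < δ)
    {g : ℝ → ℝ} (hg : Continuous g) (hgN : ∀ x, |g x| ≤ N)
    (hsmall : k * N * Real.exp (α * (L + δ)) ≤ δ) :
    ∃ v X : ℝ → ℝ, X 0 = 0 ∧ X 1 = Real.exp L ∧
      (∀ t ∈ Icc (0:ℝ) 1, HasDerivAt X (Real.exp (v t)) t) ∧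
      (∀ t ∈ Icc (0:ℝ) 1, HasDerivAt v (k * g (X t) * Real.exp (α * v t)) t) ∧
      Continuous v ∧ Continuous X := by
  set lam := Real.exp L with hlam
  have hlpos : 0 < lam := Real.exp_pos L
  let cl : ℝ → ℝ := fun v => max (L - δ) (min v (L + δ))
  have hclc : Continuous cl := by fun_prop
  have hcl1 : ∀ v, L - δ ≤ cl v := fun v => le_max_left _ _
  have hcl2 : ∀ v, cl v ≤ L + δ := fun v => max_le (by linarith) (min_le_right _ _)
  have hcleq : ∀ v, L - δ ≤ v → v ≤ L + δ → cl v = v := fun v h1 h2 => by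
    simp only [cl, min_eq_left h2, max_eq_right h1]
  -- separation of variables
  let a : ℝ → ℝ := fun s => Real.exp (-((α - 1) * cl s))
  have hac : Continuous a := by fun_prop
  obtain ⟨m, hm, ham⟩ : ∃ m > 0, ∀ s, m ≤ a s := by
    refine ⟨Real.exp (-(|α - 1| * (|L| + δ))), Real.exp_pos _, fun s => ?_⟩
    apply Real.exp_le_exp.2
    have h1 : |cl s| ≤ |L| + δ := by
      rw [abs_le]
      constructor <;> linarith [hcl1 s, hcl2 s, neg_abs_le L, le_abs_self L]
    have h2 := mul_le_mul_of_nonneg_left h1 (abs_nonneg (α - 1))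
    rw [← abs_mul] at h2
    linarith [le_abs_self ((α - 1) * cl s)]
  obtain ⟨h, hAh, hhA, hhmono, hhd⟩ :=
    exists_inverse_of_hasDerivAt_ge hm (hasDerivAt_integral_zero hac) ham
  have hhc : Continuous h := continuous_iff_continuousAt.2 fun x => (hhd x).continuousAt
  let G : ℝ → ℝ := fun x => ∫ s in (0:ℝ)..x, g s
  have hGd : ∀ x, HasDerivAt G (g x) x := hasDerivAt_integral_zero hg
  have hGc : Continuous G := continuous_iff_continuousAt.2 fun x => (hGd x).continuousAt
  have hGb : ∀ x ∈ Icc 0 lam, |k * G x| ≤ k * (N * lam) := by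
    intro x hx
    have h1 : |G x| ≤ N * |x - 0| := by
      rw [← Real.norm_eq_abs (G x)]
      exact intervalIntegral.norm_integral_le_of_norm_le_const fun s _ => hgN s
    have hN0 : 0 ≤ N := (abs_nonneg _).trans (hgN 0)
    rw [abs_mul, abs_of_nonneg hk]
    rw [sub_zero, abs_of_nonneg hx.1] at h1
    exact mul_le_mul_of_nonneg_left (h1.trans (mul_le_mul_of_nonneg_left hx.2 hN0)) hk
  -- choice of the parameter so that the travel time is one
  let T : ℝ → ℝ := fun c => ∫ x in (0:ℝ)..lam, Real.exp (-cl (h (c + k * G x)))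
  have hTc : Continuous T := by
    apply intervalIntegral.continuous_parametric_intervalIntegral_of_continuous'
    simp only [Function.uncurry_def]
    fun_prop
  have hTconst : ∀ c r : ℝ, (∀ x ∈ Icc 0 lam, cl (h (c + k * G x)) = r) →
      T c = Real.exp (L - r) := by
    intro c r hc
    have : T c = ∫ x in (0:ℝ)..lam, Real.exp (-r) := by
      apply intervalIntegral.integral_congr
      intro x hx
      rw [uIcc_of_le hlpos.le] at hx
      simp only [hc x hx]
    rw [this, intervalIntegral.integral_const, smul_eq_mul, sub_zero, hlam, ← Real.exp_add,
      sub_eq_add_neg]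
  obtain ⟨c, hc⟩ : ∃ c, T c = 1 := by
    let A : ℝ → ℝ := fun y => ∫ s in (0:ℝ)..y, a s
    have h1 : T (A (L - δ) - k * (N * lam)) = Real.exp (L - (L - δ)) := by
      apply hTconst
      intro x hx
      have : h (A (L - δ) - k * (N * lam) + k * G x) ≤ L - δ := by
        rw [← hhA (L - δ)]
        apply hhmono
        simp only [A, hhA]
        linarith [(abs_le.1 (hGb x hx)).2]
      exact max_eq_left ((min_le_left _ _).trans this)
    have h2 : T (A (L + δ) + k * (N * lam)) = Real.exp (L - (L + δ)) := by
      apply hTconst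
      intro x hx
      have : L + δ ≤ h (A (L + δ) + k * (N * lam) + k * G x) := by
        rw [← hhA (L + δ)]
        apply hhmono
        simp only [A, hhA]
        linarith [(abs_le.1 (hGb x hx)).1]
      simp only [cl, min_eq_right this]
      exact max_eq_right (by linarith)
    exact mem_range_of_exists_le_of_exists_ge hTc
      ⟨_, h2.trans_le (Real.exp_le_one_iff.2 (by linarith))⟩
      ⟨_, (Real.one_le_exp (by linarith)).trans_eq h1.symm⟩
  let V : ℝ → ℝ := fun x => h (c + k * G x)
  have hVc : Continuous V := by fun_prop
  have hVd : ∀ x, HasDerivAt V (k * g x * Real.exp ((α - 1) * cl (V x))) x := by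
    intro x
    have := (hhd (c + k * G x)).comp x (((hGd x).const_mul k).const_add c)
    refine this.congr_deriv ?_
    simp only [a, ← Real.exp_neg, neg_neg, V]
    ring
  have hcVc : Continuous fun x => Real.exp (-cl (V x)) := by fun_prop
  let τ : ℝ → ℝ := fun x => ∫ s in (0:ℝ)..x, Real.exp (-cl (V s))
  have hτd : ∀ x, HasDerivAt τ (Real.exp (-cl (V x))) x := hasDerivAt_integral_zero hcVc
  have hτ0 : τ 0 = 0 := intervalIntegral.integral_same
  have hτ1 : τ lam = 1 := hc
  obtain ⟨X, hτX, hXτ, hXmono, hXd⟩ := exists_inverse_of_hasDerivAt_ge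
    (Real.exp_pos (-(L + δ))) hτd fun x => Real.exp_le_exp.2 (neg_le_neg (hcl2 _))
  have hXc : Continuous X := continuous_iff_continuousAt.2 fun x => (hXd x).continuousAt
  have hX0 : X 0 = 0 := by simpa only [hτ0] using hXτ 0
  have hX1 : X 1 = lam := by simpa only [hτ1] using hXτ lam
  -- the clamp is inactive
  obtain ⟨x₀, hx₀, hVx₀⟩ : ∃ x₀ ∈ Icc 0 lam, V x₀ = L := by
    obtain ⟨x₀, hx₀, he⟩ := exists_hasDerivAt_eq_slope τ _ hlpos
      (fun x _ => (hτd x).continuousAt.continuousWithinAt) fun x _ => hτd x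
    refine ⟨x₀, Ioo_subset_Icc_self hx₀, ?_⟩
    rw [hτ1, hτ0, sub_zero, sub_zero, one_div, hlam, ← Real.exp_neg] at he
    have hcl : cl (V x₀) = L := neg_injective (Real.exp_injective he)
    simp only [cl] at hcl
    rcases max_choice (L - δ) (min (V x₀) (L + δ)) with h' | h'
    · linarith
    · rcases min_choice (V x₀) (L + δ) with h'' | h'' <;> linarith
  have hbound : ∀ x, |k * g x * Real.exp ((α - 1) * cl (V x))| ≤
      δ * Real.exp (-cl (V x)) := by
    intro x
    have h1 : Real.exp ((α - 1) * cl (V x)) =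
        Real.exp (α * cl (V x)) * Real.exp (-cl (V x)) := by
      rw [← Real.exp_add]; ring_nf
    have h2 : Real.exp (α * cl (V x)) ≤ Real.exp (α * (L + δ)) :=
      Real.exp_le_exp.2 (mul_le_mul_of_nonneg_left (hcl2 _) hα)
    rw [h1, abs_mul, abs_mul, abs_mul, abs_of_nonneg hk, Real.abs_exp, Real.abs_exp, ← mul_assoc]
    refine mul_le_mul_of_nonneg_right (le_trans ?_ hsmall) (Real.exp_pos _).le
    have := (abs_nonneg _).trans (hgN x)
    have := hgN x
    gcongr
  have hmono1 : Monotone fun x => δ * τ x - V x := by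
    have hd := fun x => ((hτd x).const_mul δ).fun_sub (hVd x)
    refine monotone_of_deriv_nonneg (fun x => (hd x).differentiableAt) fun x => ?_
    rw [(hd x).deriv]
    linarith [(abs_le.1 (hbound x)).2]
  have hmono2 : Monotone fun x => δ * τ x + V x := by
    have hd := fun x => ((hτd x).const_mul δ).fun_add (hVd x)
    refine monotone_of_deriv_nonneg (fun x => (hd x).differentiableAt) fun x => ?_
    rw [(hd x).deriv]
    linarith [(abs_le.1 (hbound x)).1]
  have hτmono : Monotone τ := by
    refine monotone_of_deriv_nonneg (fun x => (hτd x).differentiableAt) fun x => ?_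
    rw [(hτd x).deriv]
    exact (Real.exp_pos _).le
  have hτI : ∀ x ∈ Icc 0 lam, 0 ≤ τ x ∧ τ x ≤ 1 := fun x hx =>
    ⟨hτ0 ▸ hτmono hx.1, hτ1 ▸ hτmono hx.2⟩
  have hclV : ∀ x ∈ Icc 0 lam, cl (V x) = V x := by
    intro x hx
    have hx1 := hτI x hx
    have hx2 := hτI x₀ hx₀
    have hd : δ * |τ x - τ x₀| ≤ δ * 1 :=
      mul_le_mul_of_nonneg_left (abs_le.2 ⟨by linarith, by linarith⟩) hδ.le
    rcases le_total x x₀ with hle | hle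
    · have h1 := hmono1 hle
      have h2 := hmono2 hle
      have h3 := hτmono hle
      simp only at h1 h2
      rw [abs_of_nonpos (by linarith)] at hd
      apply hcleq <;> linarith
    · have h1 := hmono1 hle
      have h2 := hmono2 hle
      have h3 := hτmono hle
      simp only at h1 h2
      rw [abs_of_nonneg (by linarith)] at hd
      apply hcleq <;> linarith
  have hXI : ∀ t ∈ Icc (0:ℝ) 1, X t ∈ Icc 0 lam := fun t ht =>
    ⟨hX0 ▸ hXmono ht.1, hX1 ▸ hXmono ht.2⟩
  have hXd' : ∀ t, HasDerivAt X (Real.exp (cl (V (X t)))) t := fun t => by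
    have := hXd t
    rwa [← Real.exp_neg, neg_neg] at this
  refine ⟨fun t => V (X t), X, hX0, hX1, fun t ht => ?_, fun t ht => ?_, by fun_prop, hXc⟩
  · simpa only [hclV _ (hXI t ht)] using hXd' t
  · have := (hVd (X t)).comp t (hXd' t)
    rw [hclV _ (hXI t ht)] at this
    refine this.congr_deriv ?_
    rw [mul_assoc _ (Real.exp _) (Real.exp _), ← Real.exp_add]
    ring_nf

/-- Solvability of `(|x'|^{p-2} x')' = g(x)|x'|^β`, `x(0) = 0`, `x(1) = lam` for `lam > 0`. -/
theorem exists_solution_of_pos {p β : ℝ} (hp : 1 < p) (hβ : p - 1 < β) {g : ℝ → ℝ}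
    (hg : Continuous g) {N : ℝ} (hgN : ∀ x, |g x| ≤ N) (hN : 0 < N) {lam R : ℝ} (hlam : 0 < lam)
    (hR : 0 < R) (h : lam ^ (p - 1) ≤ R ^ (p - 1) - 2 * (N * R ^ β)) :
    ∃ x x' : ℝ → ℝ, Continuous x ∧ Continuous x' ∧
      (∀ t ∈ Icc (0:ℝ) 1, x t = ∫ s in (0:ℝ)..t, x' s) ∧ x 0 = 0 ∧ x 1 = lam ∧
      ∃ c : ℝ, ∀ t ∈ Icc (0:ℝ) 1,
        |x' t| ^ (p - 2) * x' t = c + ∫ s in (0:ℝ)..t, g (x s) * |x' s| ^ β := by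
  have hp1 : 0 < p - 1 := by linarith
  have hδ : N * R ^ (β - (p - 1)) ≤ (p - 1) * (Real.log R - Real.log lam) := by
    set τ := N * R ^ (β - (p - 1)) with hτ
    have hτ0 : 0 < τ := by positivity
    have hNR : N * R ^ β = τ * R ^ (p - 1) := by
      rw [hτ, mul_assoc, ← Real.rpow_add hR, sub_add_cancel]
    have hRp : 0 < R ^ (p - 1) := by positivity
    have hle : lam ^ (p - 1) ≤ R ^ (p - 1) * Real.exp (-τ) := by
      have := Real.add_one_le_exp (-τ)
      nlinarith
    have := Real.log_le_log (by positivity) hle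
    rw [Real.log_mul hRp.ne' (Real.exp_pos _).ne', Real.log_exp, Real.log_rpow hlam,
      Real.log_rpow hR] at this
    linarith
  have hδ0 : 0 < Real.log R - Real.log lam := by
    have : 0 < N * R ^ (β - (p - 1)) := by positivity
    exact pos_of_mul_pos_right (this.trans_le hδ) hp1.le
  obtain ⟨v, X, hX0, hX1, hXd, hvd, hvc, hXc⟩ :=
    exists_increasing_solution (k := (p - 1)⁻¹) (N := N) (α := β - (p - 1)) (L := Real.log lam)
      (inv_nonneg.2 hp1.le) (sub_nonneg.2 hβ.le) hδ0 hg hgN (by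
        rw [add_sub_cancel, mul_comm (β - (p - 1)), ← Real.rpow_def_of_pos hR, mul_assoc,
          inv_mul_le_iff₀ hp1]
        exact hδ)
  have hβc : Continuous fun s => g (X s) * Real.exp (β * v s) := by fun_prop
  have hsub : ∀ t ∈ Icc (0:ℝ) 1, uIcc 0 t ⊆ Icc 0 1 := fun t ht => by
    rw [uIcc_of_le ht.1]
    exact Icc_subset_Icc_right ht.2
  refine ⟨X, fun t => Real.exp (v t), hXc, by fun_prop, fun t ht => ?_, hX0,
    hX1.trans (Real.exp_log hlam), Real.exp ((p - 1) * v 0), fun t ht => ?_⟩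
  · rw [intervalIntegral.integral_eq_sub_of_hasDerivAt (fun s hs => hXd s (hsub t ht hs))
      ((by fun_prop : Continuous fun s => Real.exp (v s)).intervalIntegrable _ _), hX0, sub_zero]
  · have hpow : ∀ s, |Real.exp (v s)| ^ β = Real.exp (β * v s) := fun s => by
      rw [Real.abs_exp, ← Real.exp_mul, mul_comm]
    simp only [hpow]
    rw [intervalIntegral.integral_eq_sub_of_hasDerivAt
      (f := fun s => Real.exp ((p - 1) * v s)) (fun s hs => ?_) (hβc.intervalIntegrable _ _),
      Real.abs_exp, ← Real.exp_mul, ← Real.exp_add]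
    · ring_nf
    · refine ((hvd s (hsub t ht hs)).const_mul (p - 1)).exp.congr_deriv ?_
      have : Real.exp (β * v s) =
          Real.exp ((p - 1) * v s) * Real.exp ((β - (p - 1)) * v s) := by
        rw [← Real.exp_add]; ring_nf
      rw [this]
      field_simp

/-- Solvability of `(|x'|^{p-2} x')' = g(x)|x'|^β`, `x(0) = 0`, `x(1) = lam` for any real `lam`;
negative values reduce to positive ones by reflecting `x`. -/
theorem exists_solution {p β : ℝ} (hp : 1 < p) (hβ : p - 1 < β) {g : ℝ → ℝ}
    (hg : Continuous g) {N : ℝ} (hgN : ∀ x, |g x| ≤ N) (hN : 0 < N) {lam : ℝ}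
    (h : lam ≠ 0 → ∃ R > 0, |lam| ^ (p - 1) ≤ R ^ (p - 1) - 2 * (N * R ^ β)) :
    ∃ x x' : ℝ → ℝ, Continuous x ∧ Continuous x' ∧
      (∀ t ∈ Icc (0:ℝ) 1, x t = ∫ s in (0:ℝ)..t, x' s) ∧ x 0 = 0 ∧ x 1 = lam ∧
      ∃ c : ℝ, ∀ t ∈ Icc (0:ℝ) 1,
        |x' t| ^ (p - 2) * x' t = c + ∫ s in (0:ℝ)..t, g (x s) * |x' s| ^ β := by
  have hβ0 : β ≠ 0 := by linarith
  rcases lt_trichotomy lam 0 with hl | rfl | hl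
  · obtain ⟨R, hR, h⟩ := h hl.ne
    obtain ⟨x, x', hx, hx', hxi, hx0, hx1, c, hc⟩ :=
      exists_solution_of_pos hp hβ (g := fun s => -g (-s)) (by fun_prop)
        (fun s => by simpa using hgN (-s)) hN (neg_pos.2 hl) hR (by rwa [abs_of_neg hl] at h)
    refine ⟨fun t => -x t, fun t => -x' t, hx.neg, hx'.neg, fun t ht => ?_, by simp [hx0],
      by simp [hx1], -c, fun t ht => ?_⟩
    · simp only [intervalIntegral.integral_neg, hxi t ht]
    · have := hc t ht
      simp only [neg_mul, intervalIntegral.integral_neg] at this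
      simp only [abs_neg, mul_neg, this]
      ring
  · refine ⟨0, 0, continuous_const, continuous_const, by simp, rfl, rfl, 0, ?_⟩
    simp [Real.zero_rpow hβ0]
  · obtain ⟨R, hR, h⟩ := h hl.ne'
    exact exists_solution_of_pos hp hβ hg hgN hN hl hR (by rwa [abs_of_pos hl] at h)

/-- A sublinear power minus a linear function attains its supremum on the half line. -/
theorem exists_sSup_le_rpow_sub_mul {θ N : ℝ} (hθ0 : 0 < θ) (hθ1 : θ < 1) (hN : 0 < N) :
    ∃ z : ℝ, 0 ≤ z ∧ sSup ((fun z => (z / N) ^ θ - 2 * z) '' Ici (0:ℝ)) ≤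
      (z / N) ^ θ - 2 * z := by
  set f : ℝ → ℝ := fun z => (z / N) ^ θ - 2 * z with hf
  have hfc : Continuous f := by
    have : Continuous fun z : ℝ => z ^ θ := Real.continuous_rpow_const hθ0.le
    exact (this.comp (continuous_id.div_const N)).sub (by fun_prop)
  have hev : ∀ᶠ y in atTop, y ^ θ ≤ 2 * N * y := by
    filter_upwards [(tendsto_rpow_atTop (sub_pos.2 hθ1)).eventually_ge_atTop (2 * N)⁻¹,
      eventually_gt_atTop 0] with y hy hy0
    have h1 : y ^ (1 - θ) * y ^ θ = y := by rw [← Real.rpow_add hy0]; simp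
    have h2 : 0 < y ^ θ := by positivity
    have h3 : 1 ≤ 2 * N * y ^ (1 - θ) := by rwa [inv_le_iff_one_le_mul₀' (by positivity)] at hy
    nlinarith
  obtain ⟨Y, hY0, hY⟩ := (hev.and (eventually_ge_atTop 0)).exists_forall_of_atTop.imp
    fun Y hY => And.intro (hY Y le_rfl).2 fun y hy => (hY y hy).1
  have hNY : 0 ≤ N * Y := by positivity
  obtain ⟨z, hz, hmax⟩ := isCompact_Icc.exists_isMaxOn (nonempty_Icc.2 hNY) hfc.continuousOn
  refine ⟨z, hz.1, csSup_le (nonempty_Ici.image f) ?_⟩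
  rintro _ ⟨y, hy, rfl⟩
  rcases le_total y (N * Y) with h | h
  · exact hmax ⟨hy, h⟩
  · have h0 : f 0 ≤ f z := hmax ⟨le_rfl, hNY⟩
    have h1 : (y / N) ^ θ ≤ 2 * N * (y / N) := hY _ (by rwa [le_div_iff₀' hN])
    have h2 : 2 * N * (y / N) = 2 * y := by field_simp
    have h3 : f 0 = 0 := by simp [hf, Real.zero_rpow hθ0.ne']
    have h4 : f y = (y / N) ^ θ - 2 * y := rfl
    change f y ≤ f z
    linarith

/-- **Example 4.3, case β > p − 1** (p-Laplacian with supercritical gradient growth):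
if `|λ|^{p−1} ≤ sup_{z ≥ 0} ((z/N)^{(p−1)/β} − 2z)`, then the problem
`(|x'|^{p−2}x')' = g(x)|x'|^β`, `x(0)=0`, `x(1)=λ`, has a solution. In particular, the
problem `x'' = cos(x)(x')⁴`, `x(0)=0`, `x(1)=λ`, has a solution whenever `|λ| ≤ 3/8`. -/
theorem pLaplacian_supercritical_example
    (p β : ℝ) (hp : 1 < p) (hβ : p - 1 < β)
    (g : ℝ → ℝ) (hg : Continuous g)
    (N : ℝ) (hN : IsLUB (Set.range fun x => |g x|) N) (hNpos : 0 < N) :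
    (∀ lam : ℝ,
      |lam| ^ (p - 1) ≤ sSup ((fun z => (z / N) ^ ((p - 1) / β) - 2 * z) '' Ici (0:ℝ)) →
      ∃ x x' : ℝ → ℝ,
        IntegrableOn x' (Icc 0 1) ∧
        (∀ t ∈ Icc (0:ℝ) 1, x t = ∫ s in (0:ℝ)..t, x' s) ∧
        x 0 = 0 ∧ x 1 = lam ∧
        ∃ w : ℝ → ℝ, IntegrableOn w (Icc 0 1) ∧
          (∀ᵐ t ∂(volume.restrict (Icc (0:ℝ) 1)),
            w t = g (x t) * |x' t| ^ β) ∧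
          ∃ c : ℝ, ∀ᵐ t ∂(volume.restrict (Icc (0:ℝ) 1)),
            |x' t| ^ (p - 2) * x' t = c + ∫ s in (0:ℝ)..t, w s) ∧
    -- in particular : x'' = cos(x) (x')⁴ with x(0) = 0, x(1) = λ, for |λ| ≤ 3/8
    (∀ lam : ℝ, |lam| ≤ 3 / 8 →
      ∃ x x' : ℝ → ℝ,
        IntegrableOn x' (Icc 0 1) ∧
        (∀ t ∈ Icc (0:ℝ) 1, x t = ∫ s in (0:ℝ)..t, x' s) ∧
        x 0 = 0 ∧ x 1 = lam ∧
        ∃ w : ℝ → ℝ, IntegrableOn w (Icc 0 1) ∧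
          (∀ᵐ t ∂(volume.restrict (Icc (0:ℝ) 1)),
            w t = Real.cos (x t) * (x' t) ^ (4:ℕ)) ∧
          ∃ c : ℝ, ∀ᵐ t ∂(volume.restrict (Icc (0:ℝ) 1)),
            x' t = c + ∫ s in (0:ℝ)..t, w s) := by
  have hgN : ∀ x, |g x| ≤ N := fun x => hN.1 ⟨x, rfl⟩
  have hβ0 : 0 < β := by linarith
  have hp1 : 0 < p - 1 := by linarith
  refine ⟨fun lam hlam => ?_, fun lam hlam => ?_⟩
  · obtain ⟨x, x', hx, hx', hxi, hx0, hx1, c, hc⟩ :=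
      exists_solution hp hβ hg hgN hNpos (lam := lam) fun h0 => by
        obtain ⟨z, hz0, hz⟩ := exists_sSup_le_rpow_sub_mul
          (div_pos hp1 hβ0) ((div_lt_one hβ0).2 hβ) hNpos
        have hpos : 0 < |lam| ^ (p - 1) := Real.rpow_pos_of_pos (abs_pos.2 h0) _
        have hle := hlam.trans hz
        rcases hz0.eq_or_lt with rfl | hz0
        · rw [zero_div, Real.zero_rpow (div_pos hp1 hβ0).ne'] at hle
          linarith
        · have hzN : 0 ≤ z / N := by positivity
          refine ⟨(z / N) ^ β⁻¹, by positivity, ?_⟩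
          rwa [← Real.rpow_mul hzN, Real.rpow_inv_rpow hzN hβ0.ne', mul_div_cancel₀ _ hNpos.ne',
            inv_mul_eq_div]
    have hw : Continuous fun t => g (x t) * |x' t| ^ β :=
      (hg.comp hx).mul (hx'.abs.rpow_const fun _ => Or.inr hβ0.le)
    exact ⟨x, x', hx'.integrableOn_Icc, hxi, hx0, hx1, _, hw.integrableOn_Icc,
      ae_of_all _ fun _ => rfl, c, ae_restrict_of_forall_mem measurableSet_Icc hc⟩
  · obtain ⟨x, x', hx, hx', hxi, hx0, hx1, c, hc⟩ :=
      exists_solution (p := 2) (β := (4 : ℕ)) (by norm_num) (by norm_num) Real.continuous_cos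
        Real.abs_cos_le_one one_pos (lam := lam) fun _ => by
        refine ⟨1 / 2, by norm_num, ?_⟩
        rw [Real.rpow_natCast, show (2 : ℝ) - 1 = 1 by norm_num, Real.rpow_one, Real.rpow_one]
        linarith
    have hpow : ∀ t, |x' t| ^ ((4 : ℕ) : ℝ) = x' t ^ 4 := fun t => by
      rw [Real.rpow_natCast, Even.pow_abs (by decide)]
    simp only [hpow, sub_self, Real.rpow_zero, one_mul] at hc
    have hw : Continuous fun t => Real.cos (x t) * x' t ^ 4 := by fun_prop
    exact ⟨x, x', hx'.integrableOn_Icc, hxi, hx0, hx1, _, hw.integrableOn_Icc,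
      ae_of_all _ fun _ => rfl, c, ae_restrict_of_forall_mem measurableSet_Icc hc⟩
end

section
/- Relativistic operator example (Example 4.4). Let g ∈ L¹([0,1]) and let h : ℝ² → ℝ be continuous. Then for every λ ∈ (−1, 1) the problem ( x'(t)/√(1 − x'(t)²) )' = g(t) h(x(t), x'(t)) for a.e. t ∈ [0, 1], x(0) = 0, x(1) = λ, admits a solution x ∈ W^{1,1}([0,1]) with |x'(t)| < 1 for a.e. t ∈ [0,1]. -/
open MeasureTheory Set Filter

open scoped Topology BoundedContinuousFunction

theorem intervalIntegrable_mul_of_abs_le {F b : ℝ → ℝ} {M : ℝ}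
    (hF : ∀ s t, IntervalIntegrable F volume s t) (hb : Measurable b) (hM : ∀ s, |b s| ≤ M)
    (s t : ℝ) : IntervalIntegrable (fun r => F r * b r) volume s t := by
  have hbound : ∀ ν : Measure ℝ, ∀ᵐ r ∂ν, ‖b r‖ ≤ M := fun ν => .of_forall hM
  exact ⟨(hF s t).1.mul_bdd hb.aestronglyMeasurable (hbound _),
    (hF s t).2.mul_bdd hb.aestronglyMeasurable (hbound _)⟩

theorem abs_integral_mul_sub_le {F b : ℝ → ℝ} {M : ℝ}
    (hF : ∀ s t, IntervalIntegrable F volume s t) (hb : Measurable b) (hM : ∀ s, |b s| ≤ M)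
    (s t : ℝ) :
    |(∫ r in (0:ℝ)..t, F r * b r) - ∫ r in (0:ℝ)..s, F r * b r| ≤
      M * |(∫ r in (0:ℝ)..t, |F r|) - (∫ r in (0:ℝ)..s, |F r|)| := by
  have hFb := intervalIntegrable_mul_of_abs_le hF hb hM
  have hM0 : 0 ≤ M := (abs_nonneg _).trans (hM 0)
  rw [intervalIntegral.integral_interval_sub_left (hFb _ _) (hFb _ _),
    intervalIntegral.integral_interval_sub_left (hF _ _).abs (hF _ _).abs,
    ← abs_of_nonneg hM0, ← abs_mul, ← intervalIntegral.integral_const_mul,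
    ← Real.norm_eq_abs (∫ r in s..t, F r * b r)]
  refine intervalIntegral.norm_integral_le_abs_of_norm_le (.of_forall fun r => ?_)
    ((hF _ _).abs.const_mul M)
  rw [Real.norm_eq_abs, abs_mul, mul_comm]
  exact mul_le_mul_of_nonneg_right (hM r) (abs_nonneg _)

/-- A sequence whose increments are step weights times integrals over a uniform grid is the
primitive of the corresponding step function at the grid points. -/
theorem eq_add_integral_mul_floor {F : ℝ → ℝ} (hF : ∀ s t, IntervalIntegrable F volume s t)
    {a : ℕ → ℝ} {M : ℝ} (ha : ∀ j, |a j| ≤ M) {N : ℕ} (hN : 0 < N) {p : ℕ → ℝ}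
    (hp : ∀ j : ℕ, p (j + 1) = p j + a j * ∫ s in (j:ℝ) / N..((j + 1 : ℕ) : ℝ) / N, F s) (j : ℕ) :
    p j = p 0 + ∫ s in (0:ℝ)..(j:ℝ) / N, F s * a ⌊s * N⌋₊ := by
  have hN' : (0:ℝ) < N := by exact_mod_cast hN
  have hmeas : Measurable fun s : ℝ => a ⌊s * N⌋₊ :=
    (measurable_from_nat (f := a)).comp (Nat.measurable_floor.comp (measurable_id.mul_const _))
  have hint := intervalIntegrable_mul_of_abs_le hF hmeas (fun s => ha _)
  induction j with
  | zero => simp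
  | succ j ih =>
    have hle : (j:ℝ) / N ≤ ((j + 1 : ℕ) : ℝ) / N := by
      gcongr; simp
    have hcell : ∫ s in (j:ℝ) / N..((j + 1 : ℕ) : ℝ) / N, F s * a ⌊s * N⌋₊ =
        a j * ∫ s in (j:ℝ) / N..((j + 1 : ℕ) : ℝ) / N, F s := by
      rw [← intervalIntegral.integral_const_mul, intervalIntegral.integral_of_le hle,
        intervalIntegral.integral_of_le hle, integral_Ioc_eq_integral_Ioo,
        integral_Ioc_eq_integral_Ioo]
      refine setIntegral_congr_fun measurableSet_Ioo fun s hs => ?_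
      have h1 : (j:ℝ) ≤ s * N := ((div_lt_iff₀ hN').1 hs.1).le
      have h2 : s * N < (j:ℝ) + 1 := by
        simpa using (lt_div_iff₀ hN').1 hs.2
      have hfloor : ⌊s * N⌋₊ = j :=
        (Nat.floor_eq_iff ((Nat.cast_nonneg j).trans h1)).2 ⟨h1, h2⟩
      simp only [hfloor, mul_comm]
    rw [hp, ih, ← hcell, add_assoc,
      intervalIntegral.integral_add_adjacent_intervals (hint _ _) (hint _ _)]

/-- Forward Euler scheme with `N` steps per unit of time, started at `(0, c)`, for the system
`x' = φ y`, `y' = g k(x, y)`. -/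
noncomputable def euler (φ : ℝ → ℝ) (k : ℝ × ℝ → ℝ) (g : ℝ → ℝ) (N : ℕ) (c : ℝ) : ℕ → ℝ × ℝ
  | 0 => (0, c)
  | j + 1 =>
    ((euler φ k g N c j).1 +
        φ (euler φ k g N c j).2 * ∫ _s in (j:ℝ) / N..((j + 1 : ℕ) : ℝ) / N, (1:ℝ),
      (euler φ k g N c j).2 +
        k (euler φ k g N c j) * ∫ s in (j:ℝ) / N..((j + 1 : ℕ) : ℝ) / N, g s)

theorem continuous_euler {φ : ℝ → ℝ} (hφ : Continuous φ) {k : ℝ × ℝ → ℝ} (hk : Continuous k)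
    (g : ℝ → ℝ) (N j : ℕ) : Continuous fun c => euler φ k g N c j := by
  induction j with
  | zero => simp only [euler]; fun_prop
  | succ j ih => simp only [euler]; fun_prop

/-- The Euler scheme hits every terminal value strictly inside the range of the velocity, with an
initial value bounded independently of the mesh. -/
theorem exists_euler_shooting {φ : ℝ → ℝ} (hφ : Continuous φ) (hmono : Monotone φ)
    (hφ1 : ∀ y, |φ y| ≤ 1) {k : ℝ × ℝ → ℝ} (hk : Continuous k) {M : ℝ} (hM : ∀ q, |k q| ≤ M)
    {g : ℝ → ℝ} (hg : ∀ s t, IntervalIntegrable g volume s t) (η : ℝ) {N : ℕ} (hN : 0 < N) :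
    ∃ c : ℝ, |c - η| ≤ M * (∫ s in (0:ℝ)..1, |g s|) ∧ ∃ u v : ℝ → ℝ, Measurable u ∧ Measurable v ∧
      (∀ s, u s = ∫ r in (0:ℝ)..(⌊s * N⌋₊ : ℝ) / N, 1 * φ (v r)) ∧
      (∀ s, v s = c + ∫ r in (0:ℝ)..(⌊s * N⌋₊ : ℝ) / N, g r * k (u r, v r)) ∧
      ∫ r in (0:ℝ)..1, 1 * φ (v r) = φ η := by
  set B := M * ∫ s in (0:ℝ)..1, |g s|
  have hN' : (N:ℝ) ≠ 0 := by exact_mod_cast hN.ne'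
  have hB0 : 0 ≤ B := mul_nonneg ((abs_nonneg _).trans (hM 0))
    (intervalIntegral.integral_nonneg zero_le_one fun _ _ => abs_nonneg _)
  have hone : ∀ s t : ℝ, IntervalIntegrable (fun _ => (1:ℝ)) volume s t := fun s t =>
    intervalIntegrable_const
  have hX : ∀ c j, (euler φ k g N c j).1 =
      ∫ r in (0:ℝ)..(j:ℝ) / N, 1 * φ (euler φ k g N c ⌊r * N⌋₊).2 := fun c j => by
    simpa [euler] using eq_add_integral_mul_floor hone
      (a := fun j => φ (euler φ k g N c j).2) (fun j => hφ1 _) hN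
      (p := fun j => (euler φ k g N c j).1) (fun j => rfl) j
  have hY : ∀ c j, (euler φ k g N c j).2 =
      c + ∫ r in (0:ℝ)..(j:ℝ) / N, g r * k (euler φ k g N c ⌊r * N⌋₊) := fun c j => by
    simpa [euler] using eq_add_integral_mul_floor hg
      (a := fun j => k (euler φ k g N c j)) (fun j => hM _) hN
      (p := fun j => (euler φ k g N c j).2) (fun j => rfl) j
  have hmeas : ∀ c, Measurable fun s : ℝ => euler φ k g N c ⌊s * N⌋₊ := fun c =>
    (measurable_from_nat (f := euler φ k g N c)).comp
      (Nat.measurable_floor.comp (measurable_id.mul_const _))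
  have hend : ∀ c, (euler φ k g N c N).1 =
      ∫ r in (0:ℝ)..1, 1 * φ (euler φ k g N c ⌊r * N⌋₊).2 := fun c => by
    rw [hX, div_self hN']
  have hint : ∀ c, IntervalIntegrable (fun r => 1 * φ (euler φ k g N c ⌊r * N⌋₊).2) volume 0 1 :=
    fun c => intervalIntegrable_mul_of_abs_le hone (hφ.measurable.comp (hmeas c).snd)
      (fun s => hφ1 _) 0 1
  have hclose : ∀ c, ∀ r ∈ Icc (0:ℝ) 1, |(euler φ k g N c ⌊r * N⌋₊).2 - c| ≤ B := by
    intro c r hr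
    have h0 : (0:ℝ) ≤ (⌊r * N⌋₊ : ℝ) / N := by positivity
    have h1 : (⌊r * N⌋₊ : ℝ) / N ≤ 1 :=
      ((div_le_iff₀ (by exact_mod_cast hN)).2
        (Nat.floor_le (mul_nonneg hr.1 (Nat.cast_nonneg N)))).trans hr.2
    have h2 := abs_integral_mul_sub_le hg (hk.measurable.comp (hmeas c)) (fun s => hM _) 0
      ((⌊r * N⌋₊ : ℝ) / N)
    simp only [intervalIntegral.integral_same, sub_zero, Function.comp_def] at h2
    rw [hY, add_sub_cancel_left]
    refine h2.trans (mul_le_mul_of_nonneg_left ?_ ((abs_nonneg _).trans (hM 0)))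
    rw [abs_of_nonneg (intervalIntegral.integral_nonneg h0 fun _ _ => abs_nonneg _)]
    exact intervalIntegral.integral_mono_interval le_rfl h0 h1 (.of_forall fun _ => abs_nonneg _)
      (hg _ _).abs
  have hlow : (euler φ k g N (η - B) N).1 ≤ φ η := by
    rw [hend]
    refine (intervalIntegral.integral_mono_on zero_le_one (hint _)
      (intervalIntegrable_const (c := φ η)) fun r hr => ?_).trans (by simp)
    rw [one_mul]
    exact hmono (by linarith [(abs_le.1 (hclose (η - B) r hr)).2])
  have hhigh : φ η ≤ (euler φ k g N (η + B) N).1 := by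
    rw [hend]
    refine le_trans (by simp) (intervalIntegral.integral_mono_on zero_le_one
      (intervalIntegrable_const (c := φ η)) (hint _) fun r hr => ?_)
    rw [one_mul]
    exact hmono (by linarith [(abs_le.1 (hclose (η + B) r hr)).1])
  obtain ⟨c, hc, hcη⟩ := intermediate_value_Icc (by linarith : η - B ≤ η + B)
    (continuous_euler hφ hk g N N).fst.continuousOn ⟨hlow, hhigh⟩
  refine ⟨c, abs_le.2 ⟨by linarith [hc.1], by linarith [hc.2]⟩,
    fun s => (euler φ k g N c ⌊s * N⌋₊).1, fun s => (euler φ k g N c ⌊s * N⌋₊).2,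
    (hmeas c).fst, (hmeas c).snd, fun s => hX _ _, fun s => hY _ _, ?_⟩
  rw [← hend]
  exact hcη

/-- Bounded functions with a common modulus of continuity have a subsequence converging pointwise
on `[0, 1]` to a continuous function. -/
theorem exists_subseq_tendsto_of_modulus {f : ℕ → ℝ → ℝ} {Γ : ℝ → ℝ} (hΓ : Continuous Γ)
    (hf : ∀ n s t, |f n t - f n s| ≤ |Γ t - Γ s|) {R : ℝ} (hR : ∀ n, |f n 0| ≤ R) :
    ∃ (θ : ℕ → ℕ) (Y : ℝ → ℝ), StrictMono θ ∧ Continuous Y ∧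
      ∀ t ∈ Icc (0:ℝ) 1, Tendsto (fun n => f (θ n) t) atTop (𝓝 (Y t)) := by
  have hcont : ∀ n, Continuous (f n) := fun n => by
    refine continuous_iff_continuousAt.2 fun s => tendsto_iff_dist_tendsto_zero.2 ?_
    refine squeeze_zero (fun _ => dist_nonneg) (fun t => hf n s t) ?_
    have : Tendsto (fun t => |Γ t - Γ s|) (𝓝 s) (𝓝 |Γ s - Γ s|) :=
      ((hΓ.tendsto s).sub_const (Γ s)).abs
    simpa using this
  let F : ℕ → (Icc (0:ℝ) 1 →ᵇ ℝ) := fun n =>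
    BoundedContinuousFunction.mkOfCompact ⟨fun t => f n t, (hcont n).comp continuous_subtype_val⟩
  obtain ⟨K, hK⟩ := isCompact_Icc.exists_bound_of_continuousOn
    (hΓ.sub (continuous_const (y := Γ 0))).continuousOn (s := Icc (0:ℝ) 1)
  have hcompact : IsCompact (closure (range F)) := by
    refine BoundedContinuousFunction.arzela_ascoli (Icc (-(R + K)) (R + K)) isCompact_Icc _ ?_ ?_
    · rintro _ t ⟨n, rfl⟩
      refine abs_le.1 ?_
      have h1 := (hf n 0 t).trans (hK t t.2)
      have h2 := abs_add_le (f n t - f n 0) (f n 0)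
      rw [sub_add_cancel] at h2
      exact h2.trans (by linarith [hR n])
    · intro t
      rw [Metric.equicontinuousAt_iff]
      intro ε hε
      obtain ⟨δ, hδ, h⟩ := Metric.continuousAt_iff.1 (hΓ.continuousAt (x := (t:ℝ))) ε hε
      refine ⟨δ, hδ, ?_⟩
      rintro s hs ⟨_, n, rfl⟩
      exact (hf n s t).trans_lt (by rw [← Real.dist_eq, dist_comm]; exact h hs)
  obtain ⟨G, -, θ, hθ, hlim⟩ := hcompact.tendsto_subseq fun n => subset_closure (mem_range_self n)
  refine ⟨θ, IccExtend zero_le_one G, hθ, G.continuous.Icc_extend', fun t ht => ?_⟩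
  rw [IccExtend_of_mem _ _ ht]
  exact ((BoundedContinuousFunction.lipschitz_eval_const
    (⟨t, ht⟩ : Icc (0:ℝ) 1)).continuous.tendsto G).comp hlim

theorem tendsto_integral_mul_of_tendsto {F : ℝ → ℝ} (hF : ∀ s t, IntervalIntegrable F volume s t)
    {b : ℕ → ℝ → ℝ} {β : ℝ → ℝ} {M : ℝ} (hb : ∀ n, Measurable (b n)) (hM : ∀ n s, |b n s| ≤ M)
    (hlim : ∀ s ∈ Icc (0:ℝ) 1, Tendsto (fun n => b n s) atTop (𝓝 (β s)))
    {t : ℝ} (ht : t ∈ Icc (0:ℝ) 1) :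
    Tendsto (fun n => ∫ s in (0:ℝ)..t, F s * b n s) atTop (𝓝 (∫ s in (0:ℝ)..t, F s * β s)) := by
  refine intervalIntegral.tendsto_integral_filter_of_dominated_convergence (fun s => |F s| * M)
    (.of_forall fun n => ?_) (.of_forall fun n => .of_forall fun s _ => ?_)
    ((hF _ _).abs.mul_const M) (.of_forall fun s hs => ?_)
  · exact (intervalIntegrable_mul_of_abs_le hF (hb n) (hM n) 0 t).aestronglyMeasurable_restrict_uIoc
  · rw [Real.norm_eq_abs, abs_mul]
    exact mul_le_mul_of_nonneg_left (hM n s) (abs_nonneg _)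
  · rw [uIoc_of_le ht.1] at hs
    exact (hlim s ⟨hs.1.le, hs.2.trans ht.2⟩).const_mul _

/-- Solvability of `x' = φ y`, `y' = g k(x, y)`, `x 0 = 0`, `x 1 = φ η` for bounded `k` and
monotone bounded `φ`. -/
theorem exists_dirichlet_solution {φ : ℝ → ℝ} (hφ : Continuous φ) (hmono : Monotone φ)
    (hφ1 : ∀ y, |φ y| ≤ 1) {k : ℝ × ℝ → ℝ} (hk : Continuous k) {M : ℝ} (hM : ∀ q, |k q| ≤ M)
    {g : ℝ → ℝ} (hg : ∀ s t, IntervalIntegrable g volume s t) (η : ℝ) :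
    ∃ (c : ℝ) (Y : ℝ → ℝ), Continuous Y ∧ ∫ r in (0:ℝ)..1, φ (Y r) = φ η ∧
      ∀ t ∈ Icc (0:ℝ) 1,
        Y t = c + ∫ s in (0:ℝ)..t, g s * k (∫ r in (0:ℝ)..s, φ (Y r), Y s) := by
  have hone : ∀ s t : ℝ, IntervalIntegrable (fun _ => (1:ℝ)) volume s t := fun s t =>
    intervalIntegrable_const
  choose c hc u v hu hv hux hvy hend using fun n : ℕ =>
    exists_euler_shooting hφ hmono hφ1 hk hM hg η n.succ_pos
  have hM0 : 0 ≤ M := (abs_nonneg _).trans (hM 0)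
  have hkm : ∀ n, Measurable fun s => k (u n s, v n s) := fun n =>
    hk.measurable.comp ((hu n).prodMk (hv n))
  have hφm : ∀ n, Measurable fun s => φ (v n s) := fun n => hφ.measurable.comp (hv n)
  set y : ℕ → ℝ → ℝ := fun n t => c n + ∫ r in (0:ℝ)..t, g r * k (u n r, v n r) with hy
  set Γ : ℝ → ℝ := fun t => M * ∫ r in (0:ℝ)..t, |g r| with hΓ
  have hΓc : Continuous Γ :=
    (intervalIntegral.continuous_primitive (fun s t => (hg s t).abs) 0).const_mul M
  have hyΓ : ∀ n s t, |y n t - y n s| ≤ |Γ t - Γ s| := fun n s t => by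
    have := abs_integral_mul_sub_le hg (hkm n) (fun s => hM _) s t
    simpa only [hy, hΓ, add_sub_add_left_eq_sub, ← mul_sub, abs_mul, abs_of_nonneg hM0] using this
  have hy0 : ∀ n, |y n 0| ≤ |η| + M * ∫ s in (0:ℝ)..1, |g s| := fun n => by
    have h1 := abs_add_le (c n - η) η
    rw [sub_add_cancel] at h1
    simpa [hy] using h1.trans (by linarith [hc n])
  obtain ⟨θ, Y, hθ, hYc, hY⟩ := exists_subseq_tendsto_of_modulus hΓc hyΓ hy0
  have hgrid : ∀ s ∈ Icc (0:ℝ) 1, Tendsto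
      (fun n => (⌊s * ((θ n).succ : ℕ)⌋₊ : ℝ) / ((θ n).succ : ℕ)) atTop (𝓝 s) := fun s hs =>
    (tendsto_nat_floor_mul_div_atTop hs.1).comp (tendsto_natCast_atTop_atTop.comp
      ((tendsto_add_atTop_nat 1).comp hθ.tendsto_atTop))
  have hvlim : ∀ s ∈ Icc (0:ℝ) 1, Tendsto (fun n => v (θ n) s) atTop (𝓝 (Y s)) := by
    intro s hs
    have hdiff : Tendsto (fun n => v (θ n) s - y (θ n) s) atTop (𝓝 0) := by
      refine squeeze_zero_norm (fun n => ?_)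
        (by simpa only [sub_self, abs_zero] using
          (((hΓc.tendsto s).comp (hgrid s hs)).sub_const (Γ s)).abs)
      rw [hvy]
      exact hyΓ _ _ _
    simpa using hdiff.add (hY s hs)
  have hXlim : ∀ t ∈ Icc (0:ℝ) 1, Tendsto (fun n => ∫ r in (0:ℝ)..t, 1 * φ (v (θ n) r)) atTop
      (𝓝 (∫ r in (0:ℝ)..t, 1 * φ (Y r))) := fun t ht =>
    tendsto_integral_mul_of_tendsto hone (fun n => hφm _) (fun n s => hφ1 _)
      (fun s hs => (hφ.tendsto _).comp (hvlim s hs)) ht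
  have hulim : ∀ s ∈ Icc (0:ℝ) 1,
      Tendsto (fun n => u (θ n) s) atTop (𝓝 (∫ r in (0:ℝ)..s, 1 * φ (Y r))) := by
    intro s hs
    have hdiff : Tendsto (fun n => u (θ n) s - ∫ r in (0:ℝ)..s, 1 * φ (v (θ n) r)) atTop
        (𝓝 0) := by
      refine squeeze_zero_norm (fun n => ?_) (by simpa using ((hgrid s hs).sub_const s).abs)
      rw [hux]
      simpa using abs_integral_mul_sub_le hone (hφm (θ n)) (fun s => hφ1 _) s
        ((⌊s * ((θ n).succ : ℕ)⌋₊ : ℝ) / ((θ n).succ : ℕ))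
    simpa using hdiff.add (hXlim s hs)
  have hylim : ∀ t ∈ Icc (0:ℝ) 1, Tendsto (fun n => y (θ n) t - c (θ n)) atTop
      (𝓝 (∫ s in (0:ℝ)..t, g s * k (∫ r in (0:ℝ)..s, 1 * φ (Y r), Y s))) := by
    intro t ht
    simp only [hy, add_sub_cancel_left]
    exact tendsto_integral_mul_of_tendsto hg (fun n => hkm _) (fun n s => hM _)
      (fun s hs => (hk.tendsto _).comp ((hulim s hs).prodMk_nhds (hvlim s hs))) ht
  simp only [one_mul] at hylim hXlim hend
  refine ⟨Y 0, Y, hYc, ?_, fun t ht => ?_⟩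
  · refine tendsto_nhds_unique (hXlim 1 (right_mem_Icc.2 zero_le_one)) ?_
    simp only [hend, tendsto_const_nhds]
  · have hclim : Tendsto (fun n => c (θ n)) atTop (𝓝 (Y 0)) := by
      simpa [hy] using hY 0 (left_mem_Icc.2 zero_le_one)
    rw [← sub_eq_iff_eq_add']
    exact tendsto_nhds_unique ((hY t ht).sub hclim) (hylim t ht)

/-- **Example 4.4** (relativistic operator `Φ(s) = s/√(1−s²)`). -/
theorem relativistic_example
    (g : ℝ → ℝ) (hg : IntegrableOn g (Icc 0 1))
    (h : ℝ → ℝ → ℝ) (hh : Continuous fun q : ℝ × ℝ => h q.1 q.2)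
    (lam : ℝ) (hlam : lam ∈ Ioo (-1 : ℝ) 1) :
    ∃ x x' : ℝ → ℝ,
      IntegrableOn x' (Icc 0 1) ∧
      (∀ t ∈ Icc (0:ℝ) 1, x t = ∫ s in (0:ℝ)..t, x' s) ∧
      x 0 = 0 ∧ x 1 = lam ∧
      (∀ᵐ t ∂(volume.restrict (Icc (0:ℝ) 1)), |x' t| < 1) ∧
      ∃ w : ℝ → ℝ, IntegrableOn w (Icc 0 1) ∧
        (∀ᵐ t ∂(volume.restrict (Icc (0:ℝ) 1)),
          w t = g t * h (x t) (x' t)) ∧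
        ∃ c : ℝ, ∀ᵐ t ∂(volume.restrict (Icc (0:ℝ) 1)),
          x' t / Real.sqrt (1 - x' t ^ 2) = c + ∫ s in (0:ℝ)..t, w s := by
  set φ : ℝ → ℝ := fun y => Real.sin (Real.arctan y) with hφ
  have hφc : Continuous φ := Real.continuous_sin.comp Real.continuous_arctan
  have hφ1 : ∀ y, |φ y| < 1 := fun y => by
    rw [← sq_lt_one_iff_abs_lt_one]
    have := pow_pos (Real.cos_arctan_pos y) 2
    nlinarith [Real.sin_sq_add_cos_sq (Real.arctan y)]
  have hφinv : ∀ y, φ y / Real.sqrt (1 - φ y ^ 2) = y := fun y => by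
    have hy := Real.arctan_mem_Ioo y
    rw [← Real.tan_arcsin, Real.arcsin_sin hy.1.le hy.2.le, Real.tan_arctan]
  have hφlam : φ (Real.tan (Real.arcsin lam)) = lam := by
    simp only [hφ]
    rw [Real.arctan_tan (Real.neg_pi_div_two_lt_arcsin.2 hlam.1)
      (Real.arcsin_lt_pi_div_two.2 hlam.2), Real.sin_arcsin hlam.1.le hlam.2.le]
  set P : ℝ → ℝ := fun a => projIcc (-1 : ℝ) 1 (by norm_num) a with hP
  have hPc : Continuous P := continuous_subtype_val.comp continuous_projIcc
  set k : ℝ × ℝ → ℝ := fun q => h (P q.1) (φ q.2) with hk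
  have hkc : Continuous k :=
    hh.comp ((hPc.comp continuous_fst).prodMk (hφc.comp continuous_snd))
  obtain ⟨M, hM⟩ := ((isCompact_Icc (a := (-1:ℝ)) (b := 1)).prod
    (isCompact_Icc (a := (-1:ℝ)) (b := 1))).exists_bound_of_continuousOn hh.continuousOn
  have hkM : ∀ q, |k q| ≤ M := fun q =>
    hM (P q.1, φ q.2) ⟨Subtype.coe_prop _, abs_le.1 (hφ1 _).le⟩
  have hg' : Integrable ((Icc (0:ℝ) 1).indicator g) :=
    (integrable_indicator_iff measurableSet_Icc).2 hg
  obtain ⟨c, Y, hYc, hY1, hY⟩ := exists_dirichlet_solution hφc Real.sin_arctan_strictMono.monotone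
    (fun y => (hφ1 y).le) hkc hkM (fun s t => hg'.intervalIntegrable)
    (Real.tan (Real.arcsin lam))
  set x : ℝ → ℝ := fun t => ∫ s in (0:ℝ)..t, φ (Y s) with hx
  have hx'c : Continuous fun t => φ (Y t) := hφc.comp hYc
  have hxc : Continuous x :=
    intervalIntegral.continuous_primitive (fun s t => hx'c.intervalIntegrable s t) 0
  have hPx : ∀ t ∈ Icc (0:ℝ) 1, P (x t) = x t := by
    intro t ht
    have hle : |x t| ≤ 1 * |t - 0| := by
      rw [← Real.norm_eq_abs (x t)]
      exact intervalIntegral.norm_integral_le_of_norm_le_const fun s _ => (hφ1 (Y s)).le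
    rw [sub_zero, abs_of_nonneg ht.1, one_mul] at hle
    simp only [hP]
    rw [projIcc_of_mem _ (abs_le.1 (hle.trans ht.2))]
  refine ⟨x, fun t => φ (Y t), hx'c.integrableOn_Icc, fun t _ => rfl, by simp [hx],
    hY1.trans hφlam, .of_forall fun t => hφ1 _,
    fun t => (Icc (0:ℝ) 1).indicator g t * k (x t, Y t), ?_, ?_, c, ?_⟩
  · have hkYm : Measurable fun t => k (x t, Y t) := (hkc.comp (hxc.prodMk hYc)).measurable
    exact (hg'.mul_bdd hkYm.aestronglyMeasurable (.of_forall fun t => hkM _)).integrableOn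
  · filter_upwards [ae_restrict_mem measurableSet_Icc] with t ht
    rw [indicator_of_mem ht]
    simp only [hk, hPx t ht]
  · filter_upwards [ae_restrict_mem measurableSet_Icc] with t ht
    rw [hφinv, hY t ht]
end

section
/- Half-line example with coefficient k(t) = 1 + t² (Example 5.4). Let g : ℝ → ℝ be continuous with ‖g‖_{L^∞(ℝ)} ≤ 1, and set r₀ = (π + 4)^{−3/2}. Then for every λ ∈ ℝ with |λ| < r₀ π²/2, the problem ( (1 + t²) x'(t) )' = t² g(x(t)) (x'(t))³ for a.e. t ∈ [0, +∞), x(0) = 0, lim_{t→+∞} x(t) = λ, admits a solution. -/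
open MeasureTheory Set Filter Real

lemma abs_cos_sub_cos_le_abs_sub (a b : ℝ) : |cos a - cos b| ≤ |a - b| := by
  rw [cos_sub_cos, abs_mul, abs_mul, abs_neg, abs_two]
  have h₁ := abs_sin_le_one ((a + b) / 2)
  have h₂ : |sin ((a - b) / 2)| ≤ |(a - b) / 2| := abs_sin_le_abs
  rw [abs_div, abs_two] at h₂
  nlinarith [abs_nonneg (sin ((a + b) / 2)), abs_nonneg (sin ((a - b) / 2))]

lemma abs_intervalIntegral_sub_le {u v : ℝ → ℝ} (hu : Continuous u) (hv : Continuous v)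
    {a C : ℝ} (ha : 0 ≤ a) (h : ∀ s ∈ Icc 0 a, |u s - v s| ≤ C) :
    |(∫ s in (0:ℝ)..a, u s) - ∫ s in (0:ℝ)..a, v s| ≤ C * a := by
  rw [← intervalIntegral.integral_sub (hu.intervalIntegrable _ _) (hv.intervalIntegrable _ _)]
  have := intervalIntegral.norm_integral_le_of_norm_le_const
    (a := 0) (b := a) (f := fun s => u s - v s) (C := C) (fun s hs => by
      rw [uIoc_of_le ha] at hs
      exact h s ⟨hs.1.le, hs.2⟩)
  simpa [abs_of_nonneg ha] using this

/-- The primitive of `f` on `[0, l]`, extended to `ℝ` by constants. -/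
noncomputable def clampedPrimitive (l : ℝ) (f : ℝ → ℝ) (ξ : ℝ) : ℝ :=
  ∫ s in (0:ℝ)..max 0 (min ξ l), f s

/-- The slope at `0` of the solution of `S'' = f` on `[0, l]`, `S 0 = 0`, `S l = π / 2`. -/
noncomputable def initialSlope (l : ℝ) (f : ℝ → ℝ) : ℝ :=
  (π / 2 - ∫ s in (0:ℝ)..l, clampedPrimitive l f s) / l

/-- The solution of `S'' = f` on `[0, l]`, `S 0 = 0`, `S l = π / 2`, extended affinely. -/
noncomputable def dirichletSolution (l : ℝ) (f : ℝ → ℝ) (ξ : ℝ) : ℝ :=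
  initialSlope l f * ξ + ∫ s in (0:ℝ)..ξ, clampedPrimitive l f s

section

variable {l : ℝ} {f f₁ f₂ : ℝ → ℝ}

lemma continuous_clampedPrimitive (hf : Continuous f) : Continuous (clampedPrimitive l f) :=
  (intervalIntegral.continuous_primitive (fun _ _ => hf.intervalIntegrable _ _) 0).comp
    (by fun_prop : Continuous fun ξ : ℝ => max 0 (min ξ l))

lemma hasDerivAt_clampedPrimitive (hf : Continuous f) {ξ : ℝ} (hξ : ξ ∈ Ioo 0 l) :
    HasDerivAt (clampedPrimitive l f) (f ξ) ξ := by
  refine (intervalIntegral.integral_hasDerivAt_right (hf.intervalIntegrable 0 ξ)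
    (hf.stronglyMeasurableAtFilter _ _) hf.continuousAt).congr_of_eventuallyEq ?_
  filter_upwards [isOpen_Ioo.mem_nhds hξ] with η hη
  rw [clampedPrimitive, min_eq_left hη.2.le, max_eq_right hη.1.le]

lemma hasDerivAt_dirichletSolution (hf : Continuous f) (ξ : ℝ) :
    HasDerivAt (dirichletSolution l f) (initialSlope l f + clampedPrimitive l f ξ) ξ := by
  have hF := continuous_clampedPrimitive (l := l) hf
  have h := ((hasDerivAt_id ξ).const_mul (initialSlope l f)).add
    (intervalIntegral.integral_hasDerivAt_right (hF.intervalIntegrable 0 ξ)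
      (hF.stronglyMeasurableAtFilter _ _) hF.continuousAt)
  simp only [mul_one] at h
  exact h

lemma continuous_dirichletSolution (hf : Continuous f) : Continuous (dirichletSolution l f) :=
  continuous_iff_continuousAt.2 fun ξ => (hasDerivAt_dirichletSolution hf ξ).continuousAt

lemma dirichletSolution_zero : dirichletSolution l f 0 = 0 := by simp [dirichletSolution]

lemma dirichletSolution_right (hl : l ≠ 0) : dirichletSolution l f l = π / 2 := by
  rw [dirichletSolution, initialSlope]
  field_simp
  ring

lemma abs_clampedPrimitive_sub_le (hl : 0 ≤ l) (h₁ : Continuous f₁) (h₂ : Continuous f₂) {d : ℝ}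
    (hd : ∀ s, |f₁ s - f₂ s| ≤ d) (ξ : ℝ) :
    |clampedPrimitive l f₁ ξ - clampedPrimitive l f₂ ξ| ≤ d * l :=
  (abs_intervalIntegral_sub_le h₁ h₂ (le_max_left _ _) fun s _ => hd s).trans
    (mul_le_mul_of_nonneg_left (max_le hl (min_le_right _ _)) ((abs_nonneg _).trans (hd 0)))

lemma abs_initialSlope_sub_le (hl : 0 < l) (h₁ : Continuous f₁) (h₂ : Continuous f₂) {d : ℝ}
    (hd : ∀ s, |f₁ s - f₂ s| ≤ d) :
    |initialSlope l f₁ - initialSlope l f₂| ≤ d * l := by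
  have h := abs_intervalIntegral_sub_le (continuous_clampedPrimitive (l := l) h₁)
    (continuous_clampedPrimitive (l := l) h₂) hl.le
    (fun s _ => abs_clampedPrimitive_sub_le hl.le h₁ h₂ hd s)
  rw [initialSlope, initialSlope, ← sub_div, abs_div, abs_of_pos hl, div_le_iff₀ hl, abs_sub_comm]
  rwa [sub_sub_sub_cancel_left]

lemma abs_dirichletSolution_sub_le (hl : 0 < l) (h₁ : Continuous f₁) (h₂ : Continuous f₂) {d : ℝ}
    (hd : ∀ s, |f₁ s - f₂ s| ≤ d) {ξ : ℝ} (hξ : ξ ∈ Icc 0 l) :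
    |dirichletSolution l f₁ ξ - dirichletSolution l f₂ ξ| ≤ 2 * l ^ 2 * d := by
  have hd0 : 0 ≤ d := (abs_nonneg _).trans (hd 0)
  have hQ := abs_intervalIntegral_sub_le (continuous_clampedPrimitive (l := l) h₁)
    (continuous_clampedPrimitive (l := l) h₂) hξ.1
    (fun s _ => abs_clampedPrimitive_sub_le hl.le h₁ h₂ hd s)
  have hc := mul_le_mul_of_nonneg_right (abs_initialSlope_sub_le hl h₁ h₂ hd) hξ.1
  rw [← abs_of_nonneg hξ.1, ← abs_mul, abs_of_nonneg hξ.1] at hc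
  have hle : d * l * ξ ≤ d * l * l := mul_le_mul_of_nonneg_left hξ.2 (by positivity)
  calc |dirichletSolution l f₁ ξ - dirichletSolution l f₂ ξ|
      = |(initialSlope l f₁ - initialSlope l f₂) * ξ +
          ((∫ s in (0:ℝ)..ξ, clampedPrimitive l f₁ s) -
            ∫ s in (0:ℝ)..ξ, clampedPrimitive l f₂ s)| := by
        simp only [dirichletSolution]; ring_nf
    _ ≤ _ := abs_add_le _ _
    _ ≤ 2 * l ^ 2 * d := by linarith

end

/-- The inverse function `S` of a solution, in the variable `arctan t`, solves
`S'' = -g(ξ) sin² S cos² S`, whose right-hand side is Lipschitz in `S`. -/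
lemma exists_inverse_solution {g : ℝ → ℝ} (hg : Continuous g) (hgb : ∀ x, |g x| ≤ 1)
    {l : ℝ} (hl : 0 < l) (hl1 : l < 1) :
    ∃ p S : ℝ → ℝ, Continuous p ∧ (∃ m > 0, ∀ ξ, m ≤ p ξ) ∧ (∀ ξ, HasDerivAt S (p ξ) ξ) ∧
      S 0 = 0 ∧ S l = π / 2 ∧
      ∀ ξ ∈ Ioo 0 l, HasDerivAt p (-g ξ * ((1 - cos (4 * S ξ)) / 8)) ξ := by
  let proj : ℝ → ℝ := fun ξ => max 0 (min ξ l)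
  have hproj : Continuous proj := by fun_prop
  have hproj_mem : ∀ ξ, proj ξ ∈ Icc 0 l := fun ξ =>
    ⟨le_max_left _ _, max_le hl.le (min_le_right _ _)⟩
  let T₀ : (ℝ → ℝ) → ℝ → ℝ := fun f ξ =>
    -g ξ * ((1 - cos (4 * dirichletSolution l f (proj ξ))) / 8)
  have hT₀ : ∀ f ξ, |T₀ f ξ| ≤ 1 / 4 := by
    intro f ξ
    have h₁ : |(1 - cos (4 * dirichletSolution l f (proj ξ))) / 8| ≤ 1 / 4 := by
      have := neg_one_le_cos (4 * dirichletSolution l f (proj ξ))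
      have := cos_le_one (4 * dirichletSolution l f (proj ξ))
      rw [abs_le]; constructor <;> linarith
    simp only [T₀, abs_mul, abs_neg]
    nlinarith [hgb ξ, abs_nonneg (g ξ),
      abs_nonneg ((1 - cos (4 * dirichletSolution l f (proj ξ))) / 8)]
  have hT₀c : ∀ f, Continuous f → Continuous (T₀ f) := by
    intro f hf
    have := (continuous_dirichletSolution (l := l) hf).comp hproj
    simp only [T₀]
    exact hg.neg.mul ((continuous_const.sub
      (continuous_cos.comp (continuous_const.mul this))).div_const 8)
  let T : BoundedContinuousFunction ℝ ℝ → BoundedContinuousFunction ℝ ℝ := fun f =>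
    BoundedContinuousFunction.ofNormedAddCommGroup (T₀ f) (hT₀c f f.continuous) (1 / 4) (hT₀ f)
  have hT : ContractingWith (Real.toNNReal (l ^ 2)) T := by
    refine ⟨?_, LipschitzWith.of_dist_le_mul fun f₁ f₂ => ?_⟩
    · rw [toNNReal_lt_one]
      nlinarith
    · rw [coe_toNNReal _ (sq_nonneg l)]
      rw [BoundedContinuousFunction.dist_le (by positivity)]
      intro ξ
      have hS := abs_dirichletSolution_sub_le hl f₁.continuous f₂.continuous
        (fun s => f₁.dist_coe_le_dist (g := f₂) s) (hproj_mem ξ)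
      have hcos := abs_cos_sub_cos_le_abs_sub (4 * dirichletSolution l f₂ (proj ξ))
        (4 * dirichletSolution l f₁ (proj ξ))
      rw [← mul_sub, abs_mul, abs_of_pos (by norm_num : (0:ℝ) < 4),
        abs_sub_comm (dirichletSolution l f₂ (proj ξ))] at hcos
      change |T₀ f₁ ξ - T₀ f₂ ξ| ≤ _
      have heq : T₀ f₁ ξ - T₀ f₂ ξ = -g ξ / 8 * (cos (4 * dirichletSolution l f₂ (proj ξ)) -
          cos (4 * dirichletSolution l f₁ (proj ξ))) := by
        simp only [T₀]; ring
      rw [heq, abs_mul, abs_div, abs_neg, abs_of_pos (by norm_num : (0:ℝ) < 8)]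
      nlinarith [hgb ξ, abs_nonneg (g ξ), abs_nonneg (cos (4 * dirichletSolution l f₂ (proj ξ)) -
          cos (4 * dirichletSolution l f₁ (proj ξ)))]
  let f : BoundedContinuousFunction ℝ ℝ := hT.fixedPoint T
  have hfix : ∀ ξ, T₀ f ξ = f ξ := fun ξ =>
    congrArg (fun u : BoundedContinuousFunction ℝ ℝ => u ξ) hT.fixedPoint_isFixedPt
  have hfb : ∀ s, |f s - (0 : ℝ → ℝ) s| ≤ 1 / 4 := by
    intro s
    rw [Pi.zero_apply, sub_zero, ← hfix]
    exact hT₀ f s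
  have hc0 : Continuous (0 : ℝ → ℝ) := continuous_const
  refine ⟨fun ξ => initialSlope l f + clampedPrimitive l f ξ, dirichletSolution l f,
    continuous_const.add (continuous_clampedPrimitive f.continuous), ⟨1, one_pos, fun ξ => ?_⟩,
    hasDerivAt_dirichletSolution f.continuous, dirichletSolution_zero,
    dirichletSolution_right hl.ne', fun ξ hξ => ?_⟩
  · have h₁ := (abs_le.1 (abs_initialSlope_sub_le hl f.continuous hc0 hfb)).1
    have h₂ := (abs_le.1 (abs_clampedPrimitive_sub_le hl.le f.continuous hc0 hfb ξ)).1
    have h₃ : initialSlope l 0 = π / 2 / l := by simp [initialSlope, clampedPrimitive]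
    have h₄ : clampedPrimitive l 0 ξ = 0 := by simp [clampedPrimitive]
    have h₅ : π / 2 ≤ π / 2 / l := by
      rw [le_div_iff₀ hl]; nlinarith [pi_pos]
    dsimp only
    linarith [pi_gt_three]
  · have h := (hasDerivAt_clampedPrimitive f.continuous hξ).const_add (initialSlope l f)
    rw [← hfix] at h
    simpa only [T₀, proj, min_eq_left hξ.2.le, max_eq_right hξ.1.le] using h

lemma one_sub_cos_four_mul_arctan (t : ℝ) :
    (1 - cos (4 * arctan t)) / 8 = t ^ 2 / (1 + t ^ 2) ^ 2 := by
  have h1 : (1 + t ^ 2) ≠ 0 := by positivity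
  have hc := cos_sq_arctan t
  rw [show 4 * arctan t = 2 * (2 * arctan t) by ring, cos_two_mul, cos_two_mul, hc]
  field_simp
  ring

lemma exists_halfline_solution_of_pos {g : ℝ → ℝ} (hg : Continuous g) (hgb : ∀ x, |g x| ≤ 1)
    {l : ℝ} (hl : 0 < l) (hl1 : l < 1) :
    ∃ x x' : ℝ → ℝ,
      IntegrableOn x' (Ici 0) ∧
      (∀ t ∈ Ici (0:ℝ), x t = ∫ s in (0:ℝ)..t, x' s) ∧
      x 0 = 0 ∧ Tendsto x atTop (nhds l) ∧
      IntegrableOn (fun t => t ^ 2 * g (x t) * x' t ^ 3) (Ici 0) ∧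
      ∃ c : ℝ, ∀ t ∈ Ici (0:ℝ),
        (1 + t ^ 2) * x' t = c + ∫ s in (0:ℝ)..t, s ^ 2 * g (x s) * x' s ^ 3 := by
  obtain ⟨p, S, hp, ⟨m, hm, hmp⟩, hS, hS0, hSl, hp'⟩ := exists_inverse_solution hg hgb hl hl1
  have hppos : ∀ ξ, 0 < p ξ := fun ξ => hm.trans_le (hmp ξ)
  have hSc : Continuous S := continuous_iff_continuousAt.2 fun ξ => (hS ξ).continuousAt
  have hSmono : StrictMono S := strictMono_of_hasDerivAt_pos hS hppos
  have hmono : Monotone fun ξ => S ξ - m * ξ := by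
    refine monotone_of_hasDerivAt_nonneg (f' := fun ξ => p ξ - m) (fun ξ => ?_)
      (fun ξ => sub_nonneg.2 (hmp ξ))
    simpa using (hS ξ).fun_sub ((hasDerivAt_id' ξ).const_mul m)
  have hSsurj : Function.Surjective S := by
    refine hSc.surjective ?_ ?_
    · refine tendsto_atTop_mono' _ ?_ (tendsto_id.const_mul_atTop hm)
      filter_upwards [eventually_ge_atTop 0] with ξ hξ
      have := hmono hξ
      simp only [hS0, mul_zero, sub_zero] at this
      simpa using this
    · refine tendsto_atBot_mono' _ ?_ (tendsto_id.const_mul_atBot hm)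
      filter_upwards [eventually_le_atBot 0] with ξ hξ
      have := hmono hξ
      simp only [hS0, mul_zero, sub_zero] at this
      simpa using this
  let e := hSmono.orderIsoOfSurjective S hSsurj
  let X : ℝ → ℝ := e.symm
  have hXc : Continuous X := e.symm.continuous
  have hSX : ∀ θ, S (X θ) = θ := fun θ => e.apply_symm_apply θ
  have hXS : ∀ ξ, X (S ξ) = ξ := fun ξ => e.symm_apply_apply ξ
  have hXd : ∀ θ, HasDerivAt X (p (X θ))⁻¹ θ := fun θ =>
    HasDerivAt.of_local_left_inverse hXc.continuousAt (hS _) (hppos _).ne'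
      (Eventually.of_forall hSX)
  have hXmono : StrictMono X := e.symm.strictMono
  have hX0 : X 0 = 0 := by simpa only [hS0] using hXS 0
  have hXl : X (π / 2) = l := by simpa only [hSl] using hXS l
  let x : ℝ → ℝ := fun t => X (arctan t)
  let x' : ℝ → ℝ := fun t => (p (x t))⁻¹ * (1 / (1 + t ^ 2))
  have hxc : Continuous x := hXc.comp continuous_arctan
  have hden : ∀ t : ℝ, 1 + t ^ 2 ≠ 0 := fun t => by positivity
  have hxd : ∀ t, HasDerivAt x (x' t) t := fun t => (hXd _).comp t (hasDerivAt_arctan t)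
  have hpinv : Continuous fun t => (p (x t))⁻¹ := (hp.comp hxc).inv₀ fun t => (hppos _).ne'
  have hx'c : Continuous x' :=
    hpinv.mul (continuous_const.div (by fun_prop) hden)
  have hx0 : x 0 = 0 := by simp only [x, arctan_zero, hX0]
  have hpinv_le : ∀ ξ, (p ξ)⁻¹ ≤ m⁻¹ := fun ξ => inv_anti₀ hm (hmp ξ)
  have hx'b : ∀ t, |x' t| ≤ m⁻¹ * (1 + t ^ 2)⁻¹ := by
    intro t
    have : 0 ≤ x' t := mul_nonneg (inv_nonneg.2 (hppos _).le) (by positivity)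
    rw [abs_of_nonneg this]
    simp only [x', one_div]
    exact mul_le_mul_of_nonneg_right (hpinv_le _) (by positivity)
  have hwc : Continuous fun t => t ^ 2 * g (x t) * x' t ^ 3 := by fun_prop
  refine ⟨x, x', ?_, fun t _ => ?_, hx0, ?_, ?_, (p 0)⁻¹, fun t ht => ?_⟩
  · exact ((integrable_inv_one_add_sq.const_mul m⁻¹).mono' hx'c.aestronglyMeasurable
      (Eventually.of_forall hx'b)).integrableOn
  · rw [intervalIntegral.integral_eq_sub_of_hasDerivAt (fun s _ => hxd s)
      (hx'c.intervalIntegrable _ _), hx0, sub_zero]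
  · rw [← hXl]
    exact (hXc.tendsto _).comp (tendsto_arctan_atTop.mono_right nhdsWithin_le_nhds)
  · refine ((integrable_inv_one_add_sq.const_mul (m⁻¹ ^ 3)).mono' hwc.aestronglyMeasurable
      (Eventually.of_forall fun t => ?_)).integrableOn
    have h₁ : |x' t| ^ 3 ≤ (m⁻¹ * (1 + t ^ 2)⁻¹) ^ 3 :=
      pow_le_pow_left₀ (abs_nonneg _) (hx'b t) 3
    rw [norm_eq_abs, abs_mul, abs_mul, abs_pow, abs_pow, sq_abs]
    calc t ^ 2 * |g (x t)| * |x' t| ^ 3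
        ≤ (1 + t ^ 2) ^ 2 * 1 * (m⁻¹ * (1 + t ^ 2)⁻¹) ^ 3 := by
          have : t ^ 2 ≤ (1 + t ^ 2) ^ 2 := by nlinarith [sq_nonneg t, sq_nonneg (t ^ 2)]
          gcongr
          exact hgb _
      _ = m⁻¹ ^ 3 * (1 + t ^ 2)⁻¹ := by
          have := hden t
          field_simp
  · have hmul : ∀ s, (1 + s ^ 2) * x' s = (p (x s))⁻¹ := fun s => by
      have := hden s
      simp only [x']
      field_simp
    have hderiv : ∀ s ∈ Ioo 0 t,
        HasDerivAt (fun s => (p (x s))⁻¹) (s ^ 2 * g (x s) * x' s ^ 3) s := by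
      intro s hs
      have hxs : x s ∈ Ioo 0 l := by
        rw [← hX0, ← hXl]
        exact ⟨hXmono (arctan_pos.2 hs.1), hXmono (arctan_lt_pi_div_two s)⟩
      have h := ((hp' _ hxs).comp s (hxd s)).inv (hppos _).ne'
      refine h.congr_deriv ?_
      simp only [Function.comp_apply]
      rw [show S (x s) = arctan s from hSX _, one_sub_cos_four_mul_arctan]
      have := hden s
      have := (hppos (x s)).ne'
      simp only [x']
      field_simp
    rw [hmul, intervalIntegral.integral_eq_sub_of_hasDerivAt_of_le ht hpinv.continuousOn hderiv
      (hwc.intervalIntegrable _ _), hx0]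
    ring

lemma halfline_example_bound_lt_one : (π + 4) ^ (-(3:ℝ) / 2) * π ^ 2 / 2 < 1 := by
  have h₁ : (π + 4) ^ (-(3:ℝ) / 2) ≤ (π + 4) ^ (-1 : ℝ) :=
    rpow_le_rpow_of_exponent_le (by linarith [pi_pos]) (by norm_num)
  rw [rpow_neg_one] at h₁
  have h₂ : (π + 4)⁻¹ * π ^ 2 / 2 < 1 := by
    have := pi_pos
    rw [div_lt_one two_pos, inv_mul_lt_iff₀ (by positivity)]
    nlinarith [pi_lt_d2]
  have h₃ := mul_le_mul_of_nonneg_right h₁ (sq_nonneg π)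
  linarith

/-- **Example 5.4** (half-line problem with coefficient `k(t) = 1 + t²`):
`((1+t²)x')' = t² g(x) (x')³`, `x(0) = 0`, `x(+∞) = λ`, has a solution for every
`|λ| < r₀ π²/2` with `r₀ = (π+4)^{-3/2}`. -/
theorem halfline_example_identity
    (g : ℝ → ℝ) (hg : Continuous g) (hgbdd : ∀ x, |g x| ≤ 1)
    (r₀ : ℝ) (hr₀ : r₀ = (π + 4) ^ (-(3:ℝ) / 2))
    (lam : ℝ) (hlam : |lam| < r₀ * π ^ 2 / 2) :
    ∃ x x' : ℝ → ℝ,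
      IntegrableOn x' (Ici 0) ∧
      (∀ t ∈ Ici (0:ℝ), x t = ∫ s in (0:ℝ)..t, x' s) ∧
      x 0 = 0 ∧ Tendsto x atTop (nhds lam) ∧
      ∃ w : ℝ → ℝ, IntegrableOn w (Ici 0) ∧
        (∀ᵐ t ∂(volume.restrict (Ici (0:ℝ))),
          w t = t ^ 2 * g (x t) * (x' t) ^ (3:ℕ)) ∧
        ∃ c : ℝ, ∀ᵐ t ∂(volume.restrict (Ici (0:ℝ))),
          (1 + t ^ 2) * x' t = c + ∫ s in (0:ℝ)..t, w s := by
  have hlt : |lam| < 1 := hlam.trans (hr₀ ▸ halfline_example_bound_lt_one)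
  rcases lt_trichotomy lam 0 with h | rfl | h
  · obtain ⟨x, x', hx'i, hx, hx0, hlim, hwi, c, hw⟩ :=
      exists_halfline_solution_of_pos (g := fun y => g (-y)) (hg.comp continuous_neg)
        (fun y => hgbdd _) (neg_pos.2 h) ((neg_le_abs lam).trans_lt hlt)
    have hneg : ∀ s, s ^ 2 * g (-x s) * (-x' s) ^ 3 = -(s ^ 2 * g (-x s) * x' s ^ 3) :=
      fun s => by ring
    refine ⟨fun t => -x t, fun t => -x' t, hx'i.neg, fun t ht => ?_, by simp [hx0],
      by simpa using hlim.neg, fun t => t ^ 2 * g (-x t) * (-x' t) ^ 3, ?_,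
      Eventually.of_forall fun _ => rfl, -c, ae_restrict_of_forall_mem measurableSet_Ici ?_⟩
    · rw [intervalIntegral.integral_neg, ← hx t ht]
    · simp only [hneg]
      exact hwi.neg
    · intro t ht
      simp only [hneg]
      rw [intervalIntegral.integral_neg, mul_neg, hw t ht]
      ring
  · exact ⟨0, 0, integrableOn_zero, by simp, rfl, tendsto_const_nhds, 0, integrableOn_zero,
      by simp, 0, by simp⟩
  · obtain ⟨x, x', hx'i, hx, hx0, hlim, hwi, c, hw⟩ :=
      exists_halfline_solution_of_pos hg hgbdd h ((le_abs_self lam).trans_lt hlt)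
    exact ⟨x, x', hx'i, hx, hx0, hlim, _, hwi, Eventually.of_forall fun _ => rfl, c,
      ae_restrict_of_forall_mem measurableSet_Ici hw⟩
end
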